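/- Let d ≥ 1, let D = diag(β_1, …, β_d) with β_i ≥ 2 integers, and let (max_i β_i)^{-1} < λ < 1. Define the multivariable Takagi function G_{λ,D} : [0,1]^d → ℝ by G_{λ,D}(x) = Σ_{n=0}^∞ λ^n · d_1(D^n x, ℤ^d), where d_1(x, y) = Σ_{i=1}^d |x_i − y_i| and d_1(x, ℤ^d) = min_{k∈ℤ^d} d_1(x, k). Then the Hausdorff dimension of the graph of G_{λ,D} equals d + 1 + log λ / log(max_i β_i). -/

import Mathlib

open Set Filter MeasureTheory

noncomputable section

/-- The distance from a real number to the set of integers. -/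
def distInt (t : ℝ) : ℝ := |t - (round t : ℤ)|

/-- The multivariable Takagi function
`G_{λ,D}(x) = Σ_{n≥0} λ^n d₁(Dⁿ x, ℤ^d)` for `D = diag(β₁,…,β_d)`,
where `d₁(x,ℤ^d) = Σ_i dist(β_iⁿ x_i, ℤ)`. -/
def multiTakagi (d : ℕ) (β : Fin d → ℕ) (lam : ℝ) (x : Fin d → ℝ) : ℝ :=
  ∑' n : ℕ, lam ^ n * ∑ i, distInt ((β i : ℝ) ^ n * x i)

namespace Takagi

section Entropy

open scoped Classical in
/-- The fibre of `X` through `a` inside the finite set `A`. -/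
def fib {Ω S : Type*} (A : Finset Ω) (X : Ω → S) (a : Ω) : Finset Ω :=
  A.filter (fun b => X b = X a)

/-- The average of `f` over the finite set `A`. -/
def avg {Ω : Type*} (A : Finset Ω) (f : Ω → ℝ) : ℝ := (∑ a ∈ A, f a) / (A.card : ℝ)

/-- Shannon entropy of `X` under the uniform distribution on the finite set `A`. -/
def Ent {Ω S : Type*} (A : Finset Ω) (X : Ω → S) : ℝ :=
  avg A (fun a => Real.log ((A.card : ℝ) / ((fib A X a).card : ℝ)))

/-- Conditional entropy of `X` given `Y`. -/
def CEnt {Ω S T : Type*} (A : Finset Ω) (X : Ω → S) (Y : Ω → T) : ℝ :=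
  Ent A (fun a => (X a, Y a)) - Ent A Y

variable {Ω Ω' S T U : Type*} {A : Finset Ω}

lemma mem_fib {X : Ω → S} {a b : Ω} : b ∈ fib A X a ↔ b ∈ A ∧ X b = X a := by
  simp [fib]

lemma self_mem_fib {X : Ω → S} {a : Ω} (ha : a ∈ A) : a ∈ fib A X a := by
  simp [mem_fib, ha]

lemma fib_subset (X : Ω → S) (a : Ω) : fib A X a ⊆ A := fun _ hb => (mem_fib.1 hb).1

lemma fib_nonempty {X : Ω → S} {a : Ω} (ha : a ∈ A) : (fib A X a).Nonempty :=
  ⟨a, self_mem_fib ha⟩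

lemma card_fib_pos {X : Ω → S} {a : Ω} (ha : a ∈ A) : (0 : ℝ) < (fib A X a).card := by
  exact_mod_cast (fib_nonempty ha).card_pos

lemma card_fib_le (X : Ω → S) (a : Ω) : ((fib A X a).card : ℝ) ≤ A.card := by
  exact_mod_cast Finset.card_le_card (fib_subset X a)

lemma fib_eq {X : Ω → S} {a b : Ω} (h : X a = X b) : fib A X a = fib A X b := by
  ext c; simp [mem_fib, h]

lemma card_pos_of_mem {a : Ω} (ha : a ∈ A) : (0 : ℝ) < A.card := by
  exact_mod_cast Finset.card_pos.2 ⟨a, ha⟩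

lemma avg_mono {f g : Ω → ℝ} (h : ∀ a ∈ A, f a ≤ g a) : avg A f ≤ avg A g := by
  unfold avg
  exact div_le_div_of_nonneg_right (Finset.sum_le_sum h) (by positivity)

lemma avg_congr {f g : Ω → ℝ} (h : ∀ a ∈ A, f a = g a) : avg A f = avg A g := by
  unfold avg
  rw [Finset.sum_congr rfl h]

lemma avg_const (hA : A.Nonempty) (c : ℝ) : avg A (fun _ => c) = c := by
  have : (A.card : ℝ) ≠ 0 := by exact_mod_cast hA.card_pos.ne'
  simp [avg, this]

lemma avg_nonneg {f : Ω → ℝ} (h : ∀ a ∈ A, 0 ≤ f a) : 0 ≤ avg A f :=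
  div_nonneg (Finset.sum_nonneg h) (by positivity)

lemma avg_le_const {f : Ω → ℝ} {c : ℝ} (hc : 0 ≤ c) (h : ∀ a ∈ A, f a ≤ c) : avg A f ≤ c := by
  rcases A.eq_empty_or_nonempty with rfl | hA
  · simpa [avg] using hc
  · exact (avg_mono h).trans (avg_const hA c).le

lemma avg_le_const' (hA : A.Nonempty) {f : Ω → ℝ} {c : ℝ} (h : ∀ a ∈ A, f a ≤ c) : avg A f ≤ c :=
  (avg_mono h).trans (avg_const hA c).le

lemma const_le_avg (hA : A.Nonempty) {f : Ω → ℝ} {c : ℝ} (h : ∀ a ∈ A, c ≤ f a) : c ≤ avg A f :=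
  (avg_const hA c).ge.trans (avg_mono h)

lemma avg_add (f g : Ω → ℝ) : avg A (fun a => f a + g a) = avg A f + avg A g := by
  simp [avg, Finset.sum_add_distrib, add_div]

lemma avg_sub (f g : Ω → ℝ) : avg A (fun a => f a - g a) = avg A f - avg A g := by
  simp [avg, Finset.sum_sub_distrib, sub_div]

lemma avg_mul (c : ℝ) (f : Ω → ℝ) : avg A (fun a => c * f a) = c * avg A f := by
  simp [avg, ← Finset.mul_sum, mul_div_assoc]

lemma avg_add_const (hA : A.Nonempty) (f : Ω → ℝ) (c : ℝ) :
    avg A (fun a => f a + c) = avg A f + c := by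
  rw [avg_add, avg_const hA]

lemma sum_fib (Y : Ω → T) (g : Ω → ℝ) :
    ∑ a ∈ A, (∑ b ∈ fib A Y a, g b) / ((fib A Y a).card : ℝ) = ∑ a ∈ A, g a := by
  classical
  have h1 : ∀ a ∈ A, (∑ b ∈ fib A Y a, g b) / ((fib A Y a).card : ℝ)
      = ∑ b ∈ A, if Y b = Y a then g b / ((fib A Y b).card : ℝ) else 0 := by
    intro a ha
    rw [← Finset.sum_filter, Finset.sum_div]
    have : fib A Y a = A.filter (fun b => Y b = Y a) := by ext; simp [mem_fib]
    rw [← this]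
    refine Finset.sum_congr rfl fun b hb => ?_
    rw [fib_eq (mem_fib.1 hb).2]
  rw [Finset.sum_congr rfl h1, Finset.sum_comm]
  refine Finset.sum_congr rfl fun b hb => ?_
  rw [← Finset.sum_filter, Finset.sum_const]
  have : A.filter (fun a => Y b = Y a) = fib A Y b := by
    ext; simp [mem_fib, eq_comm]
  rw [this, nsmul_eq_mul]
  have := (card_fib_pos (X := Y) hb).ne'
  field_simp

lemma avg_fib (Y : Ω → T) (g : Ω → ℝ) : avg A (fun a => avg (fib A Y a) g) = avg A g := by
  unfold avg
  rw [sum_fib]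

lemma ent_nonneg (A : Finset Ω) (X : Ω → S) : 0 ≤ Ent A X := by
  refine avg_nonneg fun a ha => Real.log_nonneg ?_
  rw [le_div_iff₀ (card_fib_pos ha), one_mul]
  exact card_fib_le X a

lemma ent_mono {X : Ω → S} {Y : Ω → T} (h : ∀ a ∈ A, ∀ b ∈ A, Y a = Y b → X a = X b) :
    Ent A X ≤ Ent A Y := by
  refine avg_mono fun a ha => ?_
  have h0 := card_fib_pos (X := X) ha
  have h1 := card_fib_pos (X := Y) ha
  have h2 : ((fib A Y a).card : ℝ) ≤ (fib A X a).card := by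
    exact_mod_cast Finset.card_le_card fun b hb =>
      mem_fib.2 ⟨(mem_fib.1 hb).1, h b (mem_fib.1 hb).1 a ha (mem_fib.1 hb).2⟩
  have h3 := card_pos_of_mem ha
  refine Real.log_le_log (by positivity) ?_
  gcongr

lemma ent_congr {X : Ω → S} {Y : Ω → T} (h : ∀ a ∈ A, ∀ b ∈ A, Y a = Y b ↔ X a = X b) :
    Ent A X = Ent A Y :=
  le_antisymm (ent_mono fun a ha b hb => (h a ha b hb).1)
    (ent_mono fun a ha b hb => (h a ha b hb).2)

lemma cent_nonneg (A : Finset Ω) (X : Ω → S) (Y : Ω → T) : 0 ≤ CEnt A X Y :=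
  sub_nonneg.2 (ent_mono fun a _ b _ h => by simp only [Prod.mk.injEq] at h; exact h.2)

lemma cent_eq_fib (A : Finset Ω) (X : Ω → S) (Y : Ω → T) :
    CEnt A X Y = avg A (fun a => Ent (fib A Y a) X) := by
  have h1 : CEnt A X Y = avg A (fun a =>
      Real.log (((fib A Y a).card : ℝ) / ((fib A (fun a => (X a, Y a)) a).card : ℝ))) := by
    unfold CEnt Ent
    rw [← avg_sub]
    refine avg_congr fun a ha => ?_
    have h0 := card_fib_pos (X := Y) ha
    have h1 := card_fib_pos (X := fun a => (X a, Y a)) ha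
    have h2 := card_pos_of_mem ha
    rw [Real.log_div h2.ne' h1.ne', Real.log_div h2.ne' h0.ne', Real.log_div h0.ne' h1.ne']
    ring
  rw [h1, ← avg_fib Y]
  refine avg_congr fun a ha => ?_
  unfold Ent
  refine avg_congr fun b hb => ?_
  have hb' := mem_fib.1 hb
  rw [fib_eq hb'.2]
  congr 4
  ext c
  simp only [mem_fib, Prod.mk.injEq, hb'.2]
  tauto

lemma ent_gibbs (hA : A.Nonempty) (X : Ω → S) (q : S → ℝ) (hq : ∀ a ∈ A, 0 < q (X a))
    (hs : ∀ I : Finset S, (∀ s ∈ I, ∃ a ∈ A, X a = s) → ∑ s ∈ I, q s ≤ 1) :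
    Ent A X ≤ avg A (fun a => - Real.log (q (X a))) := by
  classical
  have hn : (0 : ℝ) < A.card := by exact_mod_cast hA.card_pos
  rw [← sub_nonpos]
  unfold Ent
  rw [← avg_sub]
  have h1 : ∀ a ∈ A, Real.log ((A.card : ℝ) / (fib A X a).card) - - Real.log (q (X a))
      ≤ (A.card : ℝ) * (q (X a) / (fib A X a).card) - 1 := by
    intro a ha
    have h0 := card_fib_pos (X := X) ha
    have h2 := hq a ha
    rw [sub_neg_eq_add, ← Real.log_mul (by positivity) h2.ne']
    refine (Real.log_le_sub_one_of_pos (by positivity)).trans (le_of_eq ?_)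
    ring
  refine (avg_mono h1).trans ?_
  rw [avg_sub, avg_const hA, avg_mul]
  have h2 : ∑ a ∈ A, q (X a) / ((fib A X a).card : ℝ) ≤ 1 := by
    have h3 : ∀ a ∈ A, q (X a) / ((fib A X a).card : ℝ)
        = (fun s => q s / ((A.filter (fun b => X b = s)).card : ℝ)) (X a) := by
      intro a _
      simp only
      congr 3
    rw [Finset.sum_congr rfl h3,
      Finset.sum_comp (fun s => q s / ((A.filter (fun b => X b = s)).card : ℝ)) X]
    refine le_trans (le_of_eq ?_) (hs (A.image X) (by simp))
    refine Finset.sum_congr rfl fun s hs' => ?_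
    obtain ⟨a, ha, rfl⟩ := Finset.mem_image.1 hs'
    have : (0 : ℝ) < (A.filter (fun b => X b = X a)).card := by
      exact_mod_cast Finset.card_pos.2 ⟨a, by simp [ha]⟩
    rw [nsmul_eq_mul]
    field_simp
  unfold avg
  rw [sub_nonpos, mul_div_assoc', div_le_one hn]
  nlinarith

lemma ent_le_log_card (hA : A.Nonempty) (X : Ω → S) (I : Finset S) (hI : ∀ a ∈ A, X a ∈ I) :
    Ent A X ≤ Real.log I.card := by
  obtain ⟨a0, ha0⟩ := hA
  have hc : (0 : ℝ) < I.card := by exact_mod_cast Finset.card_pos.2 ⟨_, hI a0 ha0⟩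
  refine (ent_gibbs ⟨a0, ha0⟩ X (fun _ => (I.card : ℝ)⁻¹) (fun _ _ => by positivity) ?_).trans ?_
  · intro J hJ
    have : J.card ≤ I.card := Finset.card_le_card fun s hs => by
      obtain ⟨a, ha, rfl⟩ := hJ s hs; exact hI a ha
    rw [Finset.sum_const, nsmul_eq_mul, ← div_eq_mul_inv, div_le_one hc]
    exact_mod_cast this
  · rw [avg_const ⟨a0, ha0⟩, Real.log_inv, neg_neg]

lemma ent_pair_le (A : Finset Ω) (X : Ω → S) (Y : Ω → T) :
    Ent A (fun a => (X a, Y a)) ≤ Ent A X + Ent A Y := by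
  classical
  rcases A.eq_empty_or_nonempty with rfl | hA
  · simp [Ent, avg]
  have hn : (0 : ℝ) < A.card := by exact_mod_cast hA.card_pos
  have hX : ∀ a, (fib A X a).card = (A.filter (fun b => X b = X a)).card := by
    intro a; congr 1
  have hY : ∀ a, (fib A Y a).card = (A.filter (fun b => Y b = Y a)).card := by
    intro a; congr 1
  have key := ent_gibbs hA (fun a => (X a, Y a))
    (fun p => (((A.filter (fun b => X b = p.1)).card : ℝ) / A.card)
      * (((A.filter (fun b => Y b = p.2)).card : ℝ) / A.card)) ?_ ?_
  · refine key.trans (le_of_eq ?_)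
    unfold Ent
    rw [← avg_add]
    refine avg_congr fun a ha => ?_
    have h0 := card_fib_pos (X := X) ha
    have h1 := card_fib_pos (X := Y) ha
    simp only [← hX, ← hY]
    rw [Real.log_mul (by positivity) (by positivity), Real.log_div h0.ne' hn.ne',
      Real.log_div h1.ne' hn.ne', Real.log_div hn.ne' h0.ne', Real.log_div hn.ne' h1.ne']
    ring
  · intro a ha
    have h0 := card_fib_pos (X := X) ha
    have h1 := card_fib_pos (X := Y) ha
    simp only [← hX, ← hY]
    positivity
  · intro I hI
    have hsub : I ⊆ A.image X ×ˢ A.image Y := by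
      intro s hs
      obtain ⟨a, ha, rfl⟩ := hI s hs
      simp only [Finset.mem_product, Finset.mem_image]
      exact ⟨⟨a, ha, rfl⟩, ⟨a, ha, rfl⟩⟩
    refine (Finset.sum_le_sum_of_subset_of_nonneg hsub (fun _ _ _ => by positivity)).trans ?_
    rw [Finset.sum_product]
    simp only
    rw [← Finset.sum_mul_sum, ← Finset.sum_div, ← Finset.sum_div, ← Nat.cast_sum, ← Nat.cast_sum,
      ← Finset.card_eq_sum_card_image, ← Finset.card_eq_sum_card_image, div_self hn.ne', mul_one]

lemma cent_pair_le (A : Finset Ω) (X : Ω → S) (Y : Ω → T) (Z : Ω → U) :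
    CEnt A (fun a => (X a, Y a)) Z ≤ CEnt A X Z + CEnt A Y Z := by
  simp only [cent_eq_fib]
  rw [← avg_add]
  exact avg_mono fun a _ => ent_pair_le _ _ _

/-- Submodularity: more conditioning decreases entropy. -/
lemma cent_antitone {X : Ω → S} {Y : Ω → T} {Z : Ω → U}
    (h : ∀ a ∈ A, ∀ b ∈ A, Y a = Y b → Z a = Z b) : CEnt A X Y ≤ CEnt A X Z := by
  have h1 := cent_pair_le A X Y Z
  have h2 : Ent A (fun a => ((X a, Y a), Z a)) = Ent A (fun a => (X a, Y a)) :=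
    ent_congr fun a ha b hb => by
      simp only [Prod.mk.injEq]
      have := h a ha b hb
      tauto
  have h3 : Ent A (fun a => (Y a, Z a)) = Ent A Y :=
    ent_congr fun a ha b hb => by
      simp only [Prod.mk.injEq]
      have := h a ha b hb
      tauto
  unfold CEnt at *
  linarith

lemma cent_le_ent (X : Ω → S) (Y : Ω → T) : CEnt A X Y ≤ Ent A X := by
  have := ent_pair_le A X Y
  unfold CEnt
  linarith

lemma cent_mono {X : Ω → S} {X' : Ω → T} {Y : Ω → U}
    (h : ∀ a ∈ A, ∀ b ∈ A, Y a = Y b → X' a = X' b → X a = X b) : CEnt A X Y ≤ CEnt A X' Y := by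
  unfold CEnt
  refine sub_le_sub_right (ent_mono fun a ha b hb => ?_) _
  simp only [Prod.mk.injEq]
  rintro ⟨h1, h2⟩
  exact ⟨h a ha b hb h2 h1, h2⟩

lemma cent_congr_right {X : Ω → S} {Y : Ω → T} {Z : Ω → U}
    (h : ∀ a ∈ A, ∀ b ∈ A, Y a = Y b ↔ Z a = Z b) : CEnt A X Y = CEnt A X Z :=
  le_antisymm (cent_antitone fun a ha b hb => (h a ha b hb).1)
    (cent_antitone fun a ha b hb => (h a ha b hb).2)

lemma cent_chain (X : Ω → S) (Y : Ω → T) (Z : Ω → U) :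
    CEnt A (fun a => (X a, Y a)) Z = CEnt A X (fun a => (Y a, Z a)) + CEnt A Y Z := by
  unfold CEnt
  have : Ent A (fun a => ((X a, Y a), Z a)) = Ent A (fun a => (X a, (Y a, Z a))) :=
    ent_congr fun a _ b _ => by simp only [Prod.mk.injEq]; tauto
  rw [this]
  ring

/-- `X` takes at most `M` values on each fibre of `Y`. -/
def Few (A : Finset Ω) (X : Ω → S) (Y : Ω → T) (M : ℕ) : Prop :=
  ∀ a ∈ A, ∃ I : Finset S, I.card ≤ M ∧ ∀ b ∈ A, Y b = Y a → X b ∈ I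

lemma cent_le_of_few {X : Ω → S} {Y : Ω → T} {M : ℕ} (h : Few A X Y M) :
    CEnt A X Y ≤ Real.log M := by
  rw [cent_eq_fib]
  rcases A.eq_empty_or_nonempty with rfl | hA
  · simpa [avg] using Real.log_natCast_nonneg M
  refine avg_le_const' hA fun a ha => ?_
  obtain ⟨I, hI, hX⟩ := h a ha
  have h0 : (0 : ℝ) < I.card := by
    exact_mod_cast Finset.card_pos.2 ⟨_, hX a ha rfl⟩
  refine (ent_le_log_card (fib_nonempty ha) X I fun b hb => hX b (mem_fib.1 hb).1
    (mem_fib.1 hb).2).trans (Real.log_le_log h0 (by exact_mod_cast hI))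

lemma few_int {X : Ω → ℤ} {Y : Ω → T} {K : ℕ}
    (h : ∀ a ∈ A, ∀ b ∈ A, Y a = Y b → |X a - X b| ≤ K) : Few A X Y (2 * K + 1) := by
  intro a ha
  refine ⟨Finset.Icc (X a - K) (X a + K), ?_, fun b hb hY => ?_⟩
  · rw [Int.card_Icc]; omega
  · have := abs_le.1 (h b hb a ha hY)
    rw [Finset.mem_Icc]; omega

/-- Replace the variable `X'` by `X` at bounded cost. -/
lemma cent_le_add_of_few {S' : Type*} {X : Ω → S} {X' : Ω → S'} {Y : Ω → T} {M : ℕ}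
    (h : Few A X (fun a => (X' a, Y a)) M) : CEnt A X Y ≤ CEnt A X' Y + Real.log M := by
  have h1 := cent_le_of_few h
  have h2 : CEnt A X Y ≤ CEnt A (fun a => (X a, X' a)) Y :=
    cent_mono fun a _ b _ _ h => by simp only [Prod.mk.injEq] at h; exact h.1
  rw [cent_chain] at h2
  linarith

lemma ent_le_add_of_few {X : Ω → S} {Y : Ω → T} {M : ℕ}
    (h : Few A X Y M) : Ent A X ≤ Ent A Y + Real.log M := by
  have h1 := cent_le_of_few h
  have h2 : Ent A X ≤ Ent A (fun a => (X a, Y a)) :=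
    ent_mono fun a _ b _ h => by simp only [Prod.mk.injEq] at h; exact h.1
  unfold CEnt at h1
  linarith

/-- Replace the conditioning variable `Y'` by `Y` at bounded cost. -/
lemma cent_le_add_of_few_right {T' : Type*} {X : Ω → S} {Y : Ω → T} {Y' : Ω → T'} {M : ℕ}
    (h : Few A Y' Y M) : CEnt A X Y ≤ CEnt A X Y' + Real.log M := by
  have h1 := cent_le_of_few h
  have h2 : CEnt A X Y ≤ CEnt A (fun a => (X a, Y' a)) Y :=
    cent_mono fun a _ b _ _ h => by simp only [Prod.mk.injEq] at h; exact h.1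
  rw [cent_chain] at h2
  have h3 : CEnt A X (fun a => (Y' a, Y a)) ≤ CEnt A X Y' :=
    cent_antitone fun a _ b _ h => by simp only [Prod.mk.injEq] at h; exact h.1
  linarith

lemma fib_image {Ω' : Type*} [DecidableEq Ω] {A' : Finset Ω'} {e : Ω' → Ω} (X : Ω → S) (a' : Ω') :
    fib (A'.image e) X (e a') = (fib A' (X ∘ e) a').image e := by
  ext c
  simp only [mem_fib, Finset.mem_image, Function.comp]
  constructor
  · rintro ⟨⟨b, hb, rfl⟩, h⟩; exact ⟨b, ⟨hb, h⟩, rfl⟩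
  · rintro ⟨b, ⟨hb, h⟩, rfl⟩; exact ⟨⟨b, hb, rfl⟩, h⟩

lemma avg_image {Ω' : Type*} [DecidableEq Ω] {A' : Finset Ω'} {e : Ω' → Ω} (he : Set.InjOn e A')
    (f : Ω → ℝ) : avg (A'.image e) f = avg A' (f ∘ e) := by
  unfold avg
  rw [Finset.sum_image he, Finset.card_image_of_injOn he]
  rfl

lemma ent_image {Ω' : Type*} [DecidableEq Ω] {A' : Finset Ω'} {e : Ω' → Ω} (he : Set.InjOn e A')
    (X : Ω → S) : Ent (A'.image e) X = Ent A' (X ∘ e) := by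
  unfold Ent
  rw [avg_image he]
  refine avg_congr fun a ha => ?_
  have h1 : Set.InjOn e (fib A' (X ∘ e) a) := he.mono fun b hb => (mem_fib.1 hb).1
  rw [Finset.card_image_of_injOn he]
  simp only [Function.comp_apply]
  rw [fib_image, Finset.card_image_of_injOn h1]

lemma ent_of_inj (hA : A.Nonempty) {X : Ω → S} (hX : Set.InjOn X A) :
    Ent A X = Real.log A.card := by
  unfold Ent
  rw [← avg_const hA (Real.log A.card)]
  refine avg_congr fun a ha => ?_
  have : fib A X a = {a} := by
    ext b
    simp only [mem_fib, Finset.mem_singleton]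
    constructor
    · rintro ⟨hb, h⟩; exact hX hb ha h
    · rintro rfl; exact ⟨ha, rfl⟩
  rw [this]
  simp

lemma avg_prod {Ω' : Type*} {A : Finset Ω} {A' : Finset Ω'} (f : Ω × Ω' → ℝ) :
    avg (A ×ˢ A') f = avg A (fun a => avg A' (fun b => f (a, b))) := by
  unfold avg
  rw [Finset.sum_product, Finset.card_product, ← Finset.sum_div, div_div, Nat.cast_mul,
    mul_comm (A'.card : ℝ)]

lemma cent_prod_fst {Ω' : Type*} {A : Finset Ω} {A' : Finset Ω'} (F : Ω × Ω' → S) :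
    CEnt (A ×ˢ A') F Prod.fst = avg A (fun a => Ent A' (fun b => F (a, b))) := by
  classical
  rcases A'.eq_empty_or_nonempty with rfl | hA'
  · simp [cent_eq_fib, avg, Ent]
  rw [cent_eq_fib, avg_prod]
  refine avg_congr fun a ha => ?_
  rw [← avg_const hA' (Ent A' fun b => F (a, b))]
  refine avg_congr fun b hb => ?_
  have : fib (A ×ˢ A') Prod.fst (a, b) = A'.image (fun b => (a, b)) := by
    ext ⟨x, y⟩
    simp only [mem_fib, Finset.mem_product, Finset.mem_image, Prod.mk.injEq]
    constructor
    · rintro ⟨⟨_, h⟩, rfl⟩; exact ⟨y, h, rfl, rfl⟩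
    · rintro ⟨z, h, rfl, rfl⟩; exact ⟨⟨ha, h⟩, rfl⟩
  rw [this, ent_image (fun x _ y _ h => by simpa using h)]
  rfl

lemma ent_prod_snd {Ω' : Type*} {A : Finset Ω} {A' : Finset Ω'} (hA : A.Nonempty) (X : Ω' → S) :
    Ent (A ×ˢ A') (fun p => X p.2) = Ent A' X := by
  classical
  unfold Ent
  rw [avg_prod, ← avg_const hA (avg A' _)]
  refine avg_congr fun a ha => avg_congr fun b hb => ?_
  have : fib (A ×ˢ A') (fun p => X p.2) (a, b) = A ×ˢ fib A' X b := by
    ext ⟨x, y⟩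
    simp only [mem_fib, Finset.mem_product]
    tauto
  have h0 : (A.card : ℝ) ≠ 0 := by exact_mod_cast hA.card_pos.ne'
  rw [this, Finset.card_product, Finset.card_product, Nat.cast_mul, Nat.cast_mul,
    mul_div_mul_left _ _ h0]

lemma ent_prod_fst {Ω' : Type*} {A : Finset Ω} {A' : Finset Ω'} (hA' : A'.Nonempty) (X : Ω → S) :
    Ent (A ×ˢ A') (fun p => X p.1) = Ent A X := by
  classical
  unfold Ent
  rw [avg_prod]
  refine avg_congr fun a ha => ?_
  rw [← avg_const hA' (Real.log _)]
  refine avg_congr fun b hb => ?_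
  have : fib (A ×ˢ A') (fun p => X p.1) (a, b) = fib A X a ×ˢ A' := by
    ext ⟨x, y⟩
    simp only [mem_fib, Finset.mem_product]
    tauto
  have h0 : (A'.card : ℝ) ≠ 0 := by exact_mod_cast hA'.card_pos.ne'
  rw [this, Finset.card_product, Finset.card_product, Nat.cast_mul, Nat.cast_mul,
    mul_div_mul_right _ _ h0]

/-- Average of entropies over slices is at most the entropy. -/
lemma avg_ent_le {Ω' : Type*} {A : Finset Ω} {A' : Finset Ω'} (F : Ω × Ω' → S) :
    avg A (fun a => Ent A' (fun b => F (a, b))) ≤ Ent (A ×ˢ A') F := by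
  rw [← cent_prod_fst]
  exact cent_le_ent _ _

end Entropy

/-- The data `(B, λ)` with `1/B < λ < 1`. -/
structure Sys where
  /-- the base -/
  B : ℕ
  /-- the contraction ratio -/
  lam : ℝ
  hB : 2 ≤ B
  lam_lt : lam < 1
  lt_lam : (B : ℝ)⁻¹ < lam

namespace Sys

variable (s : Sys)

lemma B_pos : (0 : ℝ) < s.B := by
  have := s.hB
  exact_mod_cast (by omega : 0 < s.B)

lemma two_le_B : (2 : ℝ) ≤ s.B := by exact_mod_cast s.hB

lemma lam_pos : 0 < s.lam := (inv_pos.2 s.B_pos).trans s.lt_lam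

/-- The contraction ratio of the slopes. -/
def gam : ℝ := 1 / (s.lam * s.B)

lemma gam_pos : 0 < s.gam := by
  have := s.B_pos; have := s.lam_pos
  unfold gam; positivity

lemma gam_lt : s.gam < 1 := by
  have h1 := s.B_pos; have h2 := s.lam_pos; have h3 := s.lt_lam
  unfold gam
  rw [div_lt_one (by positivity)]
  rwa [inv_eq_one_div, div_lt_iff₀ h1] at h3

lemma lam_gam : s.lam * s.gam = 1 / s.B := by
  have h1 := s.B_pos; have h2 := s.lam_pos
  unfold gam; field_simp

/-- `log (1/λ)`. -/
def ell : ℝ := Real.log (1 / s.lam)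

lemma ell_pos : 0 < s.ell :=
  Real.log_pos (by rw [lt_div_iff₀ s.lam_pos]; linarith [s.lam_lt])

lemma logB_pos : 0 < Real.log s.B := Real.log_pos (by linarith [s.two_le_B])

lemma ell_lt : s.ell < Real.log s.B := by
  have h1 := s.B_pos; have h2 := s.lam_pos; have h3 := s.lt_lam
  refine Real.log_lt_log (by positivity) ?_
  rw [inv_eq_one_div, div_lt_iff₀ h1] at h3
  rw [div_lt_iff₀ h2]
  linarith

/-- The sign attached to a digit. -/
def sg (d : Fin s.B) : ℝ := (-1) ^ (d : ℕ)

/-- The vertex attached to a digit. -/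
def vv (d : Fin s.B) : ℝ := (((d : ℕ) + (d : ℕ) % 2 : ℕ) : ℝ) / (2 * s.B)

lemma sg_cases (d : Fin s.B) :
    (s.sg d = 1 ∧ s.vv d = (d : ℕ) / (2 * s.B) ∧ (d : ℕ) % 2 = 0) ∨
      (s.sg d = -1 ∧ s.vv d = ((d : ℕ) + 1) / (2 * s.B) ∧ (d : ℕ) % 2 = 1) := by
  rcases Nat.mod_two_eq_zero_or_one d with h | h
  · left
    refine ⟨?_, ?_, h⟩
    · exact (Nat.even_iff.2 h).neg_one_pow
    · simp [vv, h]
  · right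
    refine ⟨?_, ?_, h⟩
    · exact (Nat.odd_iff.2 h).neg_one_pow
    · simp [vv, h]

lemma abs_sg (d : Fin s.B) : |s.sg d| = 1 := by
  simp [sg, abs_pow]

/-- Action of a word on slopes. -/
def Tl : List (Fin s.B) → ℝ → ℝ
  | [], t => t
  | d :: w, t => Tl w (1 + s.gam * s.sg d * t)

/-- The height attached to a word and an initial slope. -/
def Pl : List (Fin s.B) → ℝ → ℝ
  | [], _ => 0
  | d :: w, t => t * s.vv d + s.lam * Pl w (1 + s.gam * s.sg d * t)

/-- The position attached to a word. -/
def xl : List (Fin s.B) → ℝ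
  | [] => 0
  | d :: w => s.vv d + s.sg d * xl w / s.B

/-- The index of the interval attached to a word. -/
def ix : List (Fin s.B) → ℕ
  | [] => 0
  | d :: w => if (d : ℕ) % 2 = 0 then d * s.B ^ w.length + ix w
      else (d + 1) * s.B ^ w.length - ix w - 1

lemma Tl_append (u w : List (Fin s.B)) (t : ℝ) : s.Tl (u ++ w) t = s.Tl w (s.Tl u t) := by
  induction u generalizing t with
  | nil => rfl
  | cons d u ih => simp [Tl, ih]

lemma Pl_append (u w : List (Fin s.B)) (t : ℝ) :
    s.Pl (u ++ w) t = s.Pl u t + s.lam ^ u.length * s.Pl w (s.Tl u t) := by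
  induction u generalizing t with
  | nil => simp [Pl, Tl]
  | cons d u ih => simp [Pl, Tl, ih]; ring

lemma abs_Tl_sub (w : List (Fin s.B)) (t t' : ℝ) :
    |s.Tl w t - s.Tl w t'| = s.gam ^ w.length * |t - t'| := by
  induction w generalizing t t' with
  | nil => simp [Tl]
  | cons d w ih =>
    simp only [Tl, ih, List.length_cons]
    have : (1 + s.gam * s.sg d * t) - (1 + s.gam * s.sg d * t') = s.gam * s.sg d * (t - t') := by
      ring
    rw [this, abs_mul, abs_mul, s.abs_sg, abs_of_pos s.gam_pos]
    ring

lemma Pl_sub (w : List (Fin s.B)) (t t' : ℝ) : s.Pl w t' - s.Pl w t = (t' - t) * s.xl w := by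
  induction w generalizing t t' with
  | nil => simp [Pl, xl]
  | cons d w ih =>
    have h := ih (1 + s.gam * s.sg d * t) (1 + s.gam * s.sg d * t')
    simp only [Pl, xl]
    have h2 : s.Pl w (1 + s.gam * s.sg d * t') = s.Pl w (1 + s.gam * s.sg d * t)
        + s.gam * s.sg d * (t' - t) * s.xl w := by linear_combination h
    rw [h2]
    linear_combination (s.sg d * (t' - t) * s.xl w) * s.lam_gam

/-- The bound for invariant slopes. -/
def K : ℝ := 1 / (1 - s.gam)

lemma K_pos : 0 < s.K := one_div_pos.2 (by linarith [s.gam_lt])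

lemma K_eq : 1 + s.gam * s.K = s.K := by
  have : 1 - s.gam ≠ 0 := by linarith [s.gam_lt]
  unfold K; field_simp; ring

lemma one_le_K : 1 ≤ s.K := by
  have := s.K_eq; nlinarith [s.gam_pos, s.K_pos]

lemma step_le {t : ℝ} (ht : |t| ≤ s.K) (d : Fin s.B) : |1 + s.gam * s.sg d * t| ≤ s.K := by
  calc |1 + s.gam * s.sg d * t| ≤ |1| + |s.gam * s.sg d * t| := abs_add_le _ _
    _ = 1 + s.gam * |t| := by rw [abs_mul, abs_mul, s.abs_sg, abs_of_pos s.gam_pos]; simp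
    _ ≤ 1 + s.gam * s.K := by gcongr; exact s.gam_pos.le
    _ = s.K := s.K_eq

lemma Tl_le (w : List (Fin s.B)) {t : ℝ} (ht : |t| ≤ s.K) : |s.Tl w t| ≤ s.K := by
  induction w generalizing t with
  | nil => exact ht
  | cons d w ih => exact ih (s.step_le ht d)

lemma vv_mem (d : Fin s.B) : 0 ≤ s.vv d ∧ s.vv d ≤ 1 / 2 := by
  have h1 := s.B_pos
  have h2 : ((d : ℕ) : ℝ) + 1 ≤ s.B := by exact_mod_cast d.2
  have h3 : (0 : ℝ) ≤ (d : ℕ) := by positivity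
  rcases s.sg_cases d with ⟨_, h, _⟩ | ⟨_, h, _⟩ <;> rw [h] <;>
    refine ⟨by positivity, ?_⟩ <;> rw [div_le_div_iff₀ (by positivity) (by norm_num)] <;> linarith

/-- The bound for heights. -/
def K2 : ℝ := s.K / 2 / (1 - s.lam)

lemma K2_nonneg : 0 ≤ s.K2 := by
  have := s.K_pos; have := s.lam_lt
  exact div_nonneg (by positivity) (by linarith)

lemma K2_eq : s.K / 2 + s.lam * s.K2 = s.K2 := by
  have : 1 - s.lam ≠ 0 := by linarith [s.lam_lt]
  unfold K2; field_simp; ring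

lemma Pl_le (w : List (Fin s.B)) {t : ℝ} (ht : |t| ≤ s.K) : |s.Pl w t| ≤ s.K2 := by
  induction w generalizing t with
  | nil => simpa [Pl] using s.K2_nonneg
  | cons d w ih =>
    have h := ih (s.step_le ht d)
    have h2 := s.vv_mem d
    calc |s.Pl (d :: w) t| ≤ |t * s.vv d| + |s.lam * s.Pl w (1 + s.gam * s.sg d * t)| :=
          abs_add_le _ _
      _ = |t| * s.vv d + s.lam * |s.Pl w (1 + s.gam * s.sg d * t)| := by
          rw [abs_mul, abs_mul, abs_of_nonneg h2.1, abs_of_pos s.lam_pos]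
      _ ≤ s.K * (1 / 2) + s.lam * s.K2 := by
          gcongr
          · exact h2.1
          · exact s.K_pos.le
          · exact h2.2
          · exact s.lam_pos.le
      _ = s.K2 := by linarith [s.K2_eq]

lemma ix_lt (w : List (Fin s.B)) : s.ix w < s.B ^ w.length := by
  have hB := s.hB
  induction w with
  | nil => simp [ix]
  | cons d w ih =>
    have hd : (d : ℕ) + 1 ≤ s.B := d.2
    have h2 : ((d : ℕ) + 1) * s.B ^ w.length ≤ s.B * s.B ^ w.length := Nat.mul_le_mul_right _ hd
    have h3 : ((d : ℕ) + 1) * s.B ^ w.length = d * s.B ^ w.length + s.B ^ w.length := by ring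
    simp only [ix, List.length_cons, pow_succ']
    split_ifs <;> omega

lemma ix_inj {u w : List (Fin s.B)} (hl : u.length = w.length) (h : s.ix u = s.ix w) : u = w := by
  induction u generalizing w with
  | nil => exact (List.length_eq_zero_iff.1 hl.symm).symm
  | cons d u ih =>
    cases w with
    | nil => simp at hl
    | cons e w =>
      simp only [List.length_cons, Nat.add_right_cancel_iff] at hl
      have hu := s.ix_lt u
      have hw := s.ix_lt w
      simp only [ix] at h
      rw [hl] at h hu
      set M := s.B ^ w.length
      have h3 : ∀ d : ℕ, (d + 1) * M = d * M + M := fun d => by ring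
      have hde : (d : ℕ) = e := by
        rcases lt_trichotomy (d : ℕ) e with hlt | heq | hlt
        · exfalso
          have h4 : ((d : ℕ) + 1) * M ≤ e * M := Nat.mul_le_mul_right _ hlt
          rw [h3] at h4
          simp only [h3] at h
          split_ifs at h <;> omega
        · exact heq
        · exfalso
          have h4 : ((e : ℕ) + 1) * M ≤ d * M := Nat.mul_le_mul_right _ hlt
          rw [h3] at h4
          simp only [h3] at h
          split_ifs at h <;> omega
      have hde' : d = e := Fin.ext hde
      subst hde'
      have : s.ix u = s.ix w := by
        simp only [h3] at h
        split_ifs at h <;> omega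
      rw [ih hl this]

lemma xl_append_mem (g w : List (Fin s.B)) (hw : 0 ≤ s.xl w ∧ s.xl w ≤ 1 / 2) :
    (s.ix g : ℝ) ≤ s.xl (g ++ w) * (2 * s.B ^ g.length) ∧
      s.xl (g ++ w) * (2 * s.B ^ g.length) ≤ s.ix g + 1 := by
  have hB := s.B_pos
  induction g with
  | nil => simp [ix]; constructor <;> linarith
  | cons d g ih =>
    have hx : s.xl (d :: g ++ w) * (2 * (s.B : ℝ) ^ (d :: g).length)
        = s.vv d * (2 * s.B) * s.B ^ g.length
          + s.sg d * (s.xl (g ++ w) * (2 * s.B ^ g.length)) := by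
      simp only [xl, List.cons_append, List.length_cons, pow_succ]
      field_simp
    rw [hx]
    have hg := s.ix_lt g
    rcases s.sg_cases d with ⟨h1, h2, h3⟩ | ⟨h1, h2, h3⟩
    · have : s.ix (d :: g) = d * s.B ^ g.length + s.ix g := by simp [ix, h3]
      rw [this, h1, h2, div_mul_cancel₀ _ (by positivity)]
      push_cast
      constructor <;> linarith [ih.1, ih.2]
    · have : s.ix (d :: g) + s.ix g + 1 = (d + 1) * s.B ^ g.length := by
        have h4 : ((d : ℕ) + 1) * s.B ^ g.length = d * s.B ^ g.length + s.B ^ g.length := by ring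
        simp only [ix, h3]
        rw [if_neg (by norm_num)]
        omega
      have h4 : (s.ix (d :: g) : ℝ) + s.ix g + 1 = (d + 1) * s.B ^ g.length := by
        exact_mod_cast this
      rw [h1, h2, div_mul_cancel₀ _ (by positivity), ← h4]
      constructor <;> linarith [ih.1, ih.2]

lemma xl_mem (w : List (Fin s.B)) : 0 ≤ s.xl w ∧ s.xl w ≤ 1 / 2 := by
  have h := s.xl_append_mem w [] (by simp [xl])
  have h2 := s.ix_lt w
  have hB := s.B_pos
  rw [List.append_nil] at h
  have h3 : (0 : ℝ) < s.B ^ w.length := by positivity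
  have h4 : (s.ix w : ℝ) + 1 ≤ s.B ^ w.length := by exact_mod_cast h2
  have h5 : (0 : ℝ) ≤ s.ix w := by positivity
  constructor
  · by_contra! hc
    nlinarith
  · by_contra! hc
    nlinarith

lemma xl_append_mem' (g w : List (Fin s.B)) :
    (s.ix g : ℝ) ≤ s.xl (g ++ w) * (2 * s.B ^ g.length) ∧
      s.xl (g ++ w) * (2 * s.B ^ g.length) ≤ s.ix g + 1 :=
  s.xl_append_mem g w (s.xl_mem w)

lemma abs_Pl_sub_le (w : List (Fin s.B)) (t t' : ℝ) :
    |s.Pl w t' - s.Pl w t| ≤ |t' - t| := by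
  have := s.xl_mem w
  rw [Pl_sub, abs_mul, abs_of_nonneg this.1]
  exact mul_le_of_le_one_right (abs_nonneg _) (by linarith)

/-- Words of length `n`. -/
def W (n : ℕ) : Finset (List (Fin s.B)) := (List.finite_length_eq (Fin s.B) n).toFinset

@[simp] lemma mem_W {n : ℕ} {w : List (Fin s.B)} : w ∈ s.W n ↔ w.length = n := by
  simp [W]

lemma W_add (a b : ℕ) :
    s.W (a + b) = (s.W a ×ˢ s.W b).image (fun p => p.1 ++ p.2) := by
  ext v
  simp only [mem_W, Finset.mem_image, Finset.mem_product, Prod.exists]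
  constructor
  · intro h
    exact ⟨v.take a, v.drop a, by simp [h], List.take_append_drop a v⟩
  · rintro ⟨u, w, ⟨h1, h2⟩, rfl⟩
    simp [h1, h2]

lemma append_injOn (a b : ℕ) :
    Set.InjOn (fun p : List (Fin s.B) × List (Fin s.B) => p.1 ++ p.2) (s.W a ×ˢ s.W b : Finset _) := by
  rintro ⟨u, w⟩ h ⟨u', w'⟩ h' he
  simp only [Finset.coe_product, Set.mem_prod, Finset.mem_coe, mem_W] at h h'
  have := List.append_inj he (by rw [h.1, h'.1])
  exact Prod.ext this.1 this.2

lemma W_zero : s.W 0 = {[]} := by ext; simp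

lemma card_W (n : ℕ) : (s.W n).card = s.B ^ n := by
  induction n with
  | zero => simp [W_zero]
  | succ n ih =>
    have h1 : (s.W 1).card = s.B := by
      have : s.W 1 = (Finset.univ : Finset (Fin s.B)).image (fun d => [d]) := by
        ext w
        simp [List.length_eq_one_iff, eq_comm]
      rw [this, Finset.card_image_of_injective _ (fun a b h => by simpa using h)]
      simp
    rw [W_add, Finset.card_image_of_injOn (s.append_injOn n 1), Finset.card_product, ih, h1,
      pow_succ]

lemma W_nonempty (n : ℕ) : (s.W n).Nonempty := by
  rw [← Finset.card_pos, card_W]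
  have := s.hB
  positivity

lemma avg_W_add (a b : ℕ) (f : List (Fin s.B) → ℝ) :
    avg (s.W (a + b)) f = avg (s.W a) (fun u => avg (s.W b) (fun w => f (u ++ w))) := by
  rw [W_add, avg_image (s.append_injOn a b), avg_prod]
  rfl

lemma ent_W_add {S : Type*} (a b : ℕ) (X : List (Fin s.B) → S) :
    Ent (s.W (a + b)) X = Ent (s.W a ×ˢ s.W b) (fun p => X (p.1 ++ p.2)) := by
  rw [W_add, ent_image (s.append_injOn a b)]
  rfl

/-- The averaging operator over words of length `a`. -/
def Av (a : ℕ) (F : ℝ → ℝ) (t : ℝ) : ℝ := avg (s.W a) (fun w => F (s.Tl w t))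

lemma Av_add (a b : ℕ) (F : ℝ → ℝ) (t : ℝ) : s.Av (a + b) F t = s.Av a (s.Av b F) t := by
  unfold Av
  rw [avg_W_add]
  simp only [Tl_append]

/-- Discretisation at scale `λ^n`. -/
def fl (n : ℕ) (x : ℝ) : ℤ := ⌊x / s.lam ^ n⌋

lemma lam_pow_pos (n : ℕ) : 0 < s.lam ^ n := pow_pos s.lam_pos n

lemma abs_floor_sub_le {u v : ℝ} {k : ℕ} (h : |u - v| ≤ k) : |⌊u⌋ - ⌊v⌋| ≤ (k : ℤ) := by
  have h1 := abs_le.1 h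
  rw [abs_le]
  constructor
  · have : (⌊v⌋ : ℤ) - k ≤ ⌊u⌋ := Int.le_floor.2 (by
      push_cast; linarith [Int.floor_le v])
    linarith
  · have : (⌊u⌋ : ℤ) - k ≤ ⌊v⌋ := Int.le_floor.2 (by
      push_cast; linarith [Int.floor_le u])
    linarith

lemma fl_sub_le {n k : ℕ} {x y : ℝ} (h : |x - y| ≤ k * s.lam ^ n) :
    |s.fl n x - s.fl n y| ≤ (k : ℤ) := by
  have h0 := s.lam_pow_pos n
  refine abs_floor_sub_le ?_
  rw [← sub_div, abs_div, abs_of_pos h0, div_le_iff₀ h0]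
  exact h

lemma sub_le_of_fl_eq {n : ℕ} {x y : ℝ} (h : s.fl n x = s.fl n y) : |x - y| ≤ s.lam ^ n := by
  have h0 := s.lam_pow_pos n
  have h1 : |x / s.lam ^ n - y / s.lam ^ n| < 1 := Int.abs_sub_lt_one_of_floor_eq_floor h
  rw [← sub_div, abs_div, abs_of_pos h0, div_lt_iff₀ h0] at h1
  linarith

lemma few_fl {Ω T : Type*} {A : Finset Ω} {x : Ω → ℝ} {Y : Ω → T} {n K : ℕ}
    (h : ∀ a ∈ A, ∀ b ∈ A, Y a = Y b → |x a - x b| ≤ K * s.lam ^ n) :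
    Few A (fun a => s.fl n (x a)) Y (2 * K + 1) :=
  few_int fun a ha b hb hab => s.fl_sub_le (h a ha b hb hab)

/-- Discretised entropy of the height distribution. -/
def HH (n : ℕ) (t : ℝ) : ℝ := Ent (s.W n) (fun w => s.fl n (s.Pl w t))

/-- The function `x ↦ Σ λⁿ dist(Bⁿx, ℤ)`. -/
def H (x : ℝ) : ℝ := ∑' n : ℕ, s.lam ^ n * distInt ((s.B : ℝ) ^ n * x)

lemma log_inv_lam_pow (n : ℕ) : Real.log ((s.lam ^ n)⁻¹) = n * s.ell := by
  rw [Real.log_inv, Real.log_pow, ell, one_div, Real.log_inv]; ring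

lemma one_le_inv_lam_pow (n : ℕ) : 1 ≤ (s.lam ^ n)⁻¹ :=
  (one_le_inv₀ (s.lam_pow_pos n)).2 (pow_le_one₀ s.lam_pos.le s.lam_lt.le)

lemma cent_fl_le {Ω : Type*} {A : Finset Ω} {x y : Ω → ℝ} {n : ℕ} {k : ℝ} (hk : 0 ≤ k)
    (h : ∀ a ∈ A, |x a - y a| ≤ k * s.lam ^ n) (r : ℕ) :
    CEnt A (fun a => s.fl (n + r) (x a)) (fun a => s.fl n (y a))
      ≤ r * s.ell + Real.log (5 * (2 * k + 1)) := by
  set M := ⌈(2 * k + 1) * (s.lam ^ r)⁻¹⌉₊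
  have h1 := s.one_le_inv_lam_pow r
  have hn := s.lam_pow_pos n
  have hr := s.lam_pow_pos r
  have hM : (2 * k + 1) * (s.lam ^ r)⁻¹ ≤ M := Nat.le_ceil _
  have hM2 : (M : ℝ) < (2 * k + 1) * (s.lam ^ r)⁻¹ + 1 := Nat.ceil_lt_add_one (by positivity)
  have few : Few A (fun a => s.fl (n + r) (x a)) (fun a => s.fl n (y a)) (2 * M + 1) := by
    refine s.few_fl fun a ha b hb hab => ?_
    have h2 := s.sub_le_of_fl_eq hab
    have h3 := h a ha
    have h4 := h b hb
    have h5 : |x a - x b| ≤ (2 * k + 1) * s.lam ^ n := by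
      have : x a - x b = (x a - y a) + (y a - y b) - (x b - y b) := by ring
      rw [this]
      refine (abs_sub _ _).trans ?_
      have := abs_add_le (x a - y a) (y a - y b)
      linarith
    refine h5.trans ?_
    rw [pow_add, ← mul_assoc, mul_right_comm]
    gcongr
    rwa [← div_eq_mul_inv, div_le_iff₀ hr] at hM
  refine (cent_le_of_few few).trans ?_
  rw [← s.log_inv_lam_pow, ← Real.log_mul (by positivity) (by positivity)]
  refine Real.log_le_log (by positivity) ?_
  push_cast
  nlinarith

/-- The integer version of the height bound. -/
def KK : ℕ := ⌈s.K2⌉₊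

lemma K2_le_KK : s.K2 ≤ s.KK := Nat.le_ceil _

lemma few_prefix {Ω : Type*} {A : Finset Ω} {x y : Ω → ℝ} {n r : ℕ} {k : ℕ}
    (h : ∀ a ∈ A, |x a - y a| ≤ k * s.lam ^ n) :
    Few A (fun a => s.fl n (y a)) (fun a => s.fl (n + r) (x a)) (2 * (2 * k + 1) + 1) := by
  refine s.few_fl fun a ha b hb hab => ?_
  have h2 := s.sub_le_of_fl_eq hab
  have h3 := h a ha
  have h4 := h b hb
  have h5 : s.lam ^ (n + r) ≤ s.lam ^ n :=
    pow_le_pow_of_le_one s.lam_pos.le s.lam_lt.le (by omega)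
  have : y a - y b = (x a - x b) - (x a - y a) + (x b - y b) := by ring
  rw [this]
  push_cast
  have h6 := abs_add_le ((x a - x b) - (x a - y a)) (x b - y b)
  have h7 := abs_sub (x a - x b) (x a - y a)
  linarith

/-- The constant in the superadditivity estimate. -/
def C0 : ℝ := Real.log ((2 * (2 * s.KK + 1) + 1 : ℕ) : ℝ) + Real.log 3

lemma C0_nonneg : 0 ≤ s.C0 :=
  add_nonneg (Real.log_natCast_nonneg _) (Real.log_nonneg (by norm_num))

lemma Pl_append_sub_le {u w : List (Fin s.B)} {a : ℕ} (hu : u.length = a) {t : ℝ}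
    (ht : |t| ≤ s.K) : |s.Pl (u ++ w) t - s.Pl u t| ≤ s.K2 * s.lam ^ a := by
  rw [Pl_append, add_sub_cancel_left, abs_mul, abs_of_pos (s.lam_pow_pos _), mul_comm, hu]
  have := s.lam_pow_pos a
  gcongr
  exact s.Pl_le w (s.Tl_le u ht)

lemma Pl_append_sub_le' {u w : List (Fin s.B)} {a : ℕ} (hu : u.length = a) {t : ℝ}
    (ht : |t| ≤ s.K) : |s.Pl (u ++ w) t - s.Pl u t| ≤ s.KK * s.lam ^ a := by
  refine (s.Pl_append_sub_le hu ht).trans ?_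
  have := s.lam_pow_pos a
  gcongr
  exact s.K2_le_KK

lemma superadd (a b : ℕ) {t : ℝ} (ht : |t| ≤ s.K) :
    s.HH a t + s.Av a (s.HH b) t ≤ s.HH (a + b) t + s.C0 := by
  set A := s.W a ×ˢ s.W b
  set Z : List (Fin s.B) × List (Fin s.B) → ℤ := fun p => s.fl (a + b) (s.Pl (p.1 ++ p.2) t)
  set R : List (Fin s.B) × List (Fin s.B) → ℤ := fun p => s.fl a (s.Pl p.1 t)
  have h1 : s.HH (a + b) t = Ent A Z := s.ent_W_add a b _
  have h2 : Ent A R = s.HH a t := ent_prod_fst (s.W_nonempty b) (fun u => s.fl a (s.Pl u t))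
  have h3 : CEnt A R Z ≤ Real.log ((2 * (2 * s.KK + 1) + 1 : ℕ) : ℝ) := by
    refine cent_le_of_few (s.few_prefix (k := s.KK) fun p hp => ?_)
    simp only [A, Finset.mem_product, mem_W] at hp
    exact s.Pl_append_sub_le' hp.1 ht
  have h4 : CEnt A Z Prod.fst ≤ CEnt A Z R := cent_antitone fun p _ q _ h => by
    simp only [R, h]
  have h5 : s.Av a (s.HH b) t ≤ CEnt A Z Prod.fst + Real.log 3 := by
    have h6 : s.Av a (s.HH b) t
        = CEnt A (fun p => s.fl b (s.Pl p.2 (s.Tl p.1 t))) Prod.fst := by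
      rw [cent_prod_fst]; rfl
    rw [h6]
    have : (3 : ℝ) = ((2 * 1 + 1 : ℕ) : ℝ) := by norm_num
    rw [this]
    refine cent_le_add_of_few (s.few_fl fun p hp q hq hpq => ?_)
    simp only [A, Finset.mem_product, mem_W] at hp hq
    simp only [Prod.mk.injEq, Z] at hpq
    have h7 := s.sub_le_of_fl_eq hpq.1
    rw [Pl_append, Pl_append, hp.1, hq.1, hpq.2] at h7
    have h8 := s.lam_pow_pos a
    have h9 : s.Pl q.1 t + s.lam ^ a * s.Pl p.2 (s.Tl q.1 t)
        - (s.Pl q.1 t + s.lam ^ a * s.Pl q.2 (s.Tl q.1 t))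
        = s.lam ^ a * (s.Pl p.2 (s.Tl q.1 t) - s.Pl q.2 (s.Tl q.1 t)) := by ring
    rw [h9, abs_mul, abs_of_pos h8, pow_add, mul_le_mul_iff_right₀ h8] at h7
    rw [hpq.2]
    simpa using h7
  have h6 : Ent A (fun p => (R p, Z p)) = Ent A (fun p => (Z p, R p)) :=
    ent_congr fun p _ q _ => by simp only [Prod.mk.injEq]; tauto
  unfold CEnt at h3 h4 h5
  unfold C0
  rw [h6] at h3
  linarith

lemma HH_add_le (n r : ℕ) {t : ℝ} (ht : |t| ≤ s.K) :
    s.HH (n + r) t ≤ s.HH n t + (r * s.ell + Real.log (5 * (2 * s.K2 + 1))) := by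
  set A := s.W n ×ˢ s.W r
  set Z : List (Fin s.B) × List (Fin s.B) → ℤ := fun p => s.fl (n + r) (s.Pl (p.1 ++ p.2) t)
  set R : List (Fin s.B) × List (Fin s.B) → ℤ := fun p => s.fl n (s.Pl p.1 t)
  have h1 : s.HH (n + r) t = Ent A Z := s.ent_W_add n r _
  have h2 : Ent A R = s.HH n t := ent_prod_fst (s.W_nonempty r) (fun u => s.fl n (s.Pl u t))
  have h3 : CEnt A Z R ≤ r * s.ell + Real.log (5 * (2 * s.K2 + 1)) := by
    refine s.cent_fl_le s.K2_nonneg (fun p hp => ?_) r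
    simp only [A, Finset.mem_product, mem_W] at hp
    exact s.Pl_append_sub_le hp.1 ht
  have h4 : Ent A Z ≤ Ent A (fun p => (Z p, R p)) := ent_mono fun p _ q _ h => by
    simp only [Prod.mk.injEq] at h; exact h.1
  unfold CEnt at h3
  linarith

lemma HH_nonneg (n : ℕ) (t : ℝ) : 0 ≤ s.HH n t := ent_nonneg _ _

lemma HH_le (n : ℕ) {t : ℝ} (ht : |t| ≤ s.K) :
    s.HH n t ≤ n * s.ell + Real.log (5 * (2 * s.K2 + 1)) := by
  have h := s.HH_add_le 0 n ht
  have h0 : s.HH 0 t = 0 := by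
    unfold HH
    rw [W_zero, ent_of_inj (by simp) (by simp)]
    simp
  rw [zero_add] at h
  linarith

lemma zero_mem : |(0 : ℝ)| ≤ s.K := by simpa using s.K_pos.le

lemma exists_rate : ∃ P C : ℝ, 0 ≤ C ∧ P ≤ s.ell ∧
    (∀ n : ℕ, ∃ t, |t| ≤ s.K ∧ s.HH n t ≤ P * n + C) ∧
    ∀ ε > 0, ∃ Ce : ℝ, 0 ≤ Ce ∧ ∀ (n : ℕ) (t : ℝ), |t| ≤ s.K → (P - ε) * n - Ce ≤ s.HH n t := by
  set I : Set ℝ := {t | |t| ≤ s.K}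
  have hI : I.Nonempty := ⟨0, s.zero_mem⟩
  set h : ℕ → ℝ := fun n => sInf (s.HH n '' I)
  have hbdd : ∀ n, BddBelow (s.HH n '' I) := fun n => ⟨0, by
    rintro _ ⟨t, _, rfl⟩; exact s.HH_nonneg n t⟩
  have hle : ∀ n t, |t| ≤ s.K → h n ≤ s.HH n t := fun n t ht => csInf_le (hbdd n) ⟨t, ht, rfl⟩
  have hnn : ∀ n, 0 ≤ h n := fun n => le_csInf (hI.image _) (by
    rintro _ ⟨t, _, rfl⟩; exact s.HH_nonneg n t)
  have hsup : ∀ m n, h m + h n ≤ h (m + n) + s.C0 := by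
    intro m n
    have : h m + h n - s.C0 ≤ h (m + n) := by
      refine le_csInf (hI.image _) ?_
      rintro _ ⟨t, ht, rfl⟩
      have h1 := s.superadd m n ht
      have h2 : h n ≤ s.Av m (s.HH n) t :=
        const_le_avg (s.W_nonempty m) fun w _ => hle n _ (s.Tl_le w ht)
      have h3 := hle m t ht
      linarith
    linarith
  set u : ℕ → ℝ := fun n => s.C0 - h n
  have hu : Subadditive u := fun m n => by simp only [u]; linarith [hsup m n]
  set D := Real.log (5 * (2 * s.K2 + 1))
  have hD : 0 ≤ D := Real.log_nonneg (by linarith [s.K2_nonneg])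
  have hlow : ∀ n : ℕ, n ≠ 0 → -s.ell - D / n ≤ u n / n := by
    intro n hn
    have hn' : (0 : ℝ) < n := by positivity
    have := (hle n 0 s.zero_mem).trans (s.HH_le n s.zero_mem)
    have h4 := s.C0_nonneg
    rw [le_div_iff₀ hn', sub_mul, div_mul_cancel₀ _ hn'.ne']
    simp only [u]
    linarith
  have hb : BddBelow (Set.range fun n => u n / n) := by
    refine ⟨min 0 (-s.ell - D), ?_⟩
    rintro _ ⟨n, rfl⟩
    rcases eq_or_ne n 0 with rfl | hn
    · simp
    · refine (min_le_right _ _).trans (le_trans ?_ (hlow n hn))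
      have : D / n ≤ D := div_le_self hD (by exact_mod_cast Nat.one_le_iff_ne_zero.2 hn)
      linarith
  have hlim := hu.tendsto_lim hb
  refine ⟨-hu.lim, s.C0 + 1, by linarith [s.C0_nonneg], ?_, fun n => ?_, fun ε hε => ?_⟩
  · have h1 : Tendsto (fun n : ℕ => -s.ell - D / n) atTop (nhds (-s.ell - 0)) :=
      tendsto_const_nhds.sub (tendsto_const_div_atTop_nhds_zero_nat D)
    have h2 : -s.ell - 0 ≤ hu.lim := le_of_tendsto_of_tendsto h1 hlim
      (eventually_atTop.2 ⟨1, fun n hn => hlow n (by omega)⟩)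
    linarith
  · obtain ⟨_, ⟨t, ht, rfl⟩, hlt⟩ := exists_lt_of_csInf_lt (hI.image (s.HH n))
      (show sInf (s.HH n '' I) < h n + 1 by simp only [h]; linarith)
    refine ⟨t, ht, ?_⟩
    have : h n ≤ -hu.lim * n + s.C0 := by
      rcases eq_or_ne n 0 with rfl | hn
      · have := (hle 0 0 s.zero_mem)
        have h0 : s.HH 0 0 = 0 := by
          unfold HH
          rw [W_zero, ent_of_inj (by simp) (by simp)]
          simp
        simp only [Nat.cast_zero, mul_zero]
        linarith [s.C0_nonneg]
      · have h1 := hu.lim_le_div hb hn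
        have hn' : (0 : ℝ) < n := by positivity
        rw [le_div_iff₀ hn'] at h1
        simp only [u] at h1
        linarith
    linarith
  · have h1 := hlim.eventually (gt_mem_nhds (show hu.lim < hu.lim + ε by linarith))
    obtain ⟨N, hN⟩ := eventually_atTop.1 h1
    refine ⟨max 0 (|(-hu.lim - ε)| * (N + 1)), le_max_left _ _,
      fun n t ht => ?_⟩
    rcases le_or_gt (N + 1) n with hn | hn
    · have h2 := hN n (by omega)
      have hn' : (0 : ℝ) < n := by exact_mod_cast (by omega : 0 < n)
      rw [div_lt_iff₀ hn'] at h2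
      simp only [u] at h2
      have := hle n t ht
      have := le_max_left 0 (|(-hu.lim - ε)| * (N + 1))
      linarith [s.C0_nonneg]
    · have h3 : (-hu.lim - ε) * n ≤ |(-hu.lim - ε)| * (N + 1) := by
        have : (n : ℝ) ≤ N + 1 := by exact_mod_cast hn.le
        exact mul_le_mul (le_abs_self _) this (by positivity) (abs_nonneg _)
      have := le_max_right 0 (|(-hu.lim - ε)| * (N + 1))
      have := s.HH_nonneg n t
      linarith

/-- Bounded on the invariant interval of slopes. -/
def BD (F : ℝ → ℝ) : Prop := ∃ M : ℝ, ∀ t, |t| ≤ s.K → |F t| ≤ M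

variable {s}

lemma BD.add {F G : ℝ → ℝ} (hF : s.BD F) (hG : s.BD G) : s.BD (fun t => F t + G t) := by
  obtain ⟨M, hM⟩ := hF
  obtain ⟨M', hM'⟩ := hG
  exact ⟨M + M', fun t ht => (abs_add_le _ _).trans (add_le_add (hM t ht) (hM' t ht))⟩

lemma BD.mul {F : ℝ → ℝ} (hF : s.BD F) (c : ℝ) : s.BD (fun t => c * F t) := by
  obtain ⟨M, hM⟩ := hF
  exact ⟨|c| * M, fun t ht => by rw [abs_mul]; gcongr; exact hM t ht⟩

lemma BD.const (c : ℝ) : s.BD (fun _ => c) := ⟨|c|, fun _ _ => le_rfl⟩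

lemma BD.of_mem_Icc {F : ℝ → ℝ} {a b : ℝ} (h : ∀ t, |t| ≤ s.K → a ≤ F t ∧ F t ≤ b) : s.BD F :=
  ⟨max |a| |b|, fun t ht => abs_le_max_abs_abs (h t ht).1 (h t ht).2⟩

lemma abs_avg_le {Ω : Type*} {A : Finset Ω} {f : Ω → ℝ} {M : ℝ} (hA : A.Nonempty)
    (h : ∀ a ∈ A, |f a| ≤ M) : |avg A f| ≤ M :=
  abs_le.2 ⟨const_le_avg hA fun a ha => (abs_le.1 (h a ha)).1,
    avg_le_const' hA fun a ha => (abs_le.1 (h a ha)).2⟩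

lemma BD.Av {F : ℝ → ℝ} (hF : s.BD F) (a : ℕ) : s.BD (s.Av a F) := by
  obtain ⟨M, hM⟩ := hF
  exact ⟨M, fun t ht => abs_avg_le (s.W_nonempty a) fun w _ => hM _ (s.Tl_le w ht)⟩

lemma BD_HH (n : ℕ) : s.BD (s.HH n) :=
  BD.of_mem_Icc fun _ ht => ⟨s.HH_nonneg _ _, s.HH_le n ht⟩

variable (s)

/-- An invariant mean which is optimal for the entropy rate `P`. -/
structure Mean (P : ℝ) where
  /-- the functional -/
  toFun : (ℝ → ℝ) → ℝ
  mono : ∀ F G, s.BD F → s.BD G → (∀ t, |t| ≤ s.K → F t ≤ G t) → toFun F ≤ toFun G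
  add : ∀ F G, s.BD F → s.BD G → toFun (fun t => F t + G t) = toFun F + toFun G
  mul : ∀ F (c : ℝ), s.BD F → toFun (fun t => c * F t) = c * toFun F
  const : ∀ c : ℝ, toFun (fun _ => c) = c
  inv : ∀ F (a : ℕ), s.BD F → toFun (s.Av a F) = toFun F
  /-- the constant in the bound for entropies -/
  C : ℝ
  bound : ∀ L : ℕ, toFun (s.HH L) ≤ P * L + C

lemma exists_mean {P C : ℝ}
    (hP : ∀ n : ℕ, ∃ t, |t| ≤ s.K ∧ s.HH n t ≤ P * n + C) : Nonempty (s.Mean P) := by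
  choose t0 ht0 hH using hP
  set T : ℕ → (ℝ → ℝ) → ℝ := fun n F => (∑ q ∈ Finset.range n, s.Av q F (t0 n)) / n with hT
  have habs : ∀ F M, (∀ t, |t| ≤ s.K → |F t| ≤ M) → ∀ n : ℕ, 0 ≤ M → |T n F| ≤ M := by
    intro F M hM n hM0
    have h2 : |∑ q ∈ Finset.range n, s.Av q F (t0 n)| ≤ n * M := by
      refine (Finset.abs_sum_le_sum_abs _ _).trans ?_
      refine (Finset.sum_le_card_nsmul _ _ M fun q _ => ?_).trans (by simp)
      exact abs_avg_le (s.W_nonempty q) fun w _ => hM _ (s.Tl_le w (ht0 n))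
    simp only [hT, abs_div, Nat.abs_cast]
    exact div_le_of_le_mul₀ (by positivity) hM0 (by linarith)
  set U := hyperfilter ℕ
  have hU : (U : Filter ℕ) ≤ atTop := Nat.hyperfilter_le_atTop
  have hlim : ∀ F, s.BD F → Tendsto (fun n => T n F) U (nhds (limUnder U (fun n => T n F))) := by
    rintro F ⟨M, hM⟩
    have hM0 : 0 ≤ M := (abs_nonneg _).trans (hM 0 s.zero_mem)
    have hc : IsCompact (Icc (-M) M) := isCompact_Icc
    obtain ⟨x, _, hx⟩ := hc.ultrafilter_le_nhds (U.map (fun n => T n F)) (by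
      rw [le_principal_iff]
      have : ∀ᶠ n in (U : Filter ℕ), T n F ∈ Icc (-M) M :=
        Filter.Eventually.of_forall fun n => abs_le.1 (habs F M hM n hM0)
      exact this)
    have : Tendsto (fun n => T n F) U (nhds x) := hx
    exact tendsto_nhds_limUnder ⟨x, this⟩
  have hTadd : ∀ F G n, T n (fun t => F t + G t) = T n F + T n G := by
    intro F G n
    simp only [hT]
    rw [← add_div, ← Finset.sum_add_distrib]
    congr 1
    exact Finset.sum_congr rfl fun q _ => avg_add _ _
  have hTmul : ∀ F (c : ℝ) n, T n (fun t => c * F t) = c * T n F := by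
    intro F c n
    simp only [hT]
    rw [← mul_div_assoc, Finset.mul_sum]
    congr 1
    exact Finset.sum_congr rfl fun q _ => avg_mul _ _
  have hshift : ∀ F, s.BD F → Tendsto (fun n => T n (s.Av 1 F) - T n F) atTop (nhds 0) := by
    rintro F ⟨M, hM⟩
    have h1 : ∀ n : ℕ, |T n (s.Av 1 F) - T n F| ≤ 2 * M / n := by
      intro n
      have h2 : ∀ q, s.Av q (s.Av 1 F) (t0 n) = s.Av (q + 1) F (t0 n) := fun q =>
        (s.Av_add q 1 F (t0 n)).symm
      simp only [hT, h2]
      rw [← sub_div, ← Finset.sum_sub_distrib,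
        Finset.sum_range_sub (fun q => s.Av q F (t0 n)), abs_div, Nat.abs_cast]
      have h3 : ∀ q, |s.Av q F (t0 n)| ≤ M := fun q =>
        abs_avg_le (s.W_nonempty q) fun w _ => hM _ (s.Tl_le w (ht0 n))
      refine div_le_div_of_nonneg_right ((abs_sub _ _).trans ?_) (by positivity)
      linarith [h3 n, h3 0]
    refine squeeze_zero_norm h1 ?_
    exact tendsto_const_div_atTop_nhds_zero_nat (2 * M)
  have hinv1 : ∀ F, s.BD F → limUnder U (fun n => T n (s.Av 1 F)) = limUnder U (fun n => T n F) := by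
    intro F hF
    have h1 := (hlim _ (hF.Av 1)).sub (hlim _ hF)
    have h2 := tendsto_nhds_unique h1 ((hshift F hF).mono_left hU)
    linarith
  set D := Real.log (5 * (2 * s.K2 + 1))
  refine ⟨⟨fun F => limUnder U (fun n => T n F), ?_, ?_, ?_, ?_, ?_, s.C0, ?_⟩⟩
  · intro F G hF hG h
    refine le_of_tendsto_of_tendsto' (hlim F hF) (hlim G hG) fun n => ?_
    refine div_le_div_of_nonneg_right (Finset.sum_le_sum fun q _ => ?_) (by positivity)
    exact avg_mono fun w _ => h _ (s.Tl_le w (ht0 n))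
  · intro F G hF hG
    have h1 := (hlim F hF).add (hlim G hG)
    simp only [hTadd]
    exact h1.limUnder_eq
  · intro F c hF
    have h1 := (hlim F hF).const_mul c
    simp only [hTmul]
    exact h1.limUnder_eq
  · intro c
    refine Tendsto.limUnder_eq ?_
    refine Tendsto.mono_left (f := fun n => T n (fun _ => c)) ?_ hU
    refine tendsto_const_nhds.congr' ?_
    filter_upwards [eventually_gt_atTop 0] with n hn
    have hn' : (n : ℝ) ≠ 0 := by positivity
    simp only [hT, Sys.Av]
    rw [Finset.sum_congr rfl fun q _ => avg_const (s.W_nonempty q) c]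
    simp [hn']
  · intro F a hF
    induction a with
    | zero =>
      have : s.Av 0 F = F := by
        funext t
        unfold Sys.Av
        simp [W_zero, avg, Tl]
      rw [this]
    | succ a ih =>
      have : s.Av (a + 1) F = s.Av 1 (s.Av a F) := by
        funext t
        rw [add_comm, Av_add]
      rw [this, hinv1 _ (hF.Av a), ih]
  · intro L
    have h1 : ∀ n : ℕ, ∀ t, |t| ≤ s.K → ∑ q ∈ Finset.range n, s.Av q (s.HH L) t
        ≤ ∑ r ∈ Finset.range L, s.HH (n + r) t + n * s.C0 := by
      intro n t ht
      induction n with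
      | zero => simpa using Finset.sum_nonneg fun r _ => s.HH_nonneg r t
      | succ n ih =>
        rw [Finset.sum_range_succ]
        have h2 := s.superadd n L ht
        have h3 := Finset.sum_range_succ' (fun r => s.HH (n + r) t) L
        have h4 := Finset.sum_range_succ (fun r => s.HH (n + r) t) L
        have h5 : ∑ r ∈ Finset.range L, s.HH (n + (r + 1)) t
            = ∑ r ∈ Finset.range L, s.HH (n + 1 + r) t :=
          Finset.sum_congr rfl fun r _ => by rw [add_comm r 1, add_assoc]
        rw [h5, add_zero] at h3
        push_cast
        linarith
    have h2 : ∀ n : ℕ, 0 < n → T n (s.HH L)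
        ≤ P * L + s.C0 + (L * (C + (L * s.ell + D))) / n := by
      intro n hn
      have hn' : (0 : ℝ) < n := by positivity
      have h3 := h1 n (t0 n) (ht0 n)
      have h4 : ∑ r ∈ Finset.range L, s.HH (n + r) (t0 n)
          ≤ L * (P * n + C + (L * s.ell + D)) := by
        refine (Finset.sum_le_card_nsmul _ _ (P * n + C + (L * s.ell + D)) fun r hr => ?_).trans
          (le_of_eq (by rw [Finset.card_range, nsmul_eq_mul]))
        have h5 := s.HH_add_le n r (ht0 n)
        have h6 : (r : ℝ) ≤ L := by exact_mod_cast (Finset.mem_range.1 hr).le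
        have h7 := mul_le_mul_of_nonneg_right h6 s.ell_pos.le
        linarith [hH n]
      simp only [hT]
      rw [div_le_iff₀ hn', add_mul, div_mul_cancel₀ _ hn'.ne']
      nlinarith
    have h3 : Tendsto (fun n : ℕ => P * L + s.C0 + (L * (C + (L * s.ell + D))) / (n : ℝ)) atTop
        (nhds (P * L + s.C0 + 0)) :=
      tendsto_const_nhds.add (tendsto_const_div_atTop_nhds_zero_nat _)
    rw [add_zero] at h3
    refine le_of_tendsto_of_tendsto (hlim _ (BD_HH L)) (h3.mono_left hU) ?_
    exact hU (eventually_atTop.2 ⟨1, fun n hn => h2 n hn⟩)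

end Sys

lemma cent_prod_fst_pair {Ω Ω' S T : Type*} {A : Finset Ω} {A' : Finset Ω'} (F : Ω × Ω' → S)
    (Y : Ω × Ω' → T) :
    CEnt (A ×ˢ A') F (fun p => (p.1, Y p))
      = avg A (fun a => CEnt A' (fun b => F (a, b)) (fun b => Y (a, b))) := by
  have h1 := cent_prod_fst (A := A) (A' := A') (fun p => (F p, Y p))
  have h2 := cent_prod_fst (A := A) (A' := A') Y
  have h3 : Ent (A ×ˢ A') (fun p => ((F p, Y p), p.1)) = Ent (A ×ˢ A') (fun p => (F p, (p.1, Y p))) :=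
    ent_congr fun p _ q _ => by simp only [Prod.mk.injEq]; tauto
  have h4 : Ent (A ×ˢ A') (fun p => (Y p, p.1)) = Ent (A ×ˢ A') (fun p => (p.1, Y p)) :=
    ent_congr fun p _ q _ => by simp only [Prod.mk.injEq]; tauto
  unfold CEnt at *
  rw [avg_sub, ← h1, ← h2, h3, h4]
  ring

lemma cent_fst_snd {Ω Ω' : Type*} {A : Finset Ω} {A' : Finset Ω'} (hA : A.Nonempty)
    (hA' : A'.Nonempty) :
    CEnt (A ×ˢ A') Prod.fst Prod.snd = Real.log A.card := by
  have h1 : Ent (A ×ˢ A') (fun p => p.2) = Ent A' id := ent_prod_snd hA id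
  have h2 : Ent (A ×ˢ A') (fun p => (Prod.fst p, Prod.snd p)) = Real.log (A ×ˢ A').card :=
    ent_of_inj (hA.product hA') (fun p _ q _ h => h)
  have h3 : (0 : ℝ) < A.card := by exact_mod_cast hA.card_pos
  have h4 : (0 : ℝ) < A'.card := by exact_mod_cast hA'.card_pos
  rw [ent_of_inj hA' (Function.injective_id.injOn)] at h1
  unfold CEnt
  rw [h2, h1, Finset.card_product, Nat.cast_mul, Real.log_mul h3.ne' h4.ne']
  ring

lemma Few.pair {Ω S T U : Type*} {A : Finset Ω} {X : Ω → S} {Y : Ω → T} {Z : Ω → U} {M : ℕ}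
    (h : Few A X Z M) (hY : ∀ a ∈ A, ∀ b ∈ A, Z a = Z b → Y a = Y b) :
    Few A (fun a => (X a, Y a)) Z M := by
  classical
  intro a ha
  obtain ⟨I, hI, hI2⟩ := h a ha
  refine ⟨I.image (fun x => (x, Y a)), Finset.card_image_le.trans hI, fun b hb hab => ?_⟩
  exact Finset.mem_image.2 ⟨X b, hI2 b hb hab, by simp only [hY b hb a ha hab]⟩

namespace Sys

variable (s : Sys)

lemma cent_W_add {S T : Type*} (a b : ℕ) (X : List (Fin s.B) → S) (Y : List (Fin s.B) → T) :
    CEnt (s.W (a + b)) X Y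
      = CEnt (s.W a ×ˢ s.W b) (fun p => X (p.1 ++ p.2)) (fun p => Y (p.1 ++ p.2)) := by
  unfold CEnt
  rw [ent_W_add, ent_W_add]

/-- Entropy of the height conditioned on the suffix of the word. -/
def bb (k m : ℕ) (t : ℝ) : ℝ :=
  CEnt (s.W (m + k)) (fun v => s.fl (m + k) (s.Pl v t)) (fun v => v.drop m)

/-- Entropy of the height at a finer scale, conditioned on the height and on the suffix. -/
def zz (N k m : ℕ) (t : ℝ) : ℝ :=
  CEnt (s.W (m + k)) (fun v => s.fl (m + k + N) (s.Pl v t))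
    (fun v => (s.fl (m + k) (s.Pl v t), v.drop m))

lemma bb_nonneg (k m : ℕ) (t : ℝ) : 0 ≤ s.bb k m t := cent_nonneg _ _ _

lemma zz_nonneg (N k m : ℕ) (t : ℝ) : 0 ≤ s.zz N k m t := cent_nonneg _ _ _

lemma bb_le (k m : ℕ) (t : ℝ) : s.bb k m t ≤ s.HH (m + k) t := cent_le_ent _ _

lemma few_tail {Ω T : Type*} {A : Finset Ω} {w u : Ω → List (Fin s.B)} {a b : ℕ} {t : ℝ}
    {Y : Ω → T} (hu : ∀ p ∈ A, (u p).length = a)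
    (hY : ∀ p ∈ A, ∀ q ∈ A, Y p = Y q → u p = u q) :
    Few A (fun p => s.fl b (s.Pl (w p) (s.Tl (u p) t)))
      (fun p => (s.fl (a + b) (s.Pl (u p ++ w p) t), Y p)) (2 * 1 + 1) := by
  refine s.few_fl fun p hp q hq hpq => ?_
  simp only [Prod.mk.injEq] at hpq
  have h7 := s.sub_le_of_fl_eq hpq.1
  have huq := hY p hp q hq hpq.2
  rw [Pl_append, Pl_append, hu p hp, hu q hq, huq] at h7
  have h8 := s.lam_pow_pos a
  have h9 : s.Pl (u q) t + s.lam ^ a * s.Pl (w p) (s.Tl (u q) t)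
      - (s.Pl (u q) t + s.lam ^ a * s.Pl (w q) (s.Tl (u q) t))
      = s.lam ^ a * (s.Pl (w p) (s.Tl (u q) t) - s.Pl (w q) (s.Tl (u q) t)) := by ring
  rw [h9, abs_mul, abs_of_pos h8, pow_add, mul_le_mul_iff_right₀ h8] at h7
  rw [huq]
  simpa using h7

/-- The lower bound for the information carried by the first digits. -/
def QQ (k j m : ℕ) (t : ℝ) : ℝ :=
  j * Real.log s.B - s.bb k (j + m) t + s.Av j (s.bb k m) t - Real.log 3

lemma QQ_le (k j m : ℕ) (t : ℝ) :
    s.QQ k j m t ≤ CEnt (s.W (j + m + k)) (fun v => v.take j)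
      (fun v => (s.fl (j + m + k) (s.Pl v t), v.drop (j + m))) := by
  set A := s.W j ×ˢ s.W (m + k)
  set g : List (Fin s.B) × List (Fin s.B) → List (Fin s.B) := fun p => p.1
  set r : List (Fin s.B) × List (Fin s.B) → ℤ := fun p => s.fl (j + (m + k)) (s.Pl (p.1 ++ p.2) t)
  set τ : List (Fin s.B) × List (Fin s.B) → List (Fin s.B) := fun p => p.2.drop m
  have hmem : ∀ p ∈ A, p.1.length = j ∧ p.2.length = m + k := fun p hp => by
    simpa [A] using hp
  have htake : ∀ p ∈ A, (p.1 ++ p.2).take j = p.1 := fun p hp => by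
    rw [← (hmem p hp).1, List.take_left]
  have hdrop : ∀ p ∈ A, (p.1 ++ p.2).drop (j + m) = p.2.drop m := fun p hp => by
    rw [← (hmem p hp).1]; simp [List.drop_append]
  have e1 : CEnt (s.W (j + m + k)) (fun v => v.take j)
      (fun v => (s.fl (j + m + k) (s.Pl v t), v.drop (j + m))) = CEnt A g (fun p => (r p, τ p)) := by
    rw [add_assoc, cent_W_add]
    unfold CEnt
    refine congrArg₂ _ (ent_congr fun p hp q hq => ?_) (ent_congr fun p hp q hq => ?_)
    · simp only [htake p hp, htake q hq, hdrop p hp, hdrop q hq, r, g, τ]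
    · simp only [hdrop p hp, hdrop q hq, r, τ]
  have e2 : s.bb k (j + m) t = CEnt A r τ := by
    unfold bb
    rw [add_assoc, cent_W_add]
    unfold CEnt
    refine congrArg₂ _ (ent_congr fun p hp q hq => ?_) (ent_congr fun p hp q hq => ?_)
    · simp only [hdrop p hp, hdrop q hq, r, τ]
    · simp only [hdrop p hp, hdrop q hq, τ]
  have h1 : CEnt A g (fun p => (r p, τ p)) + CEnt A r τ = CEnt A r (fun p => (g p, τ p)) + CEnt A g τ := by
    rw [← cent_chain, ← cent_chain]
    unfold CEnt
    congr 1
    exact ent_congr fun p _ q _ => by simp only [Prod.mk.injEq]; tauto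
  have h2 : j * Real.log s.B ≤ CEnt A g τ := by
    have h3 : CEnt A g Prod.snd ≤ CEnt A g τ := cent_antitone fun p _ q _ h => by simp only [τ, h]
    refine le_trans (le_of_eq ?_) h3
    rw [cent_fst_snd (s.W_nonempty _) (s.W_nonempty _), card_W, Nat.cast_pow, Real.log_pow]
  have h3 : s.Av j (s.bb k m) t ≤ CEnt A r (fun p => (g p, τ p)) + Real.log 3 := by
    have : s.Av j (s.bb k m) t
        = CEnt A (fun p => s.fl (m + k) (s.Pl p.2 (s.Tl p.1 t))) (fun p => (g p, τ p)) := by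
      rw [cent_prod_fst_pair]; rfl
    rw [this, show (3 : ℝ) = ((2 * 1 + 1 : ℕ) : ℝ) by norm_num]
    refine cent_le_add_of_few (s.few_tail (fun p hp => (hmem p hp).1) fun p _ q _ h => ?_)
    simp only [Prod.mk.injEq] at h
    exact h.1
  rw [e1]
  unfold QQ
  rw [e2]
  linarith

lemma QQ_le_const (k j m : ℕ) (t : ℝ) : s.QQ k j m t ≤ j * Real.log s.B := by
  refine (s.QQ_le k j m t).trans ((cent_le_ent _ _).trans ?_)
  rw [add_assoc, ent_W_add]
  have h1 : Ent (s.W j ×ˢ s.W (m + k)) (fun p => (p.1 ++ p.2).take j)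
      ≤ Ent (s.W j ×ˢ s.W (m + k)) (fun p => p.1) := by
    refine ent_mono fun p hp q hq h => ?_
    simp only [Finset.mem_product, mem_W] at hp hq
    rw [← hp.1, List.take_left, hp.1, ← hq.1, List.take_left, h]
  rw [ent_prod_fst (s.W_nonempty _) (fun u => u),
    ent_of_inj (s.W_nonempty _) (fun _ _ _ _ h => h), card_W, Nat.cast_pow, Real.log_pow] at h1
  exact h1

/-- The constant in the pair inequality. -/
def Cpair (c : ℝ) (C1 : ℕ) : ℝ :=
  Real.log ((2 * (C1 + 1) + 1 : ℕ) : ℝ) + Real.log ((2 * (⌈4 / c⌉₊ + 1) + 1 : ℕ) : ℝ)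

lemma Cpair_nonneg (c : ℝ) (C1 : ℕ) : 0 ≤ Cpair c C1 :=
  add_nonneg (Real.log_natCast_nonneg _) (Real.log_natCast_nonneg _)

lemma pair_bound (N k j m : ℕ) {c : ℝ} (hc : 0 < c) {C1 : ℕ} {t t' : ℝ}
    (h1 : c * s.lam ^ (j + m + k) ≤ |t' - t|) (h2 : |t' - t| ≤ C1 * s.lam ^ (j + m + k))
    (hj : (s.B : ℝ) ^ j * s.lam ^ N ≤ 1) :
    s.QQ k j m t ≤ s.zz N k (j + m) t + s.zz N k (j + m) t' + Cpair c C1 := by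
  set L := j + m + k with hL
  set A := s.W L
  set Y : ℝ → List (Fin s.B) → ℤ × List (Fin s.B) :=
    fun t v => (s.fl L (s.Pl v t), v.drop (j + m)) with hY
  set Z : ℝ → List (Fin s.B) → ℤ := fun t v => s.fl (L + N) (s.Pl v t) with hZ
  set g : List (Fin s.B) → ℤ := fun v => s.ix (v.take j)
  have hlamL := s.lam_pow_pos L
  have hlamN := s.lam_pow_pos N
  have e1 : CEnt A (fun v => v.take j) (Y t) ≤ CEnt A g (Y t) := by
    refine cent_mono fun a ha b hb _ h => ?_
    simp only [A, mem_W] at ha hb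
    refine s.ix_inj ?_ (Int.natCast_inj.1 h)
    simp [ha, hb]
  have hixle : ∀ v ∈ A, (s.ix (v.take j) : ℝ) ≤ s.xl v * (2 * s.B ^ j) ∧
      s.xl v * (2 * s.B ^ j) ≤ s.ix (v.take j) + 1 := by
    intro v hv
    simp only [A, mem_W] at hv
    have h := s.xl_append_mem' (v.take j) (v.drop j)
    rw [List.take_append_drop, List.length_take, min_eq_left (by omega)] at h
    exact h
  have few1 : Few A g (fun v => ((Z t v, Z t' v), Y t v)) (2 * (⌈4 / c⌉₊ + 1) + 1) := by
    refine few_int fun a ha b hb hab => ?_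
    simp only [Prod.mk.injEq, hZ] at hab
    have h3 := s.sub_le_of_fl_eq hab.1.1
    have h4 := s.sub_le_of_fl_eq hab.1.2
    have h5 := s.Pl_sub a t t'
    have h6 := s.Pl_sub b t t'
    have h7 : |t' - t| * |s.xl a - s.xl b| ≤ 2 * s.lam ^ (L + N) := by
      rw [← abs_mul, mul_sub, ← h5, ← h6]
      have : s.Pl a t' - s.Pl a t - (s.Pl b t' - s.Pl b t)
          = (s.Pl a t' - s.Pl b t') - (s.Pl a t - s.Pl b t) := by ring
      rw [this]
      refine (abs_sub _ _).trans ?_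
      linarith
    have h8 : c * |s.xl a - s.xl b| ≤ 2 * s.lam ^ N := by
      have h9 := (mul_le_mul_of_nonneg_right h1 (abs_nonneg (s.xl a - s.xl b))).trans h7
      rw [pow_add s.lam L N] at h9
      have h10 : s.lam ^ L * (c * |s.xl a - s.xl b|) ≤ s.lam ^ L * (2 * s.lam ^ N) := by linarith
      exact le_of_mul_le_mul_left h10 hlamL
    have hBj : (0 : ℝ) < s.B ^ j := by have := s.B_pos; positivity
    have h9 : |s.xl a - s.xl b| * (2 * s.B ^ j) ≤ 4 / c := by
      rw [le_div_iff₀ hc]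
      have := mul_le_mul_of_nonneg_right h8 (by positivity : (0 : ℝ) ≤ 2 * s.B ^ j)
      linarith
    have ha1 := hixle a ha
    have hb1 := hixle b hb
    have h10 : |(s.ix (a.take j) : ℝ) - s.ix (b.take j)| ≤ 4 / c + 1 := by
      have h11 : |s.xl a * (2 * s.B ^ j) - s.xl b * (2 * s.B ^ j)| ≤ 4 / c := by
        rw [← sub_mul, abs_mul, abs_of_pos (by positivity : (0 : ℝ) < 2 * s.B ^ j)]
        exact h9
      have h12 := abs_le.1 h11
      rw [abs_le]
      constructor <;> linarith [ha1.1, ha1.2, hb1.1, hb1.2, h12.1, h12.2]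
    have h11 : |(s.ix (a.take j) : ℝ) - s.ix (b.take j)| ≤ ((⌈4 / c⌉₊ + 1 : ℕ) : ℝ) := by
      push_cast
      linarith [Nat.le_ceil (4 / c)]
    have h12 : ((|g a - g b| : ℤ) : ℝ) ≤ ((⌈4 / c⌉₊ + 1 : ℕ) : ℝ) := by
      push_cast [g]
      simpa using h11
    exact_mod_cast h12
  have h3 := cent_le_add_of_few few1
  have h4 := cent_pair_le A (Z t) (Z t') (Y t)
  have few2 : Few A (Y t') (Y t) (2 * (C1 + 1) + 1) := by
    refine (s.few_fl fun a _ b _ hab => ?_).pair fun a _ b _ hab => ?_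
    · simp only [hY, Prod.mk.injEq] at hab
      have h5 := s.sub_le_of_fl_eq hab.1
      have h6 := s.Pl_sub a t t'
      have h7 := s.Pl_sub b t t'
      have h8 : s.Pl a t' - s.Pl b t'
          = (s.Pl a t - s.Pl b t) + (t' - t) * (s.xl a - s.xl b) := by
        linear_combination h6 - h7
      have h9 : |s.xl a - s.xl b| ≤ 1 := by
        have := s.xl_mem a
        have := s.xl_mem b
        rw [abs_le]; constructor <;> linarith
      rw [h8]
      refine (abs_add_le _ _).trans ?_
      rw [abs_mul]
      have h10 := mul_le_of_le_one_right (abs_nonneg (t' - t)) h9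
      push_cast
      linarith
    · simp only [hY, Prod.mk.injEq] at hab
      exact hab.2
  have h5 := cent_le_add_of_few_right (X := Z t') few2
  have h6 := s.QQ_le k j m t
  have h7 : s.zz N k (j + m) t = CEnt A (Z t) (Y t) := rfl
  have h8 : s.zz N k (j + m) t' = CEnt A (Z t') (Y t') := rfl
  unfold Cpair
  have h9 : CEnt (s.W L) (fun v => v.take j) (Y t) = CEnt A (fun v => v.take j) (Y t) := rfl
  rw [h7, h8]
  simp only [← hL] at h6
  linarith

end Sys

lemma avg_ent_fib_prod {Ω Ω' S T : Type*} {A : Finset Ω} {A' : Finset Ω'} (hA' : A'.Nonempty)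
    (F : Ω × Ω' → S) (Y : Ω → T) :
    avg A (fun a => Ent (fib A Y a ×ˢ A') F) = CEnt (A ×ˢ A') F (fun p => Y p.1) := by
  rw [cent_eq_fib, avg_prod]
  refine avg_congr fun a _ => ?_
  rw [← avg_const hA' (Ent _ F)]
  refine avg_congr fun b hb => ?_
  congr 1
  ext ⟨x, y⟩
  simp only [mem_fib, Finset.mem_product]
  tauto

namespace Sys

variable (s : Sys)

/-- The constant in the bound for conditional entropies. -/
def C4 : ℝ := Real.log 7 + Real.log ((2 * (2 * s.KK + 1) + 1 : ℕ) : ℝ)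

lemma zz_le (N k m : ℕ) {t : ℝ} (ht : |t| ≤ s.K) (hk : s.gam ^ k * s.K ≤ s.lam ^ N) {a0 a1 : ℝ}
    (ha1 : 0 ≤ a1)
    (hneg : ∀ τ, |τ| ≤ s.K → ∀ A : Finset (List (Fin s.B)), A.Nonempty →
      ∀ X : List (Fin s.B) → ℝ, (∀ v ∈ A, 0 ≤ X v ∧ X v < 1) →
      Ent A (fun v => s.fl N (X v))
        ≤ a0 + a1 * Ent (A ×ˢ s.W N) (fun p => s.fl N (X p.1 + s.Pl p.2 τ))) :
    s.zz N k m t ≤ a0 + Real.log 3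
      + a1 * (s.HH (m + k + N) t - s.HH (m + k) t + s.C4) := by
  set L := m + k with hL
  set A := s.W L
  set Y : List (Fin s.B) → ℤ × List (Fin s.B) := fun v => (s.fl L (s.Pl v t), v.drop m) with hY
  set Z : List (Fin s.B) → ℤ := fun v => s.fl (L + N) (s.Pl v t) with hZ
  set Z' : List (Fin s.B) × List (Fin s.B) → ℤ := fun p => s.fl (L + N) (s.Pl (p.1 ++ p.2) t)
    with hZ'
  set r : List (Fin s.B) × List (Fin s.B) → ℤ := fun p => s.fl L (s.Pl p.1 t) with hr
  have hlamL := s.lam_pow_pos L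
  have hlamN := s.lam_pow_pos N
  have h1 : s.zz N k m t = avg A (fun v => Ent (fib A Y v) Z) := by
    unfold zz; rw [cent_eq_fib]
  have h2 : CEnt (A ×ˢ s.W N) Z' (fun p => Y p.1)
      ≤ s.HH (L + N) t - s.HH L t + Real.log ((2 * (2 * s.KK + 1) + 1 : ℕ) : ℝ) := by
    have h3 : CEnt (A ×ˢ s.W N) Z' (fun p => Y p.1) ≤ CEnt (A ×ˢ s.W N) Z' r :=
      cent_antitone fun p _ q _ h => by
        simp only [hY, Prod.mk.injEq] at h; exact h.1
    have h4 : CEnt (A ×ˢ s.W N) r Z' ≤ Real.log ((2 * (2 * s.KK + 1) + 1 : ℕ) : ℝ) := by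
      refine cent_le_of_few (s.few_prefix (k := s.KK) fun p hp => ?_)
      simp only [A, Finset.mem_product, mem_W] at hp
      exact s.Pl_append_sub_le' hp.1 ht
    have h5 : Ent (A ×ˢ s.W N) r = s.HH L t :=
      ent_prod_fst (s.W_nonempty N) (fun u => s.fl L (s.Pl u t))
    have h6 : s.HH (L + N) t = Ent (A ×ˢ s.W N) Z' := s.ent_W_add L N _
    have h7 : Ent (A ×ˢ s.W N) (fun p => (r p, Z' p)) = Ent (A ×ˢ s.W N) (fun p => (Z' p, r p)) :=
      ent_congr fun p _ q _ => by simp only [Prod.mk.injEq]; tauto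
    unfold CEnt at h3 h4 ⊢
    rw [h7] at h4
    linarith
  have h3 : ∀ v0 ∈ A, Ent (fib A Y v0) Z ≤ (a0 + Real.log 3)
      + a1 * (Ent (fib A Y v0 ×ˢ s.W N) Z' + Real.log 7) := by
    intro v0 hv0
    set F := fib A Y v0
    set X : List (Fin s.B) → ℝ := fun v => Int.fract (s.Pl v t / s.lam ^ L) with hX
    set τ := s.Tl (v0.drop m) 0
    have hτ : |τ| ≤ s.K := s.Tl_le _ s.zero_mem
    have hXsub : ∀ v ∈ F, ∀ v' ∈ F, s.lam ^ L * (X v - X v') = s.Pl v t - s.Pl v' t := by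
      intro v hv v' hv'
      have e1 := (mem_fib.1 hv).2
      have e2 := (mem_fib.1 hv').2
      simp only [hY, Prod.mk.injEq] at e1 e2
      have e3 : ⌊s.Pl v t / s.lam ^ L⌋ = ⌊s.Pl v' t / s.lam ^ L⌋ := e1.1.trans e2.1.symm
      simp only [hX, Int.fract, e3]
      field_simp
      ring
    have hT : ∀ v ∈ F, |s.Tl v t - τ| ≤ s.lam ^ N := by
      intro v hv
      have e1 := (mem_fib.1 hv).2
      have e2 := (mem_fib.1 hv).1
      simp only [hY, Prod.mk.injEq] at e1
      simp only [A, mem_W] at e2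
      have e3 : s.Tl v t = s.Tl (v.drop m) (s.Tl (v.take m) t) := by
        rw [← Tl_append, List.take_append_drop]
      rw [e3, e1.2, abs_Tl_sub, ← e1.2, List.length_drop, e2, sub_zero, hL, Nat.add_sub_cancel_left]
      refine le_trans ?_ hk
      have := s.gam_pos
      gcongr
      exact s.Tl_le _ ht
    have h4 : Ent F Z ≤ Ent F (fun v => s.fl N (X v)) + Real.log 3 := by
      rw [show (3 : ℝ) = ((2 * 1 + 1 : ℕ) : ℝ) by norm_num]
      refine ent_le_add_of_few (s.few_fl fun a ha b hb hab => ?_)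
      have e1 := s.sub_le_of_fl_eq hab
      rw [← hXsub a ha b hb, abs_mul, abs_of_pos hlamL, pow_add s.lam L N]
      push_cast
      rw [one_mul]
      exact mul_le_mul_of_nonneg_left e1 hlamL.le
    have h5 : Ent (F ×ˢ s.W N) (fun p => s.fl N (X p.1 + s.Pl p.2 τ))
        ≤ Ent (F ×ˢ s.W N) Z' + Real.log 7 := by
      rw [show (7 : ℝ) = ((2 * 3 + 1 : ℕ) : ℝ) by norm_num]
      refine ent_le_add_of_few (s.few_fl fun p hp q hq hpq => ?_)
      rw [Finset.mem_product] at hp hq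
      have e1 := s.sub_le_of_fl_eq hpq
      have lp : p.1.length = L := s.mem_W.1 (mem_fib.1 hp.1).1
      have lq : q.1.length = L := s.mem_W.1 (mem_fib.1 hq.1).1
      rw [Pl_append, Pl_append, lp, lq] at e1
      have e2 := hXsub p.1 hp.1 q.1 hq.1
      have e3 : |(X p.1 - X q.1) + (s.Pl p.2 (s.Tl p.1 t) - s.Pl q.2 (s.Tl q.1 t))| ≤ s.lam ^ N := by
        have e4 : s.lam ^ L * ((X p.1 - X q.1) + (s.Pl p.2 (s.Tl p.1 t) - s.Pl q.2 (s.Tl q.1 t)))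
            = s.Pl p.1 t + s.lam ^ L * s.Pl p.2 (s.Tl p.1 t)
              - (s.Pl q.1 t + s.lam ^ L * s.Pl q.2 (s.Tl q.1 t)) := by
          rw [mul_add, e2]; ring
        rw [← e4, abs_mul, abs_of_pos hlamL, pow_add s.lam L N] at e1
        exact le_of_mul_le_mul_left e1 hlamL
      have e5 := (s.abs_Pl_sub_le p.2 τ (s.Tl p.1 t)).trans (hT p.1 hp.1)
      have e6 := (s.abs_Pl_sub_le q.2 τ (s.Tl q.1 t)).trans (hT q.1 hq.1)
      have f3 := abs_le.1 e3
      have f5 := abs_le.1 e5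
      have f6 := abs_le.1 e6
      push_cast
      rw [abs_le]
      constructor <;> linarith [f3.1, f3.2, f5.1, f5.2, f6.1, f6.2]
    have h6 := hneg τ hτ F (fib_nonempty hv0) X fun v _ => ⟨Int.fract_nonneg _, Int.fract_lt_one _⟩
    have h7 := mul_le_mul_of_nonneg_left h5 ha1
    linarith
  have h4 := avg_mono h3
  have hA : A.Nonempty := s.W_nonempty L
  rw [avg_add, avg_const hA, avg_mul, avg_add, avg_const hA, avg_ent_fib_prod (s.W_nonempty N)] at h4
  have h5 : a1 * (CEnt (A ×ˢ s.W N) Z' (fun p => Y p.1) + Real.log 7)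
      ≤ a1 * (s.HH (L + N) t - s.HH L t + s.C4) := by
    refine mul_le_mul_of_nonneg_left ?_ ha1
    unfold C4
    linarith
  rw [h1]
  linarith

lemma W_one : s.W 1 = (Finset.univ : Finset (Fin s.B)).image (fun d => [d]) := by
  ext w
  simp [List.length_eq_one_iff, eq_comm]

/-- Even and odd digits. -/
lemma exists_digits : ∃ e o : ℕ, o ≤ 1 ∧ s.B = 2 * e + o ∧ ∀ (F : ℝ → ℝ) (t : ℝ),
    s.Av 1 F t = ((e + o) * F (1 + s.gam * t) + e * F (1 - s.gam * t)) / s.B := by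
  refine ⟨s.B / 2, s.B % 2, by omega, by omega, fun F t => ?_⟩
  have h1 : ∀ n : ℕ, ∑ d ∈ Finset.range n, F (1 + s.gam * (-1) ^ d * t)
      = ((n / 2 : ℕ) + (n % 2 : ℕ)) * F (1 + s.gam * t) + (n / 2 : ℕ) * F (1 - s.gam * t) := by
    intro n
    induction n with
    | zero => simp
    | succ n ih =>
      rw [Finset.sum_range_succ, ih]
      rcases Nat.even_or_odd' n with ⟨k, rfl | rfl⟩
      · rw [show (2 * k + 1) / 2 = k by omega, show (2 * k) / 2 = k by omega,
          show (2 * k + 1) % 2 = 1 by omega, show (2 * k) % 2 = 0 by omega]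
        simp [pow_mul]
        ring
      · rw [show (2 * k + 1 + 1) / 2 = k + 1 by omega, show (2 * k + 1) / 2 = k by omega,
          show (2 * k + 1 + 1) % 2 = 0 by omega, show (2 * k + 1) % 2 = 1 by omega]
        simp [pow_mul, pow_add, ← sub_eq_add_neg]
        ring
  unfold Sys.Av
  rw [W_one, avg_image (fun _ _ _ _ h => by simpa using h)]
  unfold avg
  simp only [Function.comp, Finset.card_univ, Fintype.card_fin, Tl, sg]
  rw [Fin.sum_univ_eq_sum_range (fun d => F (1 + s.gam * (-1) ^ d * t)) s.B, h1]

lemma Av_one_add (r : ℕ) (F : ℝ → ℝ) (t : ℝ) : s.Av (r + 1) F t = s.Av 1 (s.Av r F) t := by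
  rw [add_comm, Av_add]

/-- If `Q t₁ ≤ z t₁ + z t₂ + D` for all separated slopes `t₁, t₂` then `Q ≤ 2 z + D`,
up to an exponentially small error, after averaging. -/
lemma pairing {z Q : ℝ → ℝ} {Qm D : ℝ} {R : ℕ} (hQm : 0 ≤ Qm) (hD : 0 ≤ D)
    (hz : ∀ t, 0 ≤ z t) (hQ : ∀ t, Q t ≤ Qm)
    (hp : ∀ t1 t2, |t1| ≤ s.K → |t2| ≤ s.K → s.gam ^ R ≤ |t1 - t2| → Q t1 ≤ z t1 + z t2 + D)
    (i : ℕ) : ∀ r, 2 * i ≤ r → r ≤ R → ∀ t, |t| ≤ s.K →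
      s.Av r Q t ≤ 2 * s.Av r z t + D + (1 / 2) ^ i * Qm := by
  have hB := s.B_pos
  have hγ := s.gam_pos
  have hγ1 := s.gam_lt
  obtain ⟨e, o, ho, hBe, hAv⟩ := s.exists_digits
  have hBe' : (s.B : ℝ) = 2 * e + o := by exact_mod_cast hBe
  have ho' : (o : ℝ) ≤ 1 := by exact_mod_cast ho
  have ho0 : (0 : ℝ) ≤ o := by positivity
  have he0 : (0 : ℝ) ≤ e := by positivity
  have hstep : ∀ t, |t| ≤ s.K → |1 + s.gam * t| ≤ s.K ∧ |1 - s.gam * t| ≤ s.K := by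
    intro t ht
    have h1 := s.K_eq
    have h2 := abs_le.1 ht
    have h3 := mul_le_mul_of_nonneg_left h2.1 hγ.le
    have h4 := mul_le_mul_of_nonneg_left h2.2 hγ.le
    constructor <;> rw [abs_le] <;> constructor <;> linarith
  have hpair : ∀ r, r + 1 ≤ R → ∀ t, |t| ≤ s.K → 1 / 2 ≤ |t| →
      s.Av r Q (1 + s.gam * t) ≤ s.Av r z (1 + s.gam * t) + s.Av r z (1 - s.gam * t) + D ∧
      s.Av r Q (1 - s.gam * t) ≤ s.Av r z (1 + s.gam * t) + s.Av r z (1 - s.gam * t) + D := by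
    intro r hr t ht ht2
    have hW := s.W_nonempty r
    have hsep : ∀ w ∈ s.W r, s.gam ^ R ≤ |s.Tl w (1 + s.gam * t) - s.Tl w (1 - s.gam * t)| := by
      intro w hw
      rw [mem_W] at hw
      rw [abs_Tl_sub, hw]
      have h1 : (1 + s.gam * t) - (1 - s.gam * t) = 2 * s.gam * t := by ring
      rw [h1, abs_mul, abs_of_pos (by positivity : 0 < 2 * s.gam)]
      have h2 : s.gam ^ R ≤ s.gam ^ (r + 1) := pow_le_pow_of_le_one hγ.le hγ1.le hr
      refine h2.trans ?_
      rw [pow_succ]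
      gcongr
      nlinarith
    obtain ⟨k1, k2⟩ := hstep t ht
    constructor
    · unfold Sys.Av
      rw [← avg_add, ← avg_add_const hW]
      exact avg_mono fun w hw => hp _ _ (s.Tl_le w k1) (s.Tl_le w k2) (hsep w hw)
    · unfold Sys.Av
      rw [add_comm (avg _ _), ← avg_add, ← avg_add_const hW]
      exact avg_mono fun w hw => hp _ _ (s.Tl_le w k2) (s.Tl_le w k1) (by
        rw [abs_sub_comm]; exact hsep w hw)
  induction i with
  | zero =>
    intro r _ _ t ht
    have hW := s.W_nonempty r
    have h1 : s.Av r Q t ≤ Qm := avg_le_const' hW fun w _ => hQ _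
    have h2 : 0 ≤ s.Av r z t := avg_nonneg fun w _ => hz _
    simp only [pow_zero, one_mul]
    linarith
  | succ i ih =>
    have half : ∀ r, 2 * i + 1 ≤ r → r ≤ R → ∀ t, |t| ≤ s.K → 1 / 2 ≤ |t| →
        s.Av r Q t ≤ 2 * s.Av r z t + D + (1 / 2) ^ (i + 1) * Qm := by
      intro r hr hrR t ht ht2
      obtain ⟨r, rfl⟩ : ∃ r', r = r' + 1 := ⟨r - 1, by omega⟩
      obtain ⟨h1, h2⟩ := hpair r hrR t ht ht2
      have h3 := ih r (by omega) (by omega) _ (hstep t ht).1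
      have h4 : (0 : ℝ) ≤ (1 / 2) ^ i * Qm := by positivity
      rw [s.Av_one_add r Q, s.Av_one_add r z, hAv (s.Av r Q), hAv (s.Av r z), div_le_iff₀ hB,
        show ∀ n x : ℝ, (2 * (n / s.B) + D + x) * s.B = 2 * n + D * s.B + x * s.B from
          fun n x => by field_simp, pow_succ]
      have h5 : (o : ℝ) * ((1 / 2) ^ i * Qm) ≤ (1 / 2) ^ i * (1 / 2) * Qm * s.B := by
        have := s.two_le_B
        have h6 := mul_le_mul_of_nonneg_right (ho'.trans (by linarith : (1 : ℝ) ≤ s.B / 2)) h4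
        linarith
      have h6 := mul_le_mul_of_nonneg_left h3 ho0
      have h7 := mul_le_mul_of_nonneg_left (add_le_add h1 h2) he0
      have h8 : D * s.B = 2 * (e * D) + o * D := by rw [hBe']; ring
      rw [h8]
      linarith
    intro r hr hrR t ht
    rcases le_or_gt (1 / 2) |t| with ht2 | ht2
    · exact half r (by omega) hrR t ht ht2
    · obtain ⟨r, rfl⟩ : ∃ r', r = r' + 1 := ⟨r - 1, by omega⟩
      have h0 := abs_lt.1 ht2
      have h1 := half r (by omega) (by omega) _ (hstep t ht).1 (by
        refine le_trans ?_ (le_abs_self _); nlinarith)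
      have h2 := half r (by omega) (by omega) _ (hstep t ht).2 (by
        refine le_trans ?_ (le_abs_self _); nlinarith)
      rw [s.Av_one_add r Q, s.Av_one_add r z, hAv (s.Av r Q), hAv (s.Av r z), div_le_iff₀ hB,
        show ∀ n x : ℝ, (2 * (n / s.B) + D + x) * s.B = 2 * n + D * s.B + x * s.B from
          fun n x => by field_simp]
      have h3 := mul_le_mul_of_nonneg_left h1 (add_nonneg he0 ho0)
      have h4 := mul_le_mul_of_nonneg_left h2 he0
      have h5 : D * s.B + (1 / 2) ^ (i + 1) * Qm * s.B
          = (e + o) * (D + (1 / 2) ^ (i + 1) * Qm) + e * (D + (1 / 2) ^ (i + 1) * Qm) := by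
        rw [hBe']; ring
      linarith

end Sys

lemma sum_shift_sub (f : ℕ → ℝ) (j M : ℕ) :
    ∑ m ∈ Finset.range M, (f (j + m) - f m)
      = ∑ i ∈ Finset.range j, f (M + i) - ∑ i ∈ Finset.range j, f i := by
  have h1 := Finset.sum_range_add f j M
  have h2 := Finset.sum_range_add f M j
  rw [add_comm M j, h1] at h2
  rw [Finset.sum_sub_distrib]
  linarith

/-- A nonnegative sequence with `f m ≤ P m + C` has average increments at most `j P`. -/
lemma le_of_forall_increment {f g : ℕ → ℝ} {P Cf Cg : ℝ} (hf0 : ∀ m, 0 ≤ f m)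
    (hf : ∀ m, f m ≤ P * m + Cf) (hg0 : ∀ m, 0 ≤ g m) (hg : ∀ m, g m ≤ P * m + Cg) {a x : ℝ}
    (ha : 0 ≤ a) {j N : ℕ} (h : ∀ m, x ≤ (f (j + m) - f m) + a * (g (N + m) - g m)) :
    x ≤ j * P + a * (N * P) := by
  have key : ∀ {f : ℕ → ℝ} {Cf : ℝ}, (∀ m, 0 ≤ f m) → (∀ m, f m ≤ P * m + Cf) → ∀ j : ℕ,
      ∃ E : ℝ, ∀ M : ℕ, ∑ m ∈ Finset.range M, (f (j + m) - f m) ≤ M * (j * P) + E := by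
    intro f Cf hf0 hf j
    refine ⟨∑ i ∈ Finset.range j, (P * i + Cf), fun M => ?_⟩
    rw [sum_shift_sub]
    have h1 : ∑ i ∈ Finset.range j, f (M + i) ≤ ∑ i ∈ Finset.range j, (M * P + (P * i + Cf)) :=
      Finset.sum_le_sum fun i _ => (hf _).trans (by push_cast; linarith)
    rw [Finset.sum_add_distrib, Finset.sum_const, Finset.card_range, nsmul_eq_mul] at h1
    have h2 : 0 ≤ ∑ i ∈ Finset.range j, f i := Finset.sum_nonneg fun i _ => hf0 i
    linarith
  obtain ⟨E1, h1⟩ := key hf0 hf j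
  obtain ⟨E2, h2⟩ := key hg0 hg N
  by_contra! hx
  obtain ⟨M, hM⟩ := exists_nat_gt ((E1 + a * E2) / (x - (j * P + a * (N * P))))
  rw [div_lt_iff₀ (by linarith)] at hM
  have h3 : ∑ _m ∈ Finset.range M, x
      ≤ ∑ m ∈ Finset.range M, ((f (j + m) - f m) + a * (g (N + m) - g m)) :=
    Finset.sum_le_sum fun m _ => h m
  rw [Finset.sum_const, Finset.card_range, nsmul_eq_mul, Finset.sum_add_distrib,
    ← Finset.mul_sum] at h3
  have h4 := mul_le_mul_of_nonneg_left (h2 M) ha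
  have h5 := h1 M
  linarith

namespace Sys

variable (s : Sys)

lemma BD_bb (k m : ℕ) : s.BD (s.bb k m) :=
  BD.of_mem_Icc fun _ ht => ⟨s.bb_nonneg _ _ _, (s.bb_le _ _ _).trans (s.HH_le _ ht)⟩

lemma BD_zz (N k m : ℕ) : s.BD (s.zz N k m) := by
  refine BD.of_mem_Icc (a := 0) (b := Real.log (s.W (m + k)).card) fun t _ =>
    ⟨s.zz_nonneg _ _ _ _, (cent_le_ent _ _).trans ?_⟩
  have h1 : Ent (s.W (m + k)) (fun v => s.fl (m + k + N) (s.Pl v t)) ≤ Ent (s.W (m + k)) id :=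
    ent_mono fun a _ b _ h => by rw [show a = b from h]
  exact h1.trans (ent_le_log_card (s.W_nonempty _) _ _ fun a ha => ha)

lemma QQ_eq (k j m : ℕ) : s.QQ k j m = fun t => (j * Real.log s.B - Real.log 3)
    + ((-1) * s.bb k (j + m) t + s.Av j (s.bb k m) t) := by
  funext t; unfold QQ; ring

lemma BD_QQ (k j m : ℕ) : s.BD (s.QQ k j m) := by
  rw [QQ_eq]
  exact (BD.const _).add (((s.BD_bb k _).mul _).add ((s.BD_bb k m).Av j))

variable {s}

lemma Mean.QQ {P : ℝ} (Λ : s.Mean P) (k j m : ℕ) : Λ.toFun (s.QQ k j m)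
    = j * Real.log s.B - Real.log 3 - Λ.toFun (s.bb k (j + m)) + Λ.toFun (s.bb k m) := by
  rw [QQ_eq, Λ.add _ _ (BD.const _) (((s.BD_bb k _).mul _).add ((s.BD_bb k m).Av j)),
    Λ.const, Λ.add _ _ ((s.BD_bb k _).mul _) ((s.BD_bb k m).Av j), Λ.mul _ _ (s.BD_bb k _),
    Λ.inv _ _ (s.BD_bb k m)]
  ring

lemma Mean.affine {P : ℝ} (Λ : s.Mean P) {F : ℝ → ℝ} (hF : s.BD F) (a b : ℝ) :
    Λ.toFun (fun t => a * F t + b) = a * Λ.toFun F + b := by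
  rw [Λ.add _ _ (hF.mul a) (BD.const b), Λ.const, Λ.mul _ _ hF]

lemma Mean.nonneg {P : ℝ} (Λ : s.Mean P) {F : ℝ → ℝ} (hF : s.BD F)
    (h : ∀ t, |t| ≤ s.K → 0 ≤ F t) : 0 ≤ Λ.toFun F := by
  rw [← Λ.const 0]
  exact Λ.mono _ _ (BD.const 0) hF h

/-- The constant in the inequality below. -/
def DD (s : Sys) (i : ℕ) : ℝ := Cpair (s.gam ^ (2 * i)) ⌈2 * s.K / s.gam⌉₊

/-- The averaged form of the pair inequality. -/
lemma Mean.pair {P : ℝ} (Λ : s.Mean P) (N k j m i : ℕ)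
    (hj : (s.B : ℝ) ^ j * s.lam ^ N ≤ 1) :
    Λ.toFun (s.QQ k j m) ≤ 2 * Λ.toFun (s.zz N k (j + m)) + s.DD i
      + (1 / 2) ^ i * (j * Real.log s.B) := by
  have hγ := s.gam_pos
  have hlamL := s.lam_pow_pos (j + m + k)
  obtain ⟨k', hk1, hk2⟩ := exists_nat_pow_near_of_lt_one hlamL
    (pow_le_one₀ s.lam_pos.le s.lam_lt.le) hγ s.gam_lt
  have hk1' : s.gam ^ k' ≤ s.lam ^ (j + m + k) / s.gam := by
    rw [le_div_iff₀ hγ, ← pow_succ]; exact hk1.le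
  have hW := s.W_nonempty k'
  have hpair := s.pairing (z := s.Av k' (s.zz N k (j + m))) (Q := s.Av k' (s.QQ k j m))
    (Qm := j * Real.log s.B) (D := s.DD i) (R := 2 * i)
    (mul_nonneg (Nat.cast_nonneg _) s.logB_pos.le) (Cpair_nonneg _ _)
    (fun t => avg_nonneg fun w _ => s.zz_nonneg _ _ _ _)
    (fun t => avg_le_const' hW fun w _ => s.QQ_le_const _ _ _ _)
    (fun t1 t2 h1 h2 h12 => by
      unfold Sys.Av
      rw [← avg_add, ← avg_add_const hW]
      refine avg_mono fun w hw => s.pair_bound N k j m (by positivity) ?_ ?_ hj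
      · rw [abs_sub_comm, abs_Tl_sub, s.mem_W.1 hw, mul_comm]
        exact mul_le_mul hk2 h12 (by positivity) (by positivity)
      · rw [abs_sub_comm, abs_Tl_sub, s.mem_W.1 hw]
        have e1 : |t1 - t2| ≤ 2 * s.K := (abs_sub _ _).trans (by linarith)
        have e2 : 2 * s.K / s.gam ≤ (⌈2 * s.K / s.gam⌉₊ : ℝ) := Nat.le_ceil _
        calc s.gam ^ k' * |t1 - t2| ≤ s.lam ^ (j + m + k) / s.gam * (2 * s.K) :=
              mul_le_mul hk1' e1 (abs_nonneg _) (by positivity)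
          _ = 2 * s.K / s.gam * s.lam ^ (j + m + k) := by ring
          _ ≤ _ := mul_le_mul_of_nonneg_right e2 hlamL.le) i (2 * i) le_rfl le_rfl
  have hb1 := (s.BD_QQ k j m).Av k'
  have hb2 := (s.BD_zz N k (j + m)).Av k'
  have h := Λ.mono _ (fun t => 2 * s.Av (2 * i) (s.Av k' (s.zz N k (j + m))) t
    + (s.DD i + (1 / 2) ^ i * (j * Real.log s.B))) (hb1.Av (2 * i))
    (((hb2.Av _).mul 2).add (BD.const _)) (fun t ht => by linarith [hpair t ht])
  rw [Λ.affine (hb2.Av _), Λ.inv _ _ hb1, Λ.inv _ _ hb2, Λ.inv _ _ (s.BD_QQ k j m),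
    Λ.inv _ _ (s.BD_zz N k (j + m))] at h
  linarith

lemma Mean.main {P : ℝ} (Λ : s.Mean P) (N k j i : ℕ)
    (hj : (s.B : ℝ) ^ j * s.lam ^ N ≤ 1) (hk : s.gam ^ k * s.K ≤ s.lam ^ N) {a0 a1 : ℝ}
    (ha1 : 0 ≤ a1)
    (hneg : ∀ τ, |τ| ≤ s.K → ∀ A : Finset (List (Fin s.B)), A.Nonempty →
      ∀ X : List (Fin s.B) → ℝ, (∀ v ∈ A, 0 ≤ X v ∧ X v < 1) →
      Ent A (fun v => s.fl N (X v))
        ≤ a0 + a1 * Ent (A ×ˢ s.W N) (fun p => s.fl N (X p.1 + s.Pl p.2 τ))) :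
    j * Real.log s.B * (1 - (1 / 2) ^ i)
      ≤ j * P + 2 * (a0 + a1 * (N * P + s.C4)) + 3 * Real.log 3 + s.DD i := by
  have hzz : ∀ m, Λ.toFun (s.zz N k m) ≤ a0 + Real.log 3
      + a1 * (Λ.toFun (s.HH (m + k + N)) - Λ.toFun (s.HH (m + k)) + s.C4) := by
    intro m
    have hb : s.BD (fun t => s.HH (m + k + N) t + (-1) * s.HH (m + k) t) :=
      (s.BD_HH _).add ((s.BD_HH _).mul _)
    have h := Λ.mono _ (fun t => a1 * (s.HH (m + k + N) t + (-1) * s.HH (m + k) t)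
      + (a0 + Real.log 3 + a1 * s.C4)) (s.BD_zz N k m) ((hb.mul _).add (BD.const _))
      (fun t ht => by linarith [s.zz_le N k m ht hk ha1 hneg])
    rw [Λ.affine hb, Λ.add _ _ (s.BD_HH _) ((s.BD_HH _).mul _), Λ.mul _ _ (s.BD_HH _)] at h
    linarith
  have key := le_of_forall_increment (f := fun m => Λ.toFun (s.bb k m))
    (g := fun m => Λ.toFun (s.HH (j + m + k))) (P := P) (Cf := P * k + Λ.C)
    (Cg := P * (j + k : ℕ) + Λ.C)
    (a := 2 * a1)
    (x := j * Real.log s.B * (1 - (1 / 2) ^ i) - 2 * a0 - 3 * Real.log 3 - 2 * a1 * s.C4 - s.DD i)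
    (j := j) (N := N)
    (fun m => Λ.nonneg (s.BD_bb _ _) fun t _ => s.bb_nonneg _ _ _)
    (fun m => ?_) (fun m => Λ.nonneg (s.BD_HH _) fun t _ => s.HH_nonneg _ _)
    (fun m => ?_) (by positivity) (fun m => ?_)
  · linarith
  · have h1 := Λ.mono _ _ (s.BD_bb k m) (s.BD_HH (m + k)) fun t _ => s.bb_le _ _ _
    have h2 := Λ.bound (m + k)
    push_cast at h2
    linarith
  · have h2 := Λ.bound (j + m + k)
    push_cast at h2 ⊢
    linarith
  · have h1 := Λ.pair N k j m i hj
    rw [Λ.QQ] at h1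
    have h2 := hzz (j + m)
    have e : j + (N + m) + k = j + m + k + N := by ring
    simp only [e]
    linarith

/-- There are sets of substantial entropy whose sum with the height distribution has almost
minimal entropy. -/
def Star (P : ℝ) : Prop := ∃ c > 0, ∀ ε > 0, ∃ N0 : ℕ, ∀ N ≥ N0, ∃ τ, |τ| ≤ s.K ∧
  ∃ A : Finset (List (Fin s.B)), A.Nonempty ∧ ∃ X : List (Fin s.B) → ℝ,
    (∀ v ∈ A, 0 ≤ X v ∧ X v < 1) ∧ c * N ≤ Ent A (fun v => s.fl N (X v)) ∧
    Ent (A ×ˢ s.W N) (fun p => s.fl N (X p.1 + s.Pl p.2 τ)) ≤ (P + ε) * N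

lemma HH_le_ent_add {A : Finset (List (Fin s.B))} (hA : A.Nonempty) (X : List (Fin s.B) → ℝ)
    (N : ℕ) (τ : ℝ) :
    s.HH N τ ≤ Ent (A ×ˢ s.W N) (fun p => s.fl N (X p.1 + s.Pl p.2 τ)) + Real.log 3 := by
  have h1 := avg_ent_le (A := A) (A' := s.W N) (fun p => s.fl N (X p.1 + s.Pl p.2 τ))
  have h2 : s.HH N τ ≤ avg A (fun a => Ent (s.W N) (fun b => s.fl N (X a + s.Pl b τ)) + Real.log 3) := by
    refine const_le_avg hA fun a _ => ?_
    rw [show (3 : ℝ) = ((2 * 1 + 1 : ℕ) : ℝ) by norm_num]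
    refine ent_le_add_of_few (s.few_fl fun b _ b' _ h => ?_)
    have := s.sub_le_of_fl_eq h
    rw [add_sub_add_left_eq_sub] at this
    simpa using this
  rw [avg_add_const hA] at h2
  linarith

theorem star {P C : ℝ} (hPl : P ≤ s.ell)
    (hP : ∀ n : ℕ, ∃ t, |t| ≤ s.K ∧ s.HH n t ≤ P * n + C)
    (hlow : ∀ ε > 0, ∃ Ce : ℝ, 0 ≤ Ce ∧ ∀ (n : ℕ) (t : ℝ), |t| ≤ s.K →
      (P - ε) * n - Ce ≤ s.HH n t) : s.Star P := by
  obtain ⟨Λ⟩ := s.exists_mean hP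
  have hℓ := s.ell_pos
  have hlB := s.logB_pos
  set α := s.ell / Real.log s.B with hα
  have hα1 : α < 1 := (div_lt_one hlB).2 s.ell_lt
  have hα0 : 0 < α := div_pos hℓ hlB
  have hαl : α * Real.log s.B = s.ell := div_mul_cancel₀ _ hlB.ne'
  have h1α : 0 < 1 - α := by linarith
  refine ⟨s.ell * (1 - α) / 8, by positivity, ?_⟩
  by_contra! hcon
  obtain ⟨ε, hε, hcon⟩ := hcon
  obtain ⟨i, hi⟩ := exists_pow_lt_of_lt_one (show 0 < (1 - α) / 4 by positivity)
    (show (1 / 2 : ℝ) < 1 by norm_num)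
  set ε1 := ε * s.ell * (1 - α) / (16 * (s.ell + 3)) with hε1
  have hε1p : 0 < ε1 := by positivity
  obtain ⟨Ce, hCe, hlow⟩ := hlow ε1 hε1p
  set CC := 2 * ((s.ell + 3) / ε) * (Ce + Real.log 3 + s.C4) + 3 * Real.log 3 + s.DD i
    + Real.log s.B with hCC
  obtain ⟨N0, hN0⟩ := exists_nat_gt (CC / (s.ell * (1 - α) * (3 / 8)))
  obtain ⟨N, hN, hneg⟩ := hcon (N0 + 1)
  have hN1 : (1 : ℝ) ≤ N := by exact_mod_cast (by omega : 1 ≤ N)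
  have hNp : (0 : ℝ) < N := by linarith
  have hNN0 : (N0 : ℝ) ≤ N := by exact_mod_cast (by omega : N0 ≤ N)
  have hl3 : 0 < Real.log 3 := Real.log_pos (by norm_num)
  have hl15 : Real.log 15 ≤ 3 := by
    rw [Real.log_le_iff_le_exp (by norm_num)]
    have h1 := Real.exp_one_gt_d9
    have h2 : Real.exp 3 = Real.exp 1 ^ 3 := by rw [← Real.exp_nat_mul]; norm_num
    rw [h2]
    have h3 : (2.7 : ℝ) ^ 3 ≤ Real.exp 1 ^ 3 := pow_le_pow_left₀ (by norm_num) (by linarith) 3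
    norm_num at h3 ⊢
    linarith
  set a1 := (s.ell + 3) / ε with ha1
  have ha1p : 0 < a1 := by positivity
  set a0 := s.ell * (1 - α) / 8 * N - a1 * ((P - ε1) * N - Ce - Real.log 3) with ha0
  obtain ⟨k, hk⟩ := exists_pow_lt_of_lt_one (div_pos (s.lam_pow_pos N) s.K_pos) s.gam_lt
  rw [lt_div_iff₀ s.K_pos] at hk
  set j := ⌊N * α⌋₊ with hj
  have hj1 : (j : ℝ) ≤ N * α := Nat.floor_le (by positivity)
  have hj2 : (N : ℝ) * α < j + 1 := Nat.lt_floor_add_one _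
  have hj0 : (0 : ℝ) ≤ j := Nat.cast_nonneg _
  have hjB : (s.B : ℝ) ^ j * s.lam ^ N ≤ 1 := by
    have hp : (0 : ℝ) < s.B ^ j * s.lam ^ N := mul_pos (pow_pos s.B_pos _) (s.lam_pow_pos _)
    rw [← Real.log_nonpos_iff hp.le, Real.log_mul (pow_pos s.B_pos _).ne' (s.lam_pow_pos N).ne',
      Real.log_pow]
    have h1 := s.log_inv_lam_pow N
    rw [Real.log_inv] at h1
    have h2 := mul_le_mul_of_nonneg_right hj1 hlB.le
    rw [mul_assoc, hαl] at h2
    linarith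
  have hmain := Λ.main N k j i hjB hk.le (a0 := a0) ha1p.le (fun τ hτ A hA X hX => by
    have h1 := s.HH_le_ent_add hA X N τ
    have h2 := hlow N τ hτ
    have h3 : 0 ≤ a1 * (Ent (A ×ˢ s.W N) (fun p => s.fl N (X p.1 + s.Pl p.2 τ))
        - ((P - ε1) * N - Ce - Real.log 3)) := mul_nonneg ha1p.le (by linarith)
    by_cases hc : s.ell * (1 - α) / 8 * N ≤ Ent A (fun v => s.fl N (X v))
    · have h4 := hneg τ hτ A hA X hX hc
      have h5 : a1 * (ε * N) ≤ a1 * (Ent (A ×ˢ s.W N) (fun p => s.fl N (X p.1 + s.Pl p.2 τ))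
        - ((P - ε1) * N - Ce - Real.log 3)) := by
        refine mul_le_mul_of_nonneg_left ?_ ha1p.le
        have : 0 ≤ ε1 * N := by positivity
        linarith
      have h6 : a1 * (ε * N) = (s.ell + 3) * N := by rw [ha1]; field_simp
      have h7 := s.cent_fl_le (A := A) (x := X) (y := fun _ => 0) (n := 0) (k := 1) zero_le_one
        (fun v hv => by
          have := hX v hv
          rw [sub_zero, pow_zero, mul_one, abs_of_nonneg this.1]; exact this.2.le) N
      have h8 : Ent A (fun v => s.fl N (X v))
          ≤ CEnt A (fun v => s.fl (0 + N) (X v)) (fun v => s.fl 0 0) := by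
        unfold CEnt
        rw [zero_add]
        have e1 : Ent A (fun v => s.fl N (X v))
            ≤ Ent A (fun v => (s.fl N (X v), s.fl 0 0)) :=
          ent_mono fun a _ b _ h => by simp only [Prod.mk.injEq] at h; exact h.1
        have e2 : Ent A (fun _ => s.fl 0 0) ≤ Real.log (({s.fl 0 0} : Finset ℤ).card) :=
          ent_le_log_card hA _ _ fun a _ => by simp
        rw [Finset.card_singleton, Nat.cast_one, Real.log_one] at e2
        linarith
      norm_num at h7
      have h9 : 0 ≤ s.ell * (1 - α) / 8 * N := by positivity
      norm_num at h8
      nlinarith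
    · linarith)
  have h1 : (N : ℝ) * s.ell - Real.log s.B ≤ j * Real.log s.B := by
    have h2 := mul_le_mul_of_nonneg_right hj2.le hlB.le
    rw [mul_assoc, hαl] at h2
    linarith
  have h2 : j * Real.log s.B ≤ N * s.ell := by
    have h2 := mul_le_mul_of_nonneg_right hj1 hlB.le
    rw [mul_assoc, hαl] at h2
    exact h2
  have h3 : j * P ≤ N * α * s.ell :=
    (mul_le_mul_of_nonneg_left hPl hj0).trans (mul_le_mul_of_nonneg_right hj1 hℓ.le)
  have h4 : (1 / 2 : ℝ) ^ i * (j * Real.log s.B) ≤ (1 - α) / 4 * (N * s.ell) :=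
    mul_le_mul hi.le h2 (by positivity) (by positivity)
  have h5 : a1 * (ε1 * N) = N * (s.ell * (1 - α) / 16) := by
    rw [ha1, hε1]; field_simp
  rw [div_lt_iff₀ (by positivity)] at hN0
  have h6 : (N0 : ℝ) * (s.ell * (1 - α) * (3 / 8)) ≤ N * (s.ell * (1 - α) * (3 / 8)) :=
    mul_le_mul_of_nonneg_right hNN0 (by positivity)
  rw [ha0] at hmain
  nlinarith

end Sys

section

variable {Ω Ω' Ω'' S T : Type*}

lemma ent_equiv (e : Ω' ≃ Ω) {A' : Finset Ω'} {A : Finset Ω} (h : ∀ a, a ∈ A' ↔ e a ∈ A)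
    (X : Ω → S) : Ent A X = Ent A' (X ∘ e) := by
  classical
  rw [← ent_image (e.injective.injOn)]
  congr 1
  ext a
  simp only [Finset.mem_image]
  constructor
  · intro ha
    exact ⟨e.symm a, (h _).2 (by simpa using ha), by simp⟩
  · rintro ⟨b, hb, rfl⟩
    exact (h _).1 hb

lemma avg_equiv (e : Ω' ≃ Ω) {A' : Finset Ω'} {A : Finset Ω} (h : ∀ a, a ∈ A' ↔ e a ∈ A)
    (f : Ω → ℝ) : avg A f = avg A' (f ∘ e) := by
  classical
  rw [← avg_image (e.injective.injOn)]
  congr 1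
  ext a
  simp only [Finset.mem_image]
  constructor
  · intro ha
    exact ⟨e.symm a, (h _).2 (by simpa using ha), by simp⟩
  · rintro ⟨b, hb, rfl⟩
    exact (h _).1 hb

lemma cent_equiv (e : Ω' ≃ Ω) {A' : Finset Ω'} {A : Finset Ω} (h : ∀ a, a ∈ A' ↔ e a ∈ A)
    (X : Ω → S) (Y : Ω → T) : CEnt A X Y = CEnt A' (X ∘ e) (Y ∘ e) := by
  unfold CEnt
  rw [ent_equiv e h, ent_equiv e h]
  rfl

lemma cent_fst_add_ent {A : Finset Ω} {A' : Finset Ω'} (hA : A.Nonempty) (hA' : A'.Nonempty)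
    (Z : Ω × Ω' → S) :
    CEnt (A ×ˢ A') Prod.fst Z + Ent (A ×ˢ A') Z
      = avg A (fun a => Ent A' (fun b => Z (a, b))) + Real.log A.card := by
  have h1 := cent_prod_fst (A := A) (A' := A') Z
  have h2 : Ent (A ×ˢ A') Prod.fst = Ent A id := ent_prod_fst hA' id
  rw [ent_of_inj hA (Function.injective_id.injOn)] at h2
  have h3 : Ent (A ×ˢ A') (fun p => (p.1, Z p)) = Ent (A ×ˢ A') (fun p => (Z p, p.1)) :=
    ent_congr fun p _ q _ => by simp only [Prod.mk.injEq]; tauto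
  unfold CEnt at *
  rw [h3, ← h1, h2]
  ring

/-- The Kaimanovich–Vershik inequality. -/
lemma ent_add_add_le {AT : Finset Ω} {AX : Finset Ω'} {AY : Finset Ω''} (hT : AT.Nonempty)
    (hX : AX.Nonempty) (hY : AY.Nonempty) (f : Ω → ℤ) (g : Ω' → ℤ) (h : Ω'' → ℤ) :
    Ent (AT ×ˢ (AX ×ˢ AY)) (fun p => f p.1 + (g p.2.1 + h p.2.2)) + Ent AY h
      ≤ Ent (AX ×ˢ AY) (fun p => g p.1 + h p.2) + Ent (AT ×ˢ AY) (fun p => f p.1 + h p.2) := by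
  have h1 := cent_fst_add_ent hT (hX.product hY)
    (fun p : Ω × (Ω' × Ω'') => f p.1 + (g p.2.1 + h p.2.2))
  have h2 := cent_fst_add_ent hT hY (fun p : Ω × Ω'' => f p.1 + h p.2)
  have e1 : avg AT (fun a => Ent (AX ×ˢ AY) (fun b => f a + (g b.1 + h b.2)))
      = Ent (AX ×ˢ AY) (fun b => g b.1 + h b.2) := by
    rw [← avg_const hT (Ent (AX ×ˢ AY) (fun b => g b.1 + h b.2))]
    exact avg_congr fun a _ => ent_congr fun p _ q _ => by simp
  have e2 : avg AT (fun a => Ent AY (fun b => f a + h b)) = Ent AY h := by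
    rw [← avg_const hT (Ent AY h)]
    exact avg_congr fun a _ => ent_congr fun p _ q _ => by simp
  have h3 : CEnt (AT ×ˢ AY) Prod.fst (fun p => f p.1 + h p.2)
      ≤ CEnt (AT ×ˢ (AX ×ˢ AY)) Prod.fst (fun p => f p.1 + (g p.2.1 + h p.2.2)) := by
    have h4 : CEnt (AT ×ˢ (AX ×ˢ AY)) Prod.fst (fun p => (p.2.1, f p.1 + h p.2.2))
        ≤ CEnt (AT ×ˢ (AX ×ˢ AY)) Prod.fst (fun p => f p.1 + (g p.2.1 + h p.2.2)) :=
      cent_antitone fun p _ q _ hpq => by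
        simp only [Prod.mk.injEq] at hpq
        rw [hpq.1]; linarith [hpq.2]
    refine le_trans (le_of_eq ?_) h4
    let e : Ω' × (Ω × Ω'') ≃ Ω × (Ω' × Ω'') :=
      ⟨fun p => (p.2.1, p.1, p.2.2), fun p => (p.2.1, p.1, p.2.2), fun _ => rfl, fun _ => rfl⟩
    rw [cent_equiv e (A' := AX ×ˢ (AT ×ˢ AY)) (fun p => by simp [e]; tauto)]
    have h5 := cent_prod_fst_pair (A := AX) (A' := AT ×ˢ AY) (fun p => p.2.1)
      (fun p => f p.2.1 + h p.2.2)
    refine Eq.trans ?_ h5.symm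
    exact (avg_const hX (CEnt (AT ×ˢ AY) Prod.fst (fun p => f p.1 + h p.2))).symm
  simp only at h1 h2
  linarith

lemma mem_pi_cons {k : ℕ} (AA : Fin (k + 1) → Finset Ω) (p : Ω × (Fin k → Ω)) :
    p ∈ AA 0 ×ˢ Fintype.piFinset (fun i => AA i.succ)
      ↔ Fin.consEquiv (fun _ => Ω) p ∈ Fintype.piFinset AA := by
  rw [Fin.mem_piFinset_iff_zero_tail]
  simp [Fin.consEquiv, Fin.tail]

lemma avg_pi_succ {k : ℕ} (AA : Fin (k + 1) → Finset Ω) (f : (Fin (k + 1) → Ω) → ℝ) :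
    avg (Fintype.piFinset AA) f = avg (AA 0) (fun a =>
      avg (Fintype.piFinset (fun i => AA i.succ)) (fun z => f (Fin.cons a z))) := by
  rw [avg_equiv (Fin.consEquiv fun _ => Ω) (mem_pi_cons AA), avg_prod]
  rfl

/-- The power of a finite set. -/
def pw (k : ℕ) (A : Finset Ω) : Finset (Fin k → Ω) := Fintype.piFinset (fun _ => A)

lemma pw_nonempty {A : Finset Ω} (hA : A.Nonempty) (k : ℕ) : (pw k A).Nonempty :=
  Fintype.piFinset_nonempty.2 fun _ => hA

lemma ent_sum_le {A : Finset Ω} {A' : Finset Ω'} (hA : A.Nonempty) (hA' : A'.Nonempty)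
    (X : Ω → ℤ) (Y : Ω' → ℤ) (k : ℕ) :
    Ent (pw k A ×ˢ A') (fun p => ∑ i, X (p.1 i) + Y p.2)
      ≤ Ent A' Y + k * (Ent (A ×ˢ A') (fun p => X p.1 + Y p.2) - Ent A' Y) := by
  induction k with
  | zero =>
    simp only [Finset.univ_eq_empty, Finset.sum_empty, zero_add, Nat.cast_zero, zero_mul, add_zero]
    exact (ent_prod_snd (pw_nonempty hA 0) Y).le
  | succ k ih =>
    let e : Ω × ((Fin k → Ω) × Ω') ≃ (Fin (k + 1) → Ω) × Ω' :=
      (Equiv.prodAssoc _ _ _).symm.trans ((Fin.consEquiv fun _ => Ω).prodCongr (Equiv.refl _))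
    have h1 : Ent (pw (k + 1) A ×ˢ A') (fun p => ∑ i, X (p.1 i) + Y p.2)
        = Ent (A ×ˢ (pw k A ×ˢ A')) (fun p => X p.1 + (∑ i, X (p.2.1 i) + Y p.2.2)) := by
      rw [ent_equiv e (A' := A ×ˢ (pw k A ×ˢ A'))]
      · refine ent_congr fun p _ q _ => ?_
        simp [e, Fin.sum_univ_succ, Fin.consEquiv, add_assoc]
      · rintro ⟨a, z, b⟩
        have := mem_pi_cons (fun _ : Fin (k + 1) => A) (a, z)
        simp only [Finset.mem_product] at this ⊢
        unfold pw
        rw [show (e (a, z, b)).1 = Fin.consEquiv (fun _ => Ω) (a, z) from rfl, ← this]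
        exact and_assoc.symm
    have h2 := ent_add_add_le hA (pw_nonempty hA k) hA' X (fun z => ∑ i, X (z i)) Y
    rw [h1]
    push_cast
    linarith

theorem centralBinom_sq_mul_le (n : ℕ) : n.centralBinom ^ 2 * (2 * n + 1) ≤ 16 ^ n := by
  induction n with
  | zero => simp
  | succ n ih =>
    have h := Nat.succ_mul_centralBinom_succ n
    have h2 : ((n + 1) * (n + 1).centralBinom) ^ 2 * (2 * (n + 1) + 1)
        ≤ (n + 1) ^ 2 * 16 ^ (n + 1) := by
      rw [h]
      calc (2 * (2 * n + 1) * n.centralBinom) ^ 2 * (2 * (n + 1) + 1)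
          = (4 * ((2 * n + 1) * (2 * n + 3))) * (n.centralBinom ^ 2 * (2 * n + 1)) := by ring
        _ ≤ (4 * (4 * (n + 1) ^ 2)) * 16 ^ n := by
            apply Nat.mul_le_mul _ ih
            nlinarith
        _ = _ := by ring
    have h3 : (n + 1) ^ 2 * ((n + 1).centralBinom ^ 2 * (2 * (n + 1) + 1))
        ≤ (n + 1) ^ 2 * 16 ^ (n + 1) := by
      calc _ = _ := by ring
        _ ≤ _ := h2
    exact Nat.le_of_mul_le_mul_left h3 (by positivity)

theorem choose_half_sq_mul_le (m : ℕ) : (m.choose (m / 2)) ^ 2 * (m + 1) ≤ 4 ^ m := by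
  obtain ⟨n, rfl | rfl⟩ := Nat.even_or_odd' m
  · have := centralBinom_sq_mul_le n
    rw [Nat.centralBinom_eq_two_mul_choose] at this
    rw [show 2 * n / 2 = n by omega, pow_mul]
    exact this
  · have := centralBinom_sq_mul_le (n + 1)
    have h2 : (n + 1).centralBinom = 2 * (2 * n + 1).choose n := by
      rw [Nat.centralBinom_eq_two_mul_choose, show 2 * (n + 1) = (2 * n + 1) + 1 by ring,
        Nat.choose_succ_succ, Nat.choose_symm_half, ← two_mul]
    rw [h2] at this
    rw [show (2 * n + 1) / 2 = n by omega]
    have h3 : 16 ^ (n + 1) = 4 * 4 ^ (2 * n + 1) := by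
      rw [show (16 : ℕ) = 4 ^ 2 by norm_num, ← pow_mul]; ring
    rw [h3] at this
    nlinarith [sq_nonneg ((2 * n + 1).choose n)]

theorem choose_half_le (m : ℕ) :
    ((m.choose (m / 2) : ℕ) : ℝ) / 2 ^ m ≤ 1 / √((m : ℝ) + 1) := by
  have h : (((m.choose (m / 2) : ℕ) : ℝ)) ^ 2 * ((m : ℝ) + 1) ≤ 4 ^ m := by
    exact_mod_cast choose_half_sq_mul_le m
  rw [div_le_div_iff₀ (by positivity) (by positivity), one_mul]
  refine (sq_le_sq₀ (by positivity) (by positivity)).1 ?_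
  rw [mul_pow, Real.sq_sqrt (by positivity), ← pow_mul, mul_comm m 2, pow_mul]
  norm_num
  exact h

theorem sum_eq_sum_ite {ι : Type*} [Fintype ι] [DecidableEq ι] (T : Finset ι) (f : ι → ℝ) :
    ∑ i ∈ T, f i = ∑ i, if i ∈ T then f i else 0 := by
  simp

/-- Littlewood–Offord for positive weights. -/
theorem card_small_sums_pos {ι : Type*} [Fintype ι] [DecidableEq ι] (a : ι → ℝ) {δ : ℝ}
    (ha : ∀ i, δ < a i) (hδ : 0 ≤ δ) (u : ℝ) :
    (Finset.univ.filter fun T : Finset ι => |u - 2 * ∑ i ∈ T, a i| ≤ δ).card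
      ≤ (Fintype.card ι).choose (Fintype.card ι / 2) := by
  apply IsAntichain.sperner
  intro T hT T' hT' hne hsub
  simp only [Finset.coe_filter, Finset.mem_univ, true_and, mem_ofPred_eq, abs_le] at hT hT'
  obtain ⟨i, hi, hi'⟩ := Finset.exists_of_ssubset (Finset.ssubset_iff_subset_ne.2 ⟨hsub, hne⟩)
  have h1 : ∑ j ∈ insert i T, a j ≤ ∑ j ∈ T', a j :=
    Finset.sum_le_sum_of_subset_of_nonneg (Finset.insert_subset hi hsub)
      fun j _ _ => (hδ.trans (ha j).le)
  rw [Finset.sum_insert hi'] at h1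
  linarith [ha i, hT.1, hT.2, hT'.1, hT'.2]

theorem card_small_sums {ι : Type*} [Fintype ι] [DecidableEq ι] (a : ι → ℝ) {δ : ℝ}
    (ha : ∀ i, δ < |a i|) (hδ : 0 ≤ δ) (u : ℝ) :
    (Finset.univ.filter fun T : Finset ι => |u - 2 * ∑ i ∈ T, a i| ≤ δ).card
      ≤ (Fintype.card ι).choose (Fintype.card ι / 2) := by
  set Ng : Finset ι := Finset.univ.filter fun i => a i < 0 with hNg
  have key : ∀ T : Finset ι, ∑ i ∈ T, a i = ∑ i ∈ symmDiff T Ng, |a i| + ∑ i ∈ Ng, a i := by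
    intro T
    rw [sum_eq_sum_ite T, sum_eq_sum_ite (symmDiff T Ng), sum_eq_sum_ite Ng, ← Finset.sum_add_distrib]
    apply Finset.sum_congr rfl
    intro i _
    by_cases h1 : i ∈ T <;> by_cases h2 : a i < 0
    all_goals simp [Finset.mem_symmDiff, h1, h2, hNg, abs_of_neg, abs_of_nonneg, not_lt.1]
  refine le_trans ?_ (card_small_sums_pos (fun i => |a i|) ha hδ (u - 2 * ∑ i ∈ Ng, a i))
  apply Finset.card_le_card_of_injOn (fun T => symmDiff T Ng)
  · intro T hT
    simp only [Finset.coe_filter, Finset.mem_univ, true_and, mem_ofPred_eq] at hT ⊢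
    rw [key T] at hT
    convert hT using 2
    ring
  · intro T _ T' _ h
    exact symmDiff_left_injective Ng h

theorem card_small_subsums {ι : Type*} [DecidableEq ι] (M : Finset ι) (a : ι → ℝ) {δ : ℝ}
    (ha : ∀ i ∈ M, δ < |a i|) (hδ : 0 ≤ δ) (u : ℝ) :
    (M.powerset.filter fun T : Finset ι => |u - 2 * ∑ i ∈ T, a i| ≤ δ).card
      ≤ M.card.choose (M.card / 2) := by
  have h := card_small_sums (ι := {i // i ∈ M}) (fun i => a i) (fun i => ha i i.2) hδ u
  rw [Fintype.card_coe] at h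
  refine le_trans ?_ h
  apply Finset.card_le_card_of_injOn (fun T => T.subtype (· ∈ M))
  · intro T hT
    simp only [Finset.coe_filter, Finset.mem_univ, true_and, mem_ofPred_eq,
      Finset.mem_powerset] at hT ⊢
    rw [Finset.sum_subtype_of_mem a (fun i hi => hT.1 hi)]
    exact hT.2
  · intro T hT T' hT' hE
    simp only [Finset.coe_filter, mem_ofPred_eq, Finset.mem_powerset] at hT hT'
    ext i
    have := congrArg (fun U => U.map (Function.Embedding.subtype (· ∈ M))) hE
    simp only [Finset.subtype_map] at this
    rw [Finset.filter_true_of_mem hT.1, Finset.filter_true_of_mem hT'.1] at this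
    rw [this]

section swap
variable {Ω : Type*} {k : ℕ}

/-- Interchange of the coordinates in `η` of a pair of vectors. -/
def swp (η : Finset (Fin k)) (p : (Fin k → Ω) × (Fin k → Ω)) : (Fin k → Ω) × (Fin k → Ω) :=
  (fun i => if i ∈ η then p.2 i else p.1 i, fun i => if i ∈ η then p.1 i else p.2 i)

theorem swp_swp (η : Finset (Fin k)) (p : (Fin k → Ω) × (Fin k → Ω)) : swp η (swp η p) = p := by
  ext i <;> by_cases h : i ∈ η <;> simp [swp, h]

/-- The coordinates in which a pair of vectors differs by more than `δ`. -/
def sep (X : Ω → ℝ) (δ : ℝ) (p : (Fin k → Ω) × (Fin k → Ω)) : Finset (Fin k) :=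
  Finset.univ.filter fun i => δ < |X (p.1 i) - X (p.2 i)|

theorem sep_swp (X : Ω → ℝ) (δ : ℝ) (η : Finset (Fin k)) (p : (Fin k → Ω) × (Fin k → Ω)) :
    sep X δ (swp η p) = sep X δ p := by
  ext i
  by_cases h : i ∈ η <;> simp [sep, swp, h, abs_sub_comm]

theorem swp_sum (X : Ω → ℝ) (η : Finset (Fin k)) (p : (Fin k → Ω) × (Fin k → Ω)) :
    ∑ i, X ((swp η p).1 i) - ∑ i, X ((swp η p).2 i)
      = (∑ i, X (p.1 i) - ∑ i, X (p.2 i)) - 2 * ∑ i ∈ η, (X (p.1 i) - X (p.2 i)) := by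
  rw [sum_eq_sum_ite η, Finset.mul_sum, ← Finset.sum_sub_distrib,
    ← Finset.sum_sub_distrib, ← Finset.sum_sub_distrib]
  apply Finset.sum_congr rfl
  intro i _
  by_cases h : i ∈ η <;> simp [swp, h]
  ring

theorem avg_le_of_swp (AA : Fin k → Finset Ω) (X : Ω → ℝ) {δ : ℝ} (hδ : 0 ≤ δ) :
    avg (Fintype.piFinset AA ×ˢ Fintype.piFinset AA)
        (fun p => if |∑ i, X (p.1 i) - ∑ i, X (p.2 i)| ≤ δ then (1 : ℝ) else 0)
      ≤ avg (Fintype.piFinset AA ×ˢ Fintype.piFinset AA)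
        (fun p => 1 / √(((sep X δ p).card : ℝ) + 1)) := by
  set Q := Fintype.piFinset AA ×ˢ Fintype.piFinset AA with hQ
  set f : (Fin k → Ω) × (Fin k → Ω) → ℝ :=
    fun p => if |∑ i, X (p.1 i) - ∑ i, X (p.2 i)| ≤ δ then (1 : ℝ) else 0 with hf
  have hmem : ∀ η p, p ∈ Q → swp η p ∈ Q := by
    intro η p hp
    simp only [hQ, Finset.mem_product, Fintype.mem_piFinset] at hp ⊢
    constructor <;> intro i <;> by_cases h : i ∈ η <;> simp [swp, h, hp.1 i, hp.2 i]
  have e1 : ∑ p ∈ Q, f p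
      = ∑ p ∈ Q, ∑ η ∈ (sep X δ p).powerset, f (swp η p) / 2 ^ (sep X δ p).card := by
    have : ∑ p ∈ Q, f p
        = ∑ p ∈ Q, ∑ η ∈ (sep X δ p).powerset, f p / 2 ^ (sep X δ p).card := by
      apply Finset.sum_congr rfl
      intro p _
      rw [Finset.sum_const, Finset.card_powerset, nsmul_eq_mul]
      push_cast
      field_simp
    rw [this, Finset.sum_sigma', Finset.sum_sigma']
    refine Finset.sum_bij' (fun q _ => ⟨swp q.2 q.1, q.2⟩) (fun q _ => ⟨swp q.2 q.1, q.2⟩)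
      ?_ ?_ ?_ ?_ ?_
    · rintro ⟨p, η⟩ h
      simp only [Finset.mem_sigma, sep_swp] at h ⊢
      exact ⟨hmem _ _ h.1, h.2⟩
    · rintro ⟨p, η⟩ h
      simp only [Finset.mem_sigma, sep_swp] at h ⊢
      exact ⟨hmem _ _ h.1, h.2⟩
    · rintro ⟨p, η⟩ _
      simp [swp_swp]
    · rintro ⟨p, η⟩ _
      simp [swp_swp]
    · rintro ⟨p, η⟩ _
      simp [swp_swp, sep_swp]
  unfold avg
  rw [e1]
  apply div_le_div_of_nonneg_right _ (Nat.cast_nonneg _)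
  apply Finset.sum_le_sum
  intro p _
  rw [← Finset.sum_div]
  refine le_trans ?_ (choose_half_le _)
  apply div_le_div_of_nonneg_right _ (by positivity)
  have h2 := card_small_subsums (sep X δ p) (fun i => X (p.1 i) - X (p.2 i)) (δ := δ)
    (fun i hi => by simpa [sep] using hi) hδ (∑ i, X (p.1 i) - ∑ i, X (p.2 i))
  have h3 : ∑ η ∈ (sep X δ p).powerset, f (swp η p)
      = (((sep X δ p).powerset.filter fun T : Finset (Fin k) =>
        |(∑ i, X (p.1 i) - ∑ i, X (p.2 i)) - 2 * ∑ i ∈ T, (X (p.1 i) - X (p.2 i))| ≤ δ).card : ℝ) := by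
    rw [Finset.card_filter]
    push_cast
    apply Finset.sum_congr rfl
    intro η _
    simp only [hf, swp_sum]
  rw [h3]
  exact_mod_cast h2

theorem avg_pi_prod (AA : Fin k → Finset Ω) (g : Fin k → Ω → ℝ) :
    avg (Fintype.piFinset AA) (fun x => ∏ i, g i (x i)) = ∏ i, avg (AA i) (g i) := by
  unfold avg
  rw [Finset.prod_div_distrib, Finset.prod_univ_sum, Fintype.card_piFinset]
  push_cast
  rfl

theorem avg_pi_pair_prod (AA : Fin k → Finset Ω) (h : Ω → Ω → ℝ) :
    avg (Fintype.piFinset AA ×ˢ Fintype.piFinset AA) (fun p => ∏ i, h (p.1 i) (p.2 i))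
      = ∏ i, avg (AA i ×ˢ AA i) (fun b => h b.1 b.2) := by
  rw [avg_prod]
  simp only [avg_prod]
  rw [← avg_pi_prod]
  congr 1
  ext z
  exact avg_pi_prod AA (fun i => h (z i))

end swap

theorem integral_affine_pow_le {q : ℝ} (hq : 0 < q) (hq1 : q ≤ 1) (k : ℕ) :
    ∫ t in (0:ℝ)..1, (1 - q + q * t) ^ k ≤ 1 / ((k + 1) * q) := by
  have hd : ∀ t ∈ uIcc (0:ℝ) 1, HasDerivAt (fun t : ℝ => (1 - q + q * t) ^ (k + 1) / ((k + 1) * q))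
      ((1 - q + q * t) ^ k) t := by
    intro t _
    have h1 : HasDerivAt (fun t : ℝ => 1 - q + q * t) q t := by
      simpa using ((hasDerivAt_id t).const_mul q).const_add (1 - q)
    have := (h1.pow (k + 1)).div_const ((k + 1) * q)
    refine this.congr_deriv ?_
    have hk : (k : ℝ) + 1 ≠ 0 := by positivity
    rw [Nat.add_sub_cancel]
    push_cast
    field_simp
  rw [intervalIntegral.integral_eq_sub_of_hasDerivAt hd
    (Continuous.intervalIntegrable (by fun_prop) _ _)]
  have : 0 ≤ (1 - q + q * 0) ^ (k + 1) / ((k + 1) * q) := by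
    have : 0 ≤ 1 - q := by linarith
    simp only [mul_zero, add_zero]
    positivity
  have h2 : 1 - q + q * 1 = 1 := by ring
  rw [h2, one_pow]
  linarith

end

section

variable {Ω Ω' S T : Type*}

theorem ent_ge_coll {A : Finset Ω} (hA : A.Nonempty) [DecidableEq S] (U : Ω → S) {y : ℝ}
    (hy : 0 < y) :
    1 - (1 / y) * avg (A ×ˢ A) (fun p => if U p.1 = U p.2 then (1 : ℝ) else 0) - Real.log y
      ≤ Ent A U := by
  have e : 1 - (1 / y) * avg (A ×ˢ A) (fun p => if U p.1 = U p.2 then (1 : ℝ) else 0) - Real.log y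
      = avg A (fun a => 1 - (1 / y) * avg A (fun b => if U a = U b then (1 : ℝ) else 0)
          - Real.log y) := by
    rw [avg_sub, avg_sub, avg_mul, avg_prod, avg_const hA, avg_const hA]
  rw [e]
  apply avg_mono
  intro a ha
  have hc : avg A (fun b => if U a = U b then (1 : ℝ) else 0)
      = ((fib A U a).card : ℝ) / A.card := by
    classical
    unfold avg fib
    rw [Finset.sum_boole]
    congr 3
    ext b
    simp [eq_comm]
  rw [hc]
  have h1 := card_fib_pos (X := U) ha
  have h2 := card_pos_of_mem ha
  set c : ℝ := ((fib A U a).card : ℝ) / A.card with hcd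
  have hcp : 0 < c := by positivity
  have h3 : (A.card : ℝ) / ((fib A U a).card : ℝ) = c⁻¹ := by rw [hcd, inv_div]
  rw [h3, Real.log_inv]
  have h4 := Real.log_le_sub_one_of_pos (show 0 < c / y by positivity)
  rw [Real.log_div hcp.ne' hy.ne'] at h4
  have h5 : c / y = 1 / y * c := by ring
  linarith

theorem fib_pw {k : ℕ} (A : Finset Ω) (U : Ω → S) (x : Fin k → Ω) :
    fib (pw k A) (fun x i => U (x i)) x = Fintype.piFinset (fun i => fib A U (x i)) := by
  ext z
  simp only [mem_fib, pw, Fintype.mem_piFinset, funext_iff]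
  exact ⟨fun h i => ⟨h.1 i, h.2 i⟩, fun h => ⟨fun i => (h i).1, fun i => (h i).2⟩⟩

/-- The probability that two points of the same fibre are more than `δ` apart. -/
def spr (A : Finset Ω) (X : Ω → ℝ) (U : Ω → S) (δ : ℝ) : ℝ :=
  avg A fun a => avg (fib A U a ×ˢ fib A U a)
    fun b => if δ < |X b.1 - X b.2| then (1 : ℝ) else 0

theorem spr_le_one (A : Finset Ω) (X : Ω → ℝ) (U : Ω → S) (δ : ℝ) : spr A X U δ ≤ 1 :=
  avg_le_const zero_le_one fun _ _ => avg_le_const zero_le_one fun _ _ => by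
    split_ifs <;> norm_num

theorem avg_integral (A : Finset Ω) (f : Ω → ℝ → ℝ) (hf : ∀ a, Continuous (f a)) :
    avg A (fun a => ∫ t in (0:ℝ)..1, f a t) = ∫ t in (0:ℝ)..1, avg A (fun a => f a t) := by
  unfold avg
  rw [intervalIntegral.integral_div, intervalIntegral.integral_finsetSum]
  intro a _
  exact (hf a).intervalIntegrable _ _

theorem continuous_avg (A : Finset Ω) (f : Ω → ℝ → ℝ) (hf : ∀ a, Continuous (f a)) :
    Continuous fun t => avg A (fun a => f a t) := by
  unfold avg
  exact (continuous_finsetSum _ fun a _ => hf a).div_const _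

theorem integral_pow_unit (m : ℕ) : ∫ t in (0:ℝ)..1, t ^ m = 1 / ((m : ℝ) + 1) := by
  simp

theorem avg_inv_sep_le {A : Finset Ω} (hA : A.Nonempty) (X : Ω → ℝ) (U : Ω → S) (δ : ℝ) (k : ℕ)
    (hq : 0 < spr A X U δ) :
    avg (pw k A) (fun x =>
        avg (Fintype.piFinset (fun i => fib A U (x i)) ×ˢ Fintype.piFinset (fun i => fib A U (x i)))
          (fun p => 1 / (((sep X δ p).card : ℝ) + 1)))
      ≤ 1 / ((k + 1) * spr A X U δ) := by
  refine le_trans (le_of_eq ?_) (integral_affine_pow_le hq (spr_le_one A X U δ) k)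
  simp_rw [← integral_pow_unit]
  have : ∀ x : Fin k → Ω, avg (Fintype.piFinset (fun i => fib A U (x i)) ×ˢ
      Fintype.piFinset (fun i => fib A U (x i)))
        (fun p => ∫ t in (0:ℝ)..1, t ^ (sep X δ p).card)
      = ∫ t in (0:ℝ)..1, avg (Fintype.piFinset (fun i => fib A U (x i)) ×ˢ
          Fintype.piFinset (fun i => fib A U (x i))) (fun p => t ^ (sep X δ p).card) := fun x =>
    avg_integral _ (fun p t => t ^ (sep X δ p).card) (fun p => by fun_prop)
  simp_rw [this]
  rw [avg_integral (pw k A) (fun x t => avg (Fintype.piFinset (fun i => fib A U (x i)) ×ˢ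
          Fintype.piFinset (fun i => fib A U (x i))) (fun p => t ^ (sep X δ p).card))
    (fun x => continuous_avg _ _ fun p => by fun_prop)]
  congr 1
  ext t
  have h1 : ∀ p : (Fin k → Ω) × (Fin k → Ω), t ^ (sep X δ p).card
      = ∏ i, (fun b b' => if δ < |X b - X b'| then t else 1) (p.1 i) (p.2 i) := by
    intro p
    simp [sep, Finset.prod_ite]
  have h1' : ∀ x : Fin k → Ω, avg (Fintype.piFinset (fun i => fib A U (x i)) ×ˢ
      Fintype.piFinset (fun i => fib A U (x i))) (fun p => t ^ (sep X δ p).card)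
      = ∏ i, avg (fib A U (x i) ×ˢ fib A U (x i))
          (fun b => if δ < |X b.1 - X b.2| then t else 1) := fun x =>
    (avg_congr fun p _ => h1 p).trans
      (avg_pi_pair_prod _ (fun b b' => if δ < |X b - X b'| then t else 1))
  simp_rw [h1']
  rw [pw, avg_pi_prod (fun _ : Fin k => A) (fun _ a => avg (fib A U a ×ˢ fib A U a)
    fun b => if δ < |X b.1 - X b.2| then t else 1)]
  rw [Finset.prod_const, Finset.card_univ, Fintype.card_fin]
  congr 1
  have h2 : ∀ b : Ω × Ω, (if δ < |X b.1 - X b.2| then t else 1)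
      = 1 - (1 - t) * (if δ < |X b.1 - X b.2| then (1:ℝ) else 0) := by
    intro b
    split_ifs <;> ring
  simp_rw [h2]
  have h3 : avg A (fun a => avg (fib A U a ×ˢ fib A U a) fun b =>
      1 - (1 - t) * (if δ < |X b.1 - X b.2| then (1:ℝ) else 0))
      = avg A (fun a => 1 - (1 - t) * avg (fib A U a ×ˢ fib A U a) fun b =>
        (if δ < |X b.1 - X b.2| then (1:ℝ) else 0)) := by
    apply avg_congr
    intro a ha
    have hne := (fib_nonempty (X := U) ha)
    rw [avg_sub, avg_mul, avg_const (hne.product hne)]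
  rw [h3, avg_sub, avg_mul, avg_const hA]
  unfold spr
  ring

theorem avg_coll_le {A : Finset Ω} (hA : A.Nonempty) (X : Ω → ℝ) (U : Ω → S) {δ : ℝ} (hδ : 0 ≤ δ)
    (k : ℕ) (hq : 0 < spr A X U δ) :
    avg (pw k A) (fun x =>
        avg (Fintype.piFinset (fun i => fib A U (x i)) ×ˢ Fintype.piFinset (fun i => fib A U (x i)))
          (fun p => if |∑ i, X (p.1 i) - ∑ i, X (p.2 i)| ≤ δ then (1 : ℝ) else 0))
      ≤ 1 / √((k + 1) * spr A X U δ) := by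
  set M := (k + 1) * spr A X U δ with hM
  have hMp : 0 < M := by positivity
  set r := 1 / √M with hr
  have hrp : 0 < r := by positivity
  have hr2 : r * r = 1 / M := by
    rw [hr, div_mul_div_comm, Real.mul_self_sqrt hMp.le, one_mul]
  have key : ∀ m : ℝ, 0 < m → 1 / √m ≤ (1 / (2 * r)) * (1 / m) + r / 2 := by
    intro m hm
    set u := 1 / √m with hu
    have hu2 : u * u = 1 / m := by
      rw [hu, div_mul_div_comm, Real.mul_self_sqrt hm.le, one_mul]
    rw [← hu2]
    have : (1 / (2 * r)) * (u * u) + r / 2 - u = (u - r) ^ 2 / (2 * r) := by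
      field_simp
      ring
    have h2 : 0 ≤ (u - r) ^ 2 / (2 * r) := by positivity
    linarith
  have hne : (pw k A).Nonempty := pw_nonempty hA k
  calc _ ≤ avg (pw k A) (fun x => (1 / (2 * r)) * avg (Fintype.piFinset (fun i => fib A U (x i)) ×ˢ
            Fintype.piFinset (fun i => fib A U (x i)))
            (fun p => 1 / (((sep X δ p).card : ℝ) + 1)) + r / 2) := by
        apply avg_mono
        intro x hx
        refine (avg_le_of_swp _ X hδ).trans ?_
        have hx' : (Fintype.piFinset (fun i => fib A U (x i))).Nonempty := by
          rw [← fib_pw]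
          exact fib_nonempty hx
        rw [← avg_mul, ← avg_add_const (hx'.product hx')]
        apply avg_mono
        intro p _
        exact key _ (by positivity)
    _ = (1 / (2 * r)) * avg (pw k A) (fun x => avg (Fintype.piFinset (fun i => fib A U (x i)) ×ˢ
            Fintype.piFinset (fun i => fib A U (x i)))
            (fun p => 1 / (((sep X δ p).card : ℝ) + 1))) + r / 2 := by
        rw [avg_add_const hne, avg_mul]
    _ ≤ (1 / (2 * r)) * (1 / M) + r / 2 := by
        gcongr
        exact avg_inv_sep_le hA X U δ k hq
    _ = r := by
        rw [← hr2]
        field_simp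
        ring

theorem avg_sq_sum_le {k : ℕ} (AA : Fin k → Finset Ω) (hne : ∀ i, (AA i).Nonempty)
    (Y : Fin k → Ω → ℝ) (h0 : ∀ i, avg (AA i) (Y i) = 0) {R : ℝ}
    (h2 : ∀ i, avg (AA i) (fun a => Y i a ^ 2) ≤ R) :
    avg (Fintype.piFinset AA) (fun z => (∑ i, Y i (z i)) ^ 2) ≤ k * R := by
  induction k with
  | zero => simp [avg]
  | succ k ih =>
    have hQ : (Fintype.piFinset fun i : Fin k => AA i.succ).Nonempty :=
      Fintype.piFinset_nonempty.2 fun i => hne i.succ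
    rw [avg_pi_succ]
    have e : ∀ a, avg (Fintype.piFinset fun i : Fin k => AA i.succ)
        (fun z => (∑ i, Y i ((Fin.cons a z : Fin (k + 1) → Ω) i)) ^ 2)
        = Y 0 a ^ 2 + (2 * avg (Fintype.piFinset fun i : Fin k => AA i.succ)
            (fun z => ∑ i : Fin k, Y i.succ (z i))) * Y 0 a
          + avg (Fintype.piFinset fun i : Fin k => AA i.succ)
            (fun z => (∑ i : Fin k, Y i.succ (z i)) ^ 2) := by
      intro a
      have : ∀ z : Fin k → Ω, (∑ i, Y i ((Fin.cons a z : Fin (k + 1) → Ω) i)) ^ 2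
          = Y 0 a ^ 2 + (2 * Y 0 a) * (∑ i : Fin k, Y i.succ (z i))
            + (∑ i : Fin k, Y i.succ (z i)) ^ 2 := by
        intro z
        rw [Fin.sum_univ_succ]
        simp only [Fin.cons_zero, Fin.cons_succ]
        ring
      simp_rw [this]
      rw [avg_add, avg_add, avg_mul, avg_const hQ]
      ring
    simp_rw [e]
    rw [avg_add, avg_add, avg_mul, avg_const (hne 0), h0 0, mul_zero]
    have := ih (fun i => AA i.succ) (fun i => hne i.succ) (fun i => Y i.succ)
      (fun i => h0 i.succ) (fun i => h2 i.succ)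
    push_cast
    linarith [h2 0]

theorem hasSum_geom_neg : HasSum (fun n : ℕ => (1 / 2 : ℝ) ^ (-((n : ℤ) + 1)).natAbs) 1 := by
    have h2 : ∀ n : ℕ, (1 / 2 : ℝ) ^ (-((n : ℤ) + 1)).natAbs = (1 / 2 : ℝ) * (1 / 2) ^ n := by
      intro n
      have : (-((n : ℤ) + 1)).natAbs = n + 1 := by omega
      rw [this]; exact pow_succ' _ _
    have h3 := hasSum_geometric_two.mul_left (1 / 2 : ℝ)
    have h5 : (1 / 2 : ℝ) * 2 = 1 := by norm_num
    rw [h5] at h3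
    rw [funext h2]
    exact h3

theorem hasSum_geom_int : HasSum (fun n : ℤ => (1 / 2 : ℝ) ^ n.natAbs) 3 := by
  have h0 : HasSum (fun n : ℕ => (1 / 2 : ℝ) ^ (n : ℤ).natAbs) 2 := by
    simp only [Int.natAbs_natCast]
    exact hasSum_geometric_two
  have h4 := HasSum.of_nat_of_neg_add_one (f := fun n : ℤ => (1 / 2 : ℝ) ^ n.natAbs) h0 hasSum_geom_neg
  have : (2 : ℝ) + 1 = 3 := by norm_num
  rw [this] at h4
  exact h4

theorem sum_geom_int_le (n₀ : ℤ) (I : Finset ℤ) :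
    ∑ n ∈ I, (1 / 2 : ℝ) ^ (n - n₀).natAbs ≤ 3 := by
  have h := (Equiv.subRight n₀).hasSum_iff.2 hasSum_geom_int
  exact sum_le_hasSum I (fun n _ => pow_nonneg (by norm_num) _) h

theorem ent_le_of_avg_dist {A : Finset Ω} (hA : A.Nonempty) (V : Ω → ℤ) (n₀ : ℤ) :
    Ent A V ≤ Real.log 4 + avg A (fun a => |(V a : ℝ) - n₀|) := by
  refine (ent_gibbs hA V (fun n => (1 / 2 : ℝ) ^ (n - n₀).natAbs / 4)
    (fun a _ => by positivity) (fun I _ => ?_)).trans ?_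
  · rw [← Finset.sum_div]
    linarith [sum_geom_int_le n₀ I]
  · rw [← avg_const hA (Real.log 4), ← avg_add]
    apply avg_mono
    intro a _
    rw [Real.log_div (by positivity) (by norm_num), Real.log_pow, one_div, Real.log_inv]
    have h1 : ((V a - n₀).natAbs : ℝ) = |(V a : ℝ) - n₀| := by
      rw [Nat.cast_natAbs]
      push_cast
      rfl
    rw [h1]
    have h2 : Real.log 2 ≤ 1 := by linarith [Real.log_two_lt_d9]
    nlinarith [abs_nonneg ((V a : ℝ) - n₀)]

end

namespace Sys
variable (s : Sys) {Ω S T : Type*}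

theorem le_cent_fl_sum {A : Finset Ω} (hA : A.Nonempty) (X : Ω → ℝ) (U : Ω → S) (k n : ℕ) (c : ℝ)
    (hq : 0 < spr A X U (s.lam ^ n)) :
    1 / 2 * Real.log ((k + 1) * spr A X U (s.lam ^ n))
      ≤ CEnt (pw k A) (fun x => s.fl n (∑ i, X (x i) + c)) (fun x i => U (x i)) := by
  set M := (k + 1) * spr A X U (s.lam ^ n) with hM
  have hMp : 0 < M := by positivity
  have hne : (pw k A).Nonempty := pw_nonempty hA k
  rw [cent_eq_fib]
  set y := 1 / √M with hy
  have hyp : 0 < y := by positivity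
  have hlog : Real.log y = -(1 / 2 * Real.log M) := by
    rw [hy, one_div, Real.log_inv, Real.log_sqrt hMp.le]
    ring
  have hc := avg_coll_le hA X U (s.lam_pow_pos n).le k hq
  rw [← hM, ← hy] at hc
  calc 1 / 2 * Real.log M = 1 - (1 / y) * y - Real.log y := by
        rw [hlog]
        field_simp
        ring
    _ ≤ 1 - (1 / y) * avg (pw k A) (fun x =>
        avg (Fintype.piFinset (fun i => fib A U (x i)) ×ˢ Fintype.piFinset (fun i => fib A U (x i)))
          (fun p => if |∑ i, X (p.1 i) - ∑ i, X (p.2 i)| ≤ s.lam ^ n then (1 : ℝ) else 0))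
          - Real.log y := by
        gcongr
    _ = avg (pw k A) (fun x => 1 - (1 / y) *
        avg (Fintype.piFinset (fun i => fib A U (x i)) ×ˢ Fintype.piFinset (fun i => fib A U (x i)))
          (fun p => if |∑ i, X (p.1 i) - ∑ i, X (p.2 i)| ≤ s.lam ^ n then (1 : ℝ) else 0)
          - Real.log y) := by
        rw [avg_sub, avg_sub, avg_mul, avg_const hne, avg_const hne]
    _ ≤ _ := by
        apply avg_mono
        intro x hx
        rw [fib_pw]
        have hx' : (Fintype.piFinset (fun i => fib A U (x i))).Nonempty := by
          rw [← fib_pw]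
          exact fib_nonempty hx
        refine le_trans ?_ (ent_ge_coll hx' _ hyp)
        gcongr 1 - (1 / y) * ?_ - _
        apply avg_mono
        intro p _
        split_ifs with h1 h2 h2
        · exact le_rfl
        · exfalso
          apply h2
          have := s.sub_le_of_fl_eq h1
          rwa [add_sub_add_right_eq_sub] at this
        · exact zero_le_one
        · exact le_rfl

theorem cent_fl_sum_le {A : Finset Ω} (hA : A.Nonempty) (X : Ω → ℝ) (U : Ω → S) (k n : ℕ) (c : ℝ)
    {ρ : ℝ} (hρ : ∀ a ∈ A, ∀ b ∈ A, U a = U b → |X a - X b| ≤ ρ) (hk : k * ρ ^ 2 ≤ (s.lam ^ n) ^ 2) :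
    CEnt (pw k A) (fun x => s.fl n (∑ i, X (x i) + c)) (fun x i => U (x i)) ≤ Real.log 4 + 2 := by
  have hne : (pw k A).Nonempty := pw_nonempty hA k
  have hl := s.lam_pow_pos n
  rw [cent_eq_fib]
  apply avg_le_const' hne
  intro x hx
  rw [fib_pw]
  have hxA : ∀ i, x i ∈ A := by simpa [pw] using hx
  have hQi : ∀ i, (fib A U (x i)).Nonempty := fun i => fib_nonempty (hxA i)
  have hQ : (Fintype.piFinset (fun i => fib A U (x i))).Nonempty :=
    Fintype.piFinset_nonempty.2 hQi
  set μ : Fin k → ℝ := fun i => avg (fib A U (x i)) X with hμ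
  refine (ent_le_of_avg_dist hQ _ (s.fl n (∑ i, μ i + c))).trans ?_
  have hsq := avg_sq_sum_le (fun i => fib A U (x i)) hQi (fun i a => X a - μ i)
    (fun i => by rw [avg_sub, avg_const (hQi i), hμ]; ring) (R := ρ ^ 2) (by
      intro i
      apply avg_le_const' (hQi i)
      intro a ha
      have h1 : |X a - μ i| ≤ ρ := by
        have h2 := mem_fib.1 ha
        rw [abs_le]
        constructor
        · have : μ i ≤ X a + ρ := avg_le_const' (hQi i) fun b hb => by
            have h3 := mem_fib.1 hb
            have := (abs_le.1 (hρ b h3.1 a h2.1 (h3.2.trans h2.2.symm))).2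
            linarith
          linarith
        · have : X a - ρ ≤ μ i := const_le_avg (hQi i) fun b hb => by
            have h3 := mem_fib.1 hb
            have := (abs_le.1 (hρ b h3.1 a h2.1 (h3.2.trans h2.2.symm))).1
            linarith
          linarith
      exact sq_le_sq' (by linarith [(abs_le.1 h1).1]) (abs_le.1 h1).2)
  have hpt : ∀ z : Fin k → Ω,
      |((s.fl n (∑ i, X (z i) + c) : ℤ) : ℝ) - (s.fl n (∑ i, μ i + c) : ℤ)|
        ≤ 3 / 2 + 1 / (2 * (s.lam ^ n) ^ 2) * (∑ i, (X (z i) - μ i)) ^ 2 := by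
    intro z
    set D := ∑ i, (X (z i) - μ i) with hD
    have hD' : (∑ i, X (z i) + c) / s.lam ^ n - (∑ i, μ i + c) / s.lam ^ n = D / s.lam ^ n := by
      rw [← sub_div, hD, Finset.sum_sub_distrib]
      ring_nf
    set p := (∑ i, X (z i) + c) / s.lam ^ n
    set q := (∑ i, μ i + c) / s.lam ^ n
    have e1 : 1 / (2 * (s.lam ^ n) ^ 2) * D ^ 2 = (p - q) ^ 2 / 2 := by
      rw [hD']
      field_simp
    have h1 := Int.floor_le p
    have h2 := Int.lt_floor_add_one p
    have h3 := Int.floor_le q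
    have h4 := Int.lt_floor_add_one q
    rw [e1]
    have f1 : s.fl n (∑ i, X (z i) + c) = ⌊p⌋ := rfl
    have f2 : s.fl n (∑ i, μ i + c) = ⌊q⌋ := rfl
    rw [f1, f2, abs_le]
    constructor <;> nlinarith [sq_nonneg (p - q - 1), sq_nonneg (p - q + 1)]
  have : avg (Fintype.piFinset (fun i => fib A U (x i))) (fun z =>
      |((s.fl n (∑ i, X (z i) + c) : ℤ) : ℝ) - (s.fl n (∑ i, μ i + c) : ℤ)|) ≤ 2 := by
    refine (avg_mono fun z _ => hpt z).trans ?_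
    rw [avg_add, avg_mul, avg_const hQ]
    have : 1 / (2 * (s.lam ^ n) ^ 2) * avg (Fintype.piFinset (fun i => fib A U (x i)))
        (fun z => (∑ i, (X (z i) - μ i)) ^ 2) ≤ 1 / (2 * (s.lam ^ n) ^ 2) * (s.lam ^ n) ^ 2 := by
      gcongr
      exact hsq.trans hk
    have e : 1 / (2 * (s.lam ^ n) ^ 2) * (s.lam ^ n) ^ 2 = 1 / 2 := by
      field_simp
    linarith
  linarith

/-- Entropy at level `n` of the sum of `k` copies of `X` and an independent copy of the heights. -/
def FF (A : Finset Ω) (X : Ω → ℝ) (k N : ℕ) (τ : ℝ) (n : ℕ) : ℝ :=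
  Ent (pw k A ×ˢ s.W N) (fun p => s.fl n (∑ i, X (p.1 i) + s.Pl p.2 τ))

theorem cent_add_cent_le {A : Finset Ω} (f : Ω → ℝ) (Z : Ω → T) (m j : ℕ) :
    Ent A (fun a => s.fl m (f a)) + CEnt A (fun a => s.fl (m + j) (f a)) Z
        - CEnt A (fun a => s.fl m (f a)) Z
      ≤ Ent A (fun a => s.fl (m + j) (f a)) + Real.log 3 := by
  set U := fun a => s.fl (m + j) (f a) with hU
  set V := fun a => s.fl m (f a) with hV
  have h1 : CEnt A U (fun a => (V a, Z a)) ≤ CEnt A U V :=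
    cent_antitone fun a _ b _ h => (Prod.ext_iff.1 h).1
  have h2 := cent_chain (A := A) U V Z
  have h3 : CEnt A U Z ≤ CEnt A (fun a => (U a, V a)) Z :=
    cent_mono fun a _ b _ _ h => (Prod.ext_iff.1 h).1
  have h4 : Few A V U (2 * 1 + 1) := by
    refine s.few_fl fun a _ b _ h => ?_
    refine (s.sub_le_of_fl_eq h).trans ?_
    rw [Nat.cast_one, one_mul]
    exact pow_le_pow_of_le_one s.lam_pos.le s.lam_lt.le (by omega)
  have h5 := cent_le_of_few h4
  have h6 : CEnt A U V + Ent A V = CEnt A V U + Ent A U := by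
    have : Ent A (fun a => (U a, V a)) = Ent A (fun a => (V a, U a)) :=
      ent_congr fun a _ b _ => by simp [and_comm]
    simp only [CEnt]
    linarith
  norm_num at h5
  linarith

theorem FF_growth_of_spr {A : Finset Ω} (hA : A.Nonempty) (X : Ω → ℝ) {k N : ℕ} (τ : ℝ)
    (m w e : ℕ) (hk : k * (s.lam ^ w) ^ 2 ≤ 1) (hk' : 1 ≤ (k + 1) * (s.lam ^ w) ^ 2)
    (hq : 0 < spr A X (fun a => s.fl (m + w) (X a)) (s.lam ^ (m + (w + e)))) :
    w * s.ell + 1 / 2 * Real.log (spr A X (fun a => s.fl (m + w) (X a)) (s.lam ^ (m + (w + e))))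
        - (Real.log 4 + 2 + Real.log 3)
      ≤ s.FF A X k N τ (m + (w + e)) - s.FF A X k N τ m := by
  set q := spr A X (fun a => s.fl (m + w) (X a)) (s.lam ^ (m + (w + e))) with hqd
  have hW := s.W_nonempty N
  set Z : (Fin k → Ω) × List (Fin s.B) → List (Fin s.B) × (Fin k → ℤ) :=
    fun p => (p.2, fun i => s.fl (m + w) (X (p.1 i))) with hZ
  have h1 := s.cent_add_cent_le (A := pw k A ×ˢ s.W N)
    (fun p => ∑ i, X (p.1 i) + s.Pl p.2 τ) Z m (w + e)
  have hsw : ∀ n, CEnt (pw k A ×ˢ s.W N) (fun p => s.fl n (∑ i, X (p.1 i) + s.Pl p.2 τ)) Z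
      = avg (s.W N) (fun y => CEnt (pw k A) (fun x => s.fl n (∑ i, X (x i) + s.Pl y τ))
        (fun x i => s.fl (m + w) (X (x i)))) := by
    intro n
    have e1 := cent_equiv (Equiv.prodComm (List (Fin s.B)) (Fin k → Ω))
      (A' := s.W N ×ˢ pw k A) (A := pw k A ×ˢ s.W N)
      (by rintro ⟨a, b⟩; simp [and_comm])
      (fun p => s.fl n (∑ i, X (p.1 i) + s.Pl p.2 τ)) Z
    rw [e1]
    exact cent_prod_fst_pair (A := s.W N) (A' := pw k A)
      (fun p : List (Fin s.B) × (Fin k → Ω) => s.fl n (∑ i, X (p.2 i) + s.Pl p.1 τ))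
      (fun (p : List (Fin s.B) × (Fin k → Ω)) i => s.fl (m + w) (X (p.2 i)))
  rw [hsw, hsw] at h1
  have h2 := const_le_avg hW (fun y _ => s.le_cent_fl_sum hA X (fun a => s.fl (m + w) (X a)) k
    (m + (w + e)) (s.Pl y τ) hq)
  have h3 := avg_le_const' hW (fun y _ => s.cent_fl_sum_le hA X (fun a => s.fl (m + w) (X a)) k
    m (s.Pl y τ) (ρ := s.lam ^ (m + w)) (fun a _ b _ h => s.sub_le_of_fl_eq h) (by
      rw [pow_add, mul_pow]
      have := mul_le_mul_of_nonneg_left hk (sq_nonneg (s.lam ^ m))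
      linarith))
  rw [← hqd] at h2
  have hlw := s.lam_pow_pos w
  have h4 : w * s.ell + 1 / 2 * Real.log q ≤ 1 / 2 * Real.log ((k + 1) * q) := by
    rw [Real.log_mul (by positivity) hq.ne']
    have h5 : 2 * (w * s.ell) ≤ Real.log (k + 1) := by
      have h6 : ((s.lam ^ w) ^ 2)⁻¹ ≤ (k : ℝ) + 1 := by
        rw [inv_le_iff_one_le_mul₀ (by positivity)]
        exact hk'
      have h7 := Real.log_le_log (by positivity) h6
      rw [← pow_mul, s.log_inv_lam_pow] at h7
      push_cast at h7
      linarith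
    linarith
  unfold FF
  linarith

end Sys

theorem ent_const {Ω S : Type*} {A : Finset Ω} (hA : A.Nonempty) {Y : Ω → S} (y : S)
    (h : ∀ a ∈ A, Y a = y) : Ent A Y ≤ 0 := by
  classical
  have := ent_le_log_card hA Y {y} (fun a ha => by simp [h a ha])
  simpa using this

namespace Sys
variable (s : Sys) {Ω S T : Type*}

theorem le_cent_take {m j r : ℕ} {t L : ℝ} (ht : |t| ≤ s.K) (hL : ∀ t, |t| ≤ s.K → L ≤ s.HH j t)
    (c : ℝ) :
    L - Real.log ((2 * (2 * s.KK + 1) + 1 : ℕ) : ℝ)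
      ≤ CEnt (s.W (m + (j + r))) (fun y => s.fl (m + j) (c + s.Pl y t)) (fun y => y.take m) := by
  rw [s.cent_W_add m (j + r)]
  have h1 : CEnt (s.W m ×ˢ s.W (j + r))
      (fun p => s.fl (m + j) (c + s.Pl (p.1 ++ p.2) t)) (fun p => (p.1 ++ p.2).take m)
      = CEnt (s.W m ×ˢ s.W (j + r))
      (fun p => s.fl (m + j) (c + s.Pl (p.1 ++ p.2) t)) Prod.fst := by
    apply cent_congr_right
    rintro ⟨u, v⟩ h ⟨u', v'⟩ h'
    simp only [Finset.mem_product, mem_W] at h h'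
    simp only [List.take_left' h.1, List.take_left' h'.1]
  rw [h1, cent_prod_fst]
  apply const_le_avg (s.W_nonempty m)
  intro u hu
  have hu' : u.length = m := by simpa using hu
  have htl := s.Tl_le u ht
  set t' := s.Tl u t with ht'
  have h2 := hL t' htl
  have h3 : s.HH j t' = Ent (s.W (j + r)) (fun v => s.fl j (s.Pl (v.take j) t')) := by
    rw [ent_W_add]
    have : Ent (s.W j ×ˢ s.W r) (fun p => s.fl j (s.Pl ((p.1 ++ p.2).take j) t'))
        = Ent (s.W j ×ˢ s.W r) (fun p => s.fl j (s.Pl p.1 t')) := by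
      apply ent_congr
      rintro ⟨a, b⟩ h ⟨a', b'⟩ h'
      simp only [Finset.mem_product, mem_W] at h h'
      simp only [List.take_left' h.1, List.take_left' h'.1]
    rw [this, ent_prod_fst (s.W_nonempty r) (fun v => s.fl j (s.Pl v t'))]
    rfl
  have h4 : Few (s.W (j + r)) (fun v => s.fl j (s.Pl (v.take j) t'))
      (fun v => s.fl (m + j) (c + s.Pl (u ++ v) t)) (2 * (2 * s.KK + 1) + 1) := by
    refine s.few_fl fun v hv v' hv' h => ?_
    have hv1 : v.length = j + r := by simpa using hv
    have hv2 : v'.length = j + r := by simpa using hv'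
    have e1 := s.Pl_append_sub_le' (u := v.take j) (w := v.drop j) (a := j) (by simp; omega) htl
    have e2 := s.Pl_append_sub_le' (u := v'.take j) (w := v'.drop j) (a := j) (by simp; omega) htl
    rw [List.take_append_drop] at e1 e2
    have e3 := s.sub_le_of_fl_eq h
    rw [Pl_append, Pl_append, hu', ← ht', pow_add,
      show c + (s.Pl u t + s.lam ^ m * s.Pl v t') - (c + (s.Pl u t + s.lam ^ m * s.Pl v' t'))
        = s.lam ^ m * (s.Pl v t' - s.Pl v' t') by ring, abs_mul, abs_of_pos (s.lam_pow_pos m)] at e3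
    have e4 := le_of_mul_le_mul_left e3 (s.lam_pow_pos m)
    push_cast
    rw [abs_le] at *
    constructor <;> nlinarith [s.lam_pow_pos j]
  have h5 := ent_le_add_of_few h4
  linarith

theorem FF_growth {A : Finset Ω} (hA : A.Nonempty) (X : Ω → ℝ) (k : ℕ) {τ L : ℝ}
    (hτ : |τ| ≤ s.K) (m j r : ℕ) (hL : ∀ t, |t| ≤ s.K → L ≤ s.HH j t) :
    L - Real.log ((2 * (2 * s.KK + 1) + 1 : ℕ) : ℝ) - Real.log ((2 * (2 * s.KK) + 1 : ℕ) : ℝ)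
        - Real.log 3
      ≤ s.FF A X k (m + (j + r)) τ (m + j) - s.FF A X k (m + (j + r)) τ m := by
  set N := m + (j + r) with hN
  have h1 := s.cent_add_cent_le (A := pw k A ×ˢ s.W N)
    (fun p => ∑ i, X (p.1 i) + s.Pl p.2 τ) (fun p => (p.1, p.2.take m)) m j
  have hc : ∀ n, CEnt (pw k A ×ˢ s.W N) (fun p => s.fl n (∑ i, X (p.1 i) + s.Pl p.2 τ))
      (fun p => (p.1, p.2.take m))
      = avg (pw k A) (fun x => CEnt (s.W N) (fun y => s.fl n (∑ i, X (x i) + s.Pl y τ))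
          (fun y => y.take m)) := fun n =>
    cent_prod_fst_pair (A := pw k A) (A' := s.W N)
      (fun p : (Fin k → Ω) × List (Fin s.B) => s.fl n (∑ i, X (p.1 i) + s.Pl p.2 τ))
      (fun p : (Fin k → Ω) × List (Fin s.B) => p.2.take m)
  have h2 : L - Real.log ((2 * (2 * s.KK + 1) + 1 : ℕ) : ℝ)
      ≤ CEnt (pw k A ×ˢ s.W N) (fun p => s.fl (m + j) (∑ i, X (p.1 i) + s.Pl p.2 τ))
          (fun p => (p.1, p.2.take m)) := by
    rw [hc]
    exact const_le_avg (pw_nonempty hA k) fun x _ => s.le_cent_take hτ hL _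
  have h3 : CEnt (pw k A ×ˢ s.W N) (fun p => s.fl m (∑ i, X (p.1 i) + s.Pl p.2 τ))
          (fun p => (p.1, p.2.take m)) ≤ Real.log ((2 * (2 * s.KK) + 1 : ℕ) : ℝ) := by
    apply cent_le_of_few
    refine s.few_fl ?_
    rintro ⟨x, y⟩ hy ⟨x', y'⟩ hy' h
    simp only [Finset.mem_product, mem_W] at hy hy'
    obtain ⟨rfl, h'⟩ := Prod.ext_iff.1 h
    simp only at h' ⊢
    have e1 := s.Pl_append_sub_le' (u := y.take m) (w := y.drop m) (a := m) (by simp; omega) hτ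
    have e2 := s.Pl_append_sub_le' (u := y'.take m) (w := y'.drop m) (a := m) (by simp; omega) hτ
    rw [List.take_append_drop] at e1 e2
    rw [h'] at e1
    push_cast
    rw [abs_le] at *
    constructor <;> linarith
  unfold FF
  linarith

theorem FF_mono (A : Finset Ω) (X : Ω → ℝ) (k N : ℕ) (τ : ℝ) {m n : ℕ} (h : m ≤ n) :
    s.FF A X k N τ m ≤ s.FF A X k N τ n + Real.log 3 := by
  have h4 : Few (pw k A ×ˢ s.W N) (fun p => s.fl m (∑ i, X (p.1 i) + s.Pl p.2 τ))
      (fun p => s.fl n (∑ i, X (p.1 i) + s.Pl p.2 τ)) (2 * 1 + 1) := by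
    refine s.few_fl fun a _ b _ h => ?_
    refine (s.sub_le_of_fl_eq h).trans ?_
    rw [Nat.cast_one, one_mul]
    exact pow_le_pow_of_le_one s.lam_pos.le s.lam_lt.le (by omega)
  have h5 := ent_le_add_of_few h4
  norm_num at h5
  exact h5

theorem FF_le {A : Finset Ω} (hA : A.Nonempty) (X : Ω → ℝ) (k N : ℕ) (τ : ℝ) :
    s.FF A X k N τ N ≤ s.HH N τ
      + k * (Ent (A ×ˢ s.W N) (fun p => s.fl N (X p.1 + s.Pl p.2 τ)) + Real.log 3 - s.HH N τ)
      + Real.log ((2 * (k + 1) + 1 : ℕ) : ℝ) := by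
  have h1 := ent_sum_le hA (s.W_nonempty N) (fun a => s.fl N (X a)) (fun y => s.fl N (s.Pl y τ)) k
  have h2 : Few (A ×ˢ s.W N) (fun p => s.fl N (X p.1) + s.fl N (s.Pl p.2 τ))
      (fun p => s.fl N (X p.1 + s.Pl p.2 τ)) (2 * 1 + 1) := by
    refine few_int fun a _ b _ h => ?_
    have key : ∀ u v : ℝ, s.fl N u + s.fl N v ≤ s.fl N (u + v)
        ∧ s.fl N (u + v) ≤ s.fl N u + s.fl N v + 1 := by
      intro u v
      unfold fl
      rw [add_div]
      have := Int.le_floor_add_floor (u / s.lam ^ N) (v / s.lam ^ N)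
      exact ⟨Int.le_floor_add _ _, by omega⟩
    have k1 := key (X a.1) (s.Pl a.2 τ)
    have k2 := key (X b.1) (s.Pl b.2 τ)
    rw [abs_le]
    push_cast
    constructor <;> omega
  have h3 : Few (pw k A ×ˢ s.W N) (fun p => s.fl N (∑ i, X (p.1 i) + s.Pl p.2 τ))
      (fun p => ∑ i, s.fl N (X (p.1 i)) + s.fl N (s.Pl p.2 τ)) (2 * (k + 1) + 1) := by
    refine few_int fun a _ b _ h => ?_
    have key : ∀ p : (Fin k → Ω) × List (Fin s.B),
        ∑ i, s.fl N (X (p.1 i)) + s.fl N (s.Pl p.2 τ) ≤ s.fl N (∑ i, X (p.1 i) + s.Pl p.2 τ)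
        ∧ s.fl N (∑ i, X (p.1 i) + s.Pl p.2 τ)
          ≤ ∑ i, s.fl N (X (p.1 i)) + s.fl N (s.Pl p.2 τ) + (k + 1) := by
      intro p
      have e : (∑ i, X (p.1 i) + s.Pl p.2 τ) / s.lam ^ N
          = ∑ i, X (p.1 i) / s.lam ^ N + s.Pl p.2 τ / s.lam ^ N := by
        rw [add_div, Finset.sum_div]
      have a1 : ∑ i, ((s.fl N (X (p.1 i)) : ℤ) : ℝ) ≤ ∑ i, X (p.1 i) / s.lam ^ N :=
        Finset.sum_le_sum fun i _ => Int.floor_le _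
      have a2 : ∑ i, X (p.1 i) / s.lam ^ N ≤ ∑ i, (((s.fl N (X (p.1 i)) : ℤ) : ℝ) + 1) :=
        Finset.sum_le_sum fun i _ => (Int.lt_floor_add_one _).le
      rw [Finset.sum_add_distrib] at a2
      simp only [Finset.sum_const, Finset.card_univ, Fintype.card_fin, nsmul_eq_mul, mul_one] at a2
      have a3 := Int.floor_le (s.Pl p.2 τ / s.lam ^ N)
      have a4 := Int.lt_floor_add_one (s.Pl p.2 τ / s.lam ^ N)
      constructor
      · apply Int.le_floor.2
        rw [e]
        push_cast
        unfold fl at a1 ⊢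
        linarith
      · apply Int.lt_add_one_iff.1
        apply Int.floor_lt.2
        rw [e]
        push_cast
        unfold fl at a2 ⊢
        linarith
    have k1 := key a
    have k2 := key b
    rw [abs_le]
    push_cast
    constructor <;> linarith
  have h4 := ent_le_add_of_few h2
  have h5 := ent_le_add_of_few h3
  norm_num at h4
  have h6 : Ent (s.W N) (fun y => s.fl N (s.Pl y τ)) = s.HH N τ := rfl
  rw [h6] at h1
  unfold FF
  have h7 : (k : ℝ) * (Ent (A ×ˢ s.W N) (fun p => s.fl N (X p.1) + s.fl N (s.Pl p.2 τ)) - s.HH N τ)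
      ≤ k * (Ent (A ×ˢ s.W N) (fun p => s.fl N (X p.1 + s.Pl p.2 τ)) + Real.log 3 - s.HH N τ) := by
    gcongr
  linarith

theorem ent_fib_le {Q : Finset Ω} (hQ : Q.Nonempty) (X : Ω → ℝ) (m e : ℕ)
    (hX : ∀ a ∈ Q, ∀ b ∈ Q, s.fl m (X a) = s.fl m (X b)) :
    Ent Q (fun a => s.fl (m + e) (X a)) ≤ Real.log 6 + (e * s.ell + 3) *
      avg (Q ×ˢ Q) (fun b => if s.lam ^ (m + e) < |X b.1 - X b.2| then (1 : ℝ) else 0) := by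
  classical
  set δ := s.lam ^ (m + e) with hδ
  set p := avg (Q ×ˢ Q) (fun b => if δ < |X b.1 - X b.2| then (1 : ℝ) else 0) with hp
  set U := fun a => s.fl (m + e) (X a) with hU
  obtain ⟨a₀, ha₀, hle⟩ : ∃ a ∈ Q, avg Q (fun b => if δ < |X a - X b| then (1 : ℝ) else 0) ≤ p := by
    by_contra! hcon
    obtain ⟨a, ha, hmin⟩ := Finset.exists_min_image Q
      (fun a => avg Q (fun b => if δ < |X a - X b| then (1 : ℝ) else 0)) hQ
    have := const_le_avg hQ hmin
    rw [hp, avg_prod] at hcon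
    exact absurd (hcon a ha) (not_lt.2 this)
  set V : Ω → Prop := fun b => δ < |X a₀ - X b| with hV
  have h1 : Ent Q U ≤ Ent Q V + CEnt Q U V := by
    have : Ent Q U ≤ Ent Q (fun a => (U a, V a)) :=
      ent_mono fun a _ b _ h => (Prod.ext_iff.1 h).1
    unfold CEnt
    linarith
  have h2 : Ent Q V ≤ Real.log 2 := by
    have := ent_le_log_card hQ V {True, False} (fun a _ => by
      by_cases h : V a <;> simp [h])
    refine this.trans (Real.log_le_log (by simp) ?_)
    exact_mod_cast Finset.card_le_two
  have hl5 : Real.log 5 ≤ 3 := by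
    have : Real.log 5 ≤ Real.log 8 := Real.log_le_log (by norm_num) (by norm_num)
    rw [show (8 : ℝ) = 2 ^ 3 by norm_num, Real.log_pow] at this
    have := Real.log_two_lt_d9
    push_cast at *
    linarith
  have h3 : CEnt Q U V ≤ Real.log 3 + (e * s.ell + 3) * p := by
    rw [cent_eq_fib]
    have : avg Q (fun a => Ent (fib Q V a) U)
        ≤ avg Q (fun a => Real.log 3 + (e * s.ell + 3) * (if V a then (1 : ℝ) else 0)) := by
      apply avg_mono
      intro a ha
      have hne : (fib Q V a).Nonempty := fib_nonempty ha
      have hell := s.ell_pos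
      have hl3 : 0 ≤ Real.log 3 := Real.log_nonneg (by norm_num)
      by_cases hVa : V a
      · rw [if_pos hVa]
        have e1 := s.cent_fl_le (A := fib Q V a) (x := X) (y := X) (n := m) (k := 0) le_rfl
          (by simp) e
        have e2 : Ent (fib Q V a) U ≤ Ent (fib Q V a) (fun a => s.fl m (X a))
            + CEnt (fib Q V a) U (fun a => s.fl m (X a)) := by
          have : Ent (fib Q V a) U ≤ Ent (fib Q V a) (fun b => (U b, s.fl m (X b))) :=
            ent_mono fun a _ b _ h => (Prod.ext_iff.1 h).1
          unfold CEnt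
          linarith
        have e3 := ent_const hne (Y := fun a => s.fl m (X a)) (s.fl m (X a))
          (fun b hb => hX _ (fib_subset _ _ hb) _ ha)
        norm_num at e1
        linarith
      · rw [if_neg hVa]
        have e1 := ent_le_log_card hne U (Finset.Icc (s.fl (m + e) (X a₀) - 1)
          (s.fl (m + e) (X a₀) + 1)) (by
            intro b hb
            have hb' : ¬ V b := by
              rw [(mem_fib.1 hb).2]
              exact hVa
            have := s.fl_sub_le (n := m + e) (k := 1) (x := X a₀) (y := X b)
              (by simpa using not_lt.1 hb')
            rw [abs_le] at this
            push_cast at this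
            rw [Finset.mem_Icc]
            constructor <;> simp only [hU] <;> omega)
        have e2 : (Finset.Icc (s.fl (m + e) (X a₀) - 1) (s.fl (m + e) (X a₀) + 1)).card = 3 := by
          rw [Int.card_Icc]
          omega
        rw [e2] at e1
        push_cast at e1
        linarith
    refine this.trans ?_
    rw [avg_add, avg_mul, avg_const hQ]
    have : 0 ≤ (e * s.ell + 3) := by have := s.ell_pos; positivity
    have := mul_le_mul_of_nonneg_left hle this
    simp only [hV]
    linarith
  have : Real.log 6 = Real.log 2 + Real.log 3 := by
    rw [← Real.log_mul (by norm_num) (by norm_num)]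
    norm_num
  linarith

theorem cent_level_le (A : Finset Ω) (X : Ω → ℝ) (m e : ℕ) :
    CEnt A (fun a => s.fl (m + e) (X a)) (fun a => s.fl m (X a))
      ≤ Real.log 6 + (e * s.ell + 3) * spr A X (fun a => s.fl m (X a)) (s.lam ^ (m + e)) := by
  rcases A.eq_empty_or_nonempty with rfl | hA
  · have : 0 ≤ Real.log 6 := Real.log_nonneg (by norm_num)
    simpa [CEnt, Ent, avg, spr] using this
  rw [cent_eq_fib]
  unfold spr
  rw [← avg_mul, ← avg_const hA (Real.log 6), ← avg_add]
  apply avg_mono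
  intro a ha
  exact s.ent_fib_le (fib_nonempty ha) X m e
    fun b hb b' hb' => (mem_fib.1 hb).2.trans (mem_fib.1 hb').2.symm

end Sys

namespace Sys
variable (s : Sys) {Ω : Type*}

theorem log_five_le : Real.log 5 ≤ 3 := by
  have h : Real.log 5 ≤ Real.log 8 := Real.log_le_log (by norm_num) (by norm_num)
  rw [show (8 : ℝ) = 2 ^ 3 by norm_num, Real.log_pow] at h
  have := Real.log_two_lt_d9
  push_cast at *
  linarith

theorem ent_level_sub_le (A : Finset Ω) (X : Ω → ℝ) (n r : ℕ) :
    Ent A (fun a => s.fl (n + r) (X a)) - Ent A (fun a => s.fl n (X a))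
      ≤ CEnt A (fun a => s.fl (n + r) (X a)) (fun a => s.fl n (X a)) := by
  have : Ent A (fun a => s.fl (n + r) (X a))
      ≤ Ent A (fun b => (s.fl (n + r) (X b), s.fl n (X b))) :=
    ent_mono fun a _ b _ h => (Prod.ext_iff.1 h).1
  unfold CEnt
  linarith

theorem ent_level_le (A : Finset Ω) (X : Ω → ℝ) (n r : ℕ) :
    Ent A (fun a => s.fl (n + r) (X a)) ≤ Ent A (fun a => s.fl n (X a)) + (r * s.ell + 3) := by
  have h1 := s.ent_level_sub_le A X n r
  have h2 := s.cent_fl_le (A := A) (x := X) (y := X) (n := n) (k := 0) le_rfl (by simp) r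
  norm_num at h2
  linarith [log_five_le]

open scoped Classical in
/-- The levels at which `X` spreads with probability at least `p`. -/
def goodLevels (A : Finset Ω) (X : Ω → ℝ) (w e M : ℕ) (p : ℝ) : Finset ℕ :=
  (Finset.range M).filter fun m =>
    p ≤ spr A X (fun a => s.fl (m + w) (X a)) (s.lam ^ (m + (w + e)))

theorem card_goodLevels {A : Finset Ω} (hA : A.Nonempty) {X : Ω → ℝ}
    (hX : ∀ a ∈ A, 0 ≤ X a ∧ X a < 1) {w e M : ℕ} {c p : ℝ} (hp : 0 ≤ p)
    (hc : c * (M + w + e : ℕ) ≤ Ent A (fun a => s.fl (M + w + e) (X a))) :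
    e * (c * (M + w + e : ℕ) - (w + 2 * e) * s.ell - 6)
      ≤ M * Real.log 6 + (e * s.ell + 3) * (M * p + (s.goodLevels A X w e M p).card) := by
  classical
  have hell := s.ell_pos
  set E := fun n => Ent A (fun a => s.fl n (X a)) with hE
  have hE0 : E 0 ≤ 0 := by
    refine ent_const hA 0 fun a ha => ?_
    unfold fl
    rw [pow_zero, div_one]
    exact Int.floor_eq_zero_iff.2 (hX a ha)
  have hlow : ∀ i ∈ Finset.range e, c * (M + w + e : ℕ) - e * s.ell - 3 ≤ E (M + i + w) := by
    intro i hi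
    have hi' := Finset.mem_range.1 hi
    have h1 := s.ent_level_le A X (M + i + w) (e - i)
    rw [show M + i + w + (e - i) = M + w + e by omega] at h1
    have h2 : ((e - i : ℕ) : ℝ) ≤ e := by exact_mod_cast Nat.sub_le e i
    have h3 := mul_le_mul_of_nonneg_right h2 hell.le
    simp only [hE]
    linarith
  have hup : ∀ i ∈ Finset.range e, E (i + w) ≤ (w + e) * s.ell + 3 := by
    intro i hi
    have hi' := Finset.mem_range.1 hi
    have h1 := s.ent_level_le A X 0 (i + w)
    rw [zero_add] at h1
    have h2 : ((i + w : ℕ) : ℝ) ≤ w + e := by exact_mod_cast (by omega : i + w ≤ w + e)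
    have h3 := mul_le_mul_of_nonneg_right h2 hell.le
    simp only [hE] at hE0 ⊢
    linarith
  have hsum := sum_shift_sub (fun m => E (m + w)) e M
  have hl := Finset.sum_le_sum hlow
  have hu := Finset.sum_le_sum hup
  simp only [Finset.sum_const, Finset.card_range, nsmul_eq_mul] at hl hu
  have hT : ∑ m ∈ Finset.range M, (E (e + m + w) - E (m + w))
      ≤ ∑ m ∈ Finset.range M, (Real.log 6 + (e * s.ell + 3) *
        (p + if m ∈ s.goodLevels A X w e M p then 1 else 0)) := by
    apply Finset.sum_le_sum
    intro m hm
    have h1 := s.ent_level_sub_le A X (m + w) e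
    have h2 := s.cent_level_le A X (m + w) e
    rw [show m + w + e = e + m + w by ring] at h1 h2
    have h3 : spr A X (fun a => s.fl (m + w) (X a)) (s.lam ^ (e + m + w))
        ≤ p + if m ∈ s.goodLevels A X w e M p then 1 else 0 := by
      split_ifs with hg
      · linarith [spr_le_one A X (fun a => s.fl (m + w) (X a)) (s.lam ^ (e + m + w))]
      · have : ¬ p ≤ spr A X (fun a => s.fl (m + w) (X a)) (s.lam ^ (m + (w + e))) := by
          intro h
          exact hg (Finset.mem_filter.2 ⟨hm, h⟩)
        rw [show e + m + w = m + (w + e) by ring]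
        linarith
    have h4 := mul_le_mul_of_nonneg_left h3 (show 0 ≤ e * s.ell + 3 by positivity)
    simp only [hE]
    linarith
  rw [Finset.sum_add_distrib, ← Finset.mul_sum, Finset.sum_add_distrib] at hT
  have hcard : ∑ m ∈ Finset.range M, (if m ∈ s.goodLevels A X w e M p then (1 : ℝ) else 0)
      = (s.goodLevels A X w e M p).card := by
    rw [Finset.sum_ite_mem, Finset.inter_eq_right.2 (show s.goodLevels A X w e M p ⊆ _ from
      Finset.filter_subset _ _)]
    simp
  rw [hcard] at hT
  simp only [Finset.sum_const, Finset.card_range, nsmul_eq_mul] at hT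
  have e1 : (e : ℝ) * (c * (M + w + e : ℕ) - (w + 2 * e) * s.ell - 6)
      = e * (c * (M + w + e : ℕ) - e * s.ell - 3) - e * ((w + e) * s.ell + 3) := by ring
  rw [e1]
  linarith

theorem FF_nonneg (A : Finset Ω) (X : Ω → ℝ) (k N : ℕ) (τ : ℝ) (n : ℕ) :
    0 ≤ s.FF A X k N τ n := ent_nonneg _ _

theorem sum_FF_le (A : Finset Ω) (X : Ω → ℝ) (k : ℕ) (τ : ℝ) (j M : ℕ) :
    ∑ m ∈ Finset.range M, (s.FF A X k (M + j) τ (m + j) - s.FF A X k (M + j) τ m)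
      ≤ j * (s.FF A X k (M + j) τ (M + j) + Real.log 3) := by
  have h := sum_shift_sub (s.FF A X k (M + j) τ) j M
  have h1 : ∑ i ∈ Finset.range j, s.FF A X k (M + j) τ (M + i)
      ≤ ∑ i ∈ Finset.range j, (s.FF A X k (M + j) τ (M + j) + Real.log 3) :=
    Finset.sum_le_sum fun i hi => s.FF_mono A X k (M + j) τ
      (by have := Finset.mem_range.1 hi; omega)
  have h2 : 0 ≤ ∑ i ∈ Finset.range j, s.FF A X k (M + j) τ i :=
    Finset.sum_nonneg fun i _ => s.FF_nonneg _ _ _ _ _ _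
  simp only [Finset.sum_const, Finset.card_range, nsmul_eq_mul] at h1
  have h3 : ∀ m, j + m = m + j := fun m => add_comm _ _
  simp only [h3] at h
  linarith

theorem exists_nat_mul_le_one {x : ℝ} (hx : 0 < x) :
    ∃ k : ℕ, k * x ≤ 1 ∧ 1 ≤ (k + 1) * x := by
  refine ⟨⌊x⁻¹⌋₊, ?_, ?_⟩
  · have := mul_le_mul_of_nonneg_right (Nat.floor_le (inv_pos.2 hx).le) hx.le
    rwa [inv_mul_cancel₀ hx.ne'] at this
  · have := mul_le_mul_of_nonneg_right (Nat.lt_floor_add_one x⁻¹).le hx.le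
    rwa [inv_mul_cancel₀ hx.ne'] at this

theorem exists_length {P L η ε₁ : ℝ} (C₁ C₃ e : ℝ) (hgap : 0 < L - P) (hη : 0 < η)
    (hε₁ : 0 < ε₁) (h8 : η * (L - P) = 8 * ε₁) : ∃ w : ℕ,
      0 ≤ w * L + C₃ - ((P - ε₁) * (w + e) - C₁) ∧
      0 < ((P - ε₁) * (w + e) - C₁) + η * (w * L + C₃ - ((P - ε₁) * (w + e) - C₁))
        - (w + e) * P := by
  obtain ⟨C₄, hC₄⟩ : ∃ C₄, C₄ = C₃ - (P - ε₁) * e + C₁ := ⟨_, rfl⟩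
  obtain ⟨C₅, hC₅⟩ : ∃ C₅, C₅ = η * C₄ - e * ε₁ - C₁ := ⟨_, rfl⟩
  obtain ⟨w, hw⟩ := exists_nat_gt (|C₅| / ε₁ + |C₄| / (L - P))
  have hw5 : |C₅| < w * ε₁ := by
    rw [← div_lt_iff₀ hε₁]
    have : 0 ≤ |C₄| / (L - P) := by positivity
    linarith
  have hw4 : |C₄| < w * (L - P) := by
    rw [← div_lt_iff₀ hgap]
    have : 0 ≤ |C₅| / ε₁ := by positivity
    linarith
  have hw0 : (0 : ℝ) ≤ w := Nat.cast_nonneg w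
  have hD : w * L + C₃ - ((P - ε₁) * (w + e) - C₁) = w * (L - P) + w * ε₁ + C₄ := by
    rw [hC₄]
    ring
  have hwe := mul_nonneg hw0 hε₁.le
  refine ⟨w, ?_, ?_⟩
  · rw [hD]
    linarith [neg_abs_le C₄]
  · have h : ((P - ε₁) * (w + e) - C₁) + η * (w * L + C₃ - ((P - ε₁) * (w + e) - C₁))
        - (w + e) * P = w * (η * (L - P)) + η * (w * ε₁) - w * ε₁ + C₅ := by
      rw [hD, hC₅]
      ring
    rw [h, h8]
    have := mul_nonneg hη.le hwe
    linarith [neg_abs_le C₅]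

set_option maxHeartbeats 1000000 in
theorem false_of_star {P : ℝ} (hPl : P < s.ell) (hs : s.Star P)
    (hlow : ∀ ε > 0, ∃ Ce, 0 ≤ Ce ∧ ∀ n t, |t| ≤ s.K → (P - ε) * n - Ce ≤ s.HH n t) : False := by
  classical
  obtain ⟨c, hc, hs⟩ := hs
  have hell := s.ell_pos
  have hl3 : 0 ≤ Real.log 3 := Real.log_nonneg (by norm_num)
  have hl6 : 0 < Real.log 6 := Real.log_pos (by norm_num)
  obtain ⟨e, he⟩ := exists_nat_ge (Real.log 6 * 4 / c)
  have he6 : Real.log 6 ≤ e * c / 4 := by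
    rw [div_le_iff₀ hc] at he
    linarith
  have hepos : (0 : ℝ) < e := by
    by_contra h
    have : (e : ℝ) = 0 := le_antisymm (not_lt.1 h) (Nat.cast_nonneg e)
    rw [this] at he6
    linarith
  obtain ⟨Λ, hΛ⟩ : ∃ x, x = e * s.ell + 3 := ⟨_, rfl⟩
  have hΛp : 0 < Λ := by rw [hΛ]; positivity
  obtain ⟨p₀, hp₀⟩ : ∃ x, x = e * c / (4 * Λ) := ⟨_, rfl⟩
  have hp₀p : 0 < p₀ := by rw [hp₀]; positivity
  obtain ⟨η, hη⟩ : ∃ x, x = e * c / (2 * Λ) := ⟨_, rfl⟩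
  have hηp : 0 < η := by rw [hη]; positivity
  obtain ⟨ε₁, hε₁⟩ : ∃ x, x = η * (s.ell - P) / 8 := ⟨_, rfl⟩
  have hε₁p : 0 < ε₁ := by
    have : 0 < s.ell - P := by linarith
    rw [hε₁]
    positivity
  obtain ⟨C₂, hC₂, hlow₁⟩ := hlow ε₁ hε₁p
  obtain ⟨C₁, hC₁⟩ : ∃ C₁, C₁ = C₂ + Real.log ((2 * (2 * s.KK + 1) + 1 : ℕ) : ℝ)
    + Real.log ((2 * (2 * s.KK) + 1 : ℕ) : ℝ) + Real.log 3 := ⟨_, rfl⟩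
  obtain ⟨C₃, hC₃⟩ : ∃ C₃, C₃ = 1 / 2 * Real.log p₀ - (Real.log 4 + 2 + Real.log 3) := ⟨_, rfl⟩
  have hgap : 0 < s.ell - P := by linarith
  obtain ⟨w, hwD, hwζ⟩ := exists_length C₁ C₃ e hgap hηp hε₁p (by rw [hε₁]; ring)
  have hw0 : (0 : ℝ) ≤ w := Nat.cast_nonneg w
  obtain ⟨j, hj⟩ : ∃ j, j = w + e := ⟨_, rfl⟩
  have hjr : (j : ℝ) = w + e := by rw [hj]; push_cast; ring
  have hjp : (0 : ℝ) < j := by rw [hjr]; linarith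
  rw [← hjr] at hwD hwζ
  obtain ⟨b, hb⟩ : ∃ b, b = (P - ε₁) * j - C₁ := ⟨_, rfl⟩
  rw [← hb] at hwD hwζ
  obtain ⟨D, hD⟩ : ∃ D, D = w * s.ell + C₃ - b := ⟨_, rfl⟩
  rw [← hD] at hwD hwζ
  have hD0 : 0 ≤ D := hwD
  obtain ⟨ζ, hζ⟩ : ∃ ζ, ζ = b + η * D - j * P := ⟨_, rfl⟩
  rw [← hζ] at hwζ
  have hζp : 0 < ζ := hwζ
  have hlw := s.lam_pow_pos w
  obtain ⟨k, hk1, hk2⟩ := exists_nat_mul_le_one (pow_pos hlw 2)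
  obtain ⟨ε, hε⟩ : ∃ x, x = ζ / (2 * (j * (1 + 2 * k))) := ⟨_, rfl⟩
  have hεp : 0 < ε := by rw [hε]; positivity
  have hεe : j * ε * (1 + 2 * k) = ζ / 2 := by
    rw [hε]
    field_simp
  obtain ⟨Ce, hCe, hlow₂⟩ := hlow ε hεp
  obtain ⟨N₀, hN₀⟩ := hs ε hεp
  obtain ⟨LK, hLK⟩ : ∃ x, x = Real.log ((2 * (k + 1) + 1 : ℕ) : ℝ) := ⟨_, rfl⟩
  obtain ⟨g₀, hg₀⟩ : ∃ x, x = e * ((w + 2 * e) * s.ell + 6) / Λ := ⟨_, rfl⟩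
  obtain ⟨Q, hQ⟩ : ∃ x, x = j * b + g₀ * D + j * (Real.log 3 + k * (Ce + Real.log 3) + LK + Real.log 3) := ⟨_, rfl⟩
  obtain ⟨N₁, hN₁⟩ := exists_nat_gt (Q / (ζ / 2))
  obtain ⟨M, hM⟩ : ∃ M, M = max N₀ N₁ := ⟨_, rfl⟩
  obtain ⟨τ, hτ, A, hA, X, hX, hent, hentle⟩ := hN₀ (M + j) (by
    have := le_max_left N₀ N₁
    omega)
  have hNr : ((M + j : ℕ) : ℝ) = M + j := by push_cast; ring
  have hNQ : Q < (M + j : ℕ) * (ζ / 2) := by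
    rw [div_lt_iff₀ (by positivity)] at hN₁
    have : (N₁ : ℝ) ≤ (M + j : ℕ) := by
      exact_mod_cast (le_max_right N₀ N₁).trans (by omega)
    have := mul_le_mul_of_nonneg_right this (show 0 ≤ ζ / 2 by positivity)
    linarith
  have h1 := s.sum_FF_le A X k τ j M
  obtain ⟨G, hG⟩ : ∃ x, x = s.goodLevels A X w e M p₀ := ⟨_, rfl⟩
  have hGsub : G ⊆ Finset.range M := by
    rw [hG]
    exact Finset.filter_subset _ _
  have h2 : M * b + G.card * D
      ≤ ∑ m ∈ Finset.range M, (s.FF A X k (M + j) τ (m + j) - s.FF A X k (M + j) τ m) := by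
    have hcard : ∑ m ∈ Finset.range M, (if m ∈ G then D else 0) = G.card * D := by
      rw [Finset.sum_ite_mem, Finset.inter_eq_right.2 hGsub]
      simp
    have hb' : ∑ m ∈ Finset.range M, b = M * b := by simp
    rw [← hcard, ← hb', ← Finset.sum_add_distrib]
    apply Finset.sum_le_sum
    intro m hm
    split_ifs with hg
    · have hq := (Finset.mem_filter.1 (hG ▸ hg)).2
      have h3 := s.FF_growth_of_spr hA X (N := M + j) τ m w e hk1 hk2 (hp₀p.trans_le hq)
      have h4 := Real.log_le_log hp₀p hq
      rw [hD, hC₃, hj]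
      rw [hj] at h3
      linarith
    · obtain ⟨r, hr⟩ : ∃ r, M = m + r := ⟨M - m, by have := Finset.mem_range.1 hm; omega⟩
      have h3 := s.FF_growth hA X k hτ m j r (hlow₁ j)
      rw [show m + (j + r) = M + j by omega] at h3
      rw [hb, hC₁]
      linarith
  have h3 := s.card_goodLevels hA hX (w := w) (e := e) (M := M) (c := c) hp₀p.le
    (by rw [show M + w + e = M + j by omega]; exact hent)
  rw [show M + w + e = M + j by omega, ← hG, ← hΛ] at h3
  have h4 := s.FF_le hA X k (M + j) τ
  have h5 := s.HH_le_ent_add hA X (M + j) τ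
  have h6 := hlow₂ (M + j) τ hτ
  rw [hNr] at hNQ h6 h3 hentle
  obtain ⟨N, hN⟩ : ∃ x, x = (M : ℝ) + j := ⟨_, rfl⟩
  rw [← hN] at hNQ h6 h3 hentle
  have hN0 : 0 ≤ N := by rw [hN]; positivity
  have hMN : (M : ℝ) ≤ N := by linarith
  have hM0 : (0 : ℝ) ≤ M := Nat.cast_nonneg M
  have hGlow : η * N - g₀ ≤ G.card := by
    have e1 : Λ * p₀ = e * c / 4 := by
      rw [hp₀]
      field_simp
    have e2 : Λ * η = e * c / 2 := by
      rw [hη]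
      field_simp
    have e3 : Λ * g₀ = e * ((w + 2 * e) * s.ell + 6) := by
      rw [hg₀]
      field_simp
    have e4 : (M : ℝ) * Real.log 6 ≤ N * (e * c / 4) := by gcongr
    have e5 : (M : ℝ) * (e * c / 4) ≤ N * (e * c / 4) := by gcongr
    have e6 : Λ * (M * p₀ + G.card) = M * (e * c / 4) + Λ * G.card := by rw [← e1]; ring
    rw [e6] at h3
    have e7 : Λ * (η * N - g₀) ≤ Λ * G.card := by
      have : Λ * (η * N - g₀) = e * c / 2 * N - e * ((w + 2 * e) * s.ell + 6) := by
        rw [← e2, ← e3]; ring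
      rw [this]
      linarith
    exact le_of_mul_le_mul_left e7 hΛp
  have hF : s.FF A X k (M + j) τ (M + j)
      ≤ (P + ε) * N + Real.log 3 + k * (2 * ε * N + Ce + Real.log 3) + LK := by
    have hk0 : (0 : ℝ) ≤ k := Nat.cast_nonneg k
    have : (k : ℝ) * (Ent (A ×ˢ s.W (M + j)) (fun p => s.fl (M + j) (X p.1 + s.Pl p.2 τ))
        + Real.log 3 - s.HH (M + j) τ) ≤ k * (2 * ε * N + Ce + Real.log 3) := by
      apply mul_le_mul_of_nonneg_left _ hk0
      linarith
    linarith
  have hGD := mul_le_mul_of_nonneg_right hGlow hD0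
  have hjF := mul_le_mul_of_nonneg_left hF hjp.le
  have hfin : N * (ζ - j * ε * (1 + 2 * k)) ≤ Q := by
    rw [hζ, hQ]
    have hMe : (M : ℝ) = N - j := by rw [hN]; ring
    rw [hMe] at h2
    linarith
  rw [hεe] at hfin
  linarith

end Sys

theorem sum_inv_card_fib {Ω S : Type*} [DecidableEq S] (A : Finset Ω) (X : Ω → S) :
    ∑ a ∈ A, ((fib A X a).card : ℝ)⁻¹ = (A.image X).card := by
  have h : ∑ _x ∈ A.image X, (1 : ℝ) = ∑ a ∈ A, ((fib A X a).card : ℝ)⁻¹ := by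
    refine Finset.sum_image' (fun a => ((fib A X a).card : ℝ)⁻¹) fun a ha => ?_
    have hf : A.filter (fun b => X b = X a) = fib A X a := by ext; simp [mem_fib]
    rw [hf, Finset.sum_congr rfl (g := fun _ => ((fib A X a).card : ℝ)⁻¹)]
    · have := (card_fib_pos (X := X) ha).ne'
      simp [this]
    · intro b hb
      rw [fib_eq (mem_fib.1 hb).2]
  rw [← h]
  simp

/-- If the entropy of `X` is within `c` of its maximal value `r`, then at least half of the points
lie in fibres of relative size at most `exp (- (r - 2 * (c + 1)))`. -/
theorem exists_half_of_le_ent {Ω S : Type*} [DecidableEq S] {A : Finset Ω} (hA : A.Nonempty)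
    (X : Ω → S) {r c : ℝ} (hc : 0 ≤ c) (hr : ((A.image X).card : ℝ) ≤ Real.exp r)
    (hent : r - c ≤ Ent A X) :
    ∃ V ⊆ A, A.card ≤ 2 * V.card ∧
      ∀ a ∈ V, ((fib A X a).card : ℝ) ≤ A.card * Real.exp (-(r - 2 * (c + 1))) := by
  classical
  set I : Ω → ℝ := fun a => Real.log ((A.card : ℝ) / ((fib A X a).card : ℝ)) with hI
  have hn : (0 : ℝ) < A.card := by exact_mod_cast hA.card_pos
  set V := A.filter (fun a => r - 2 * (c + 1) ≤ I a) with hV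
  have key : ∀ a ∈ A, I a - r + (if a ∈ V then 0 else 2 * (c + 1))
      ≤ Real.exp (-r) * ((A.card : ℝ) * ((fib A X a).card : ℝ)⁻¹) := by
    intro a ha
    have h0 := card_fib_pos (X := X) ha
    have e1 : Real.exp (-r) * ((A.card : ℝ) * ((fib A X a).card : ℝ)⁻¹) = Real.exp (I a - r) := by
      rw [Real.exp_sub, hI, Real.exp_log (by positivity), Real.exp_neg]
      ring
    rw [e1]
    split_ifs with h
    · linarith [Real.add_one_le_exp (I a - r)]
    · have : ¬ (r - 2 * (c + 1) ≤ I a) := fun h' => h (Finset.mem_filter.2 ⟨ha, h'⟩)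
      linarith [Real.exp_pos (I a - r)]
  have hsum := Finset.sum_le_sum key
  rw [← Finset.mul_sum, ← Finset.mul_sum, sum_inv_card_fib, Finset.sum_add_distrib,
    Finset.sum_sub_distrib] at hsum
  have hE : ∑ a ∈ A, I a = A.card * Ent A X := by
    unfold Ent avg
    field_simp
    rfl
  have hcard : ∑ a ∈ A, (if a ∈ V then (0 : ℝ) else 2 * (c + 1))
      = (A.card - V.card) * (2 * (c + 1)) := by
    rw [← Finset.sum_filter_add_sum_filter_not A (fun a => a ∈ V)]
    rw [Finset.sum_congr rfl (g := fun _ => (0 : ℝ))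
      (fun a ha => if_pos (Finset.mem_filter.1 ha).2)]
    rw [Finset.sum_congr rfl (g := fun _ => 2 * (c + 1))
      (fun a ha => if_neg (Finset.mem_filter.1 ha).2)]
    have h2 : A.filter (fun a => a ∉ V) = A \ V := by
      ext a
      simp
    have hVA : V ⊆ A := Finset.filter_subset _ _
    rw [h2, Finset.sum_const, Finset.sum_const, nsmul_eq_mul, nsmul_eq_mul,
      Finset.cast_card_sdiff hVA]
    ring
  rw [hE, hcard] at hsum
  have hR : Real.exp (-r) * (A.card * ((A.image X).card : ℝ)) ≤ A.card := by
    have : Real.exp (-r) * ((A.image X).card : ℝ) ≤ 1 := by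
      calc _ ≤ Real.exp (-r) * Real.exp r := by gcongr
        _ = 1 := by rw [← Real.exp_add]; simp
    calc _ = A.card * (Real.exp (-r) * ((A.image X).card : ℝ)) := by ring
      _ ≤ A.card * 1 := by gcongr
      _ = A.card := mul_one _
  refine ⟨V, Finset.filter_subset _ _, ?_, ?_⟩
  · have h1 : (A.card : ℝ) * (r - c) ≤ A.card * Ent A X := by gcongr
    simp only [Finset.sum_const, nsmul_eq_mul] at hsum
    have h2 : ((A.card : ℝ) - V.card) * (2 * (c + 1)) ≤ A.card * (c + 1) := by linarith
    have h3 : ((A.card : ℝ) - V.card) * 2 ≤ A.card := by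
      refine le_of_mul_le_mul_right ?_ (show 0 < c + 1 by linarith)
      linarith
    have : (A.card : ℝ) ≤ 2 * V.card := by linarith
    exact_mod_cast this
  · intro a ha
    obtain ⟨haA, ha⟩ := Finset.mem_filter.1 ha
    have h0 := card_fib_pos (X := X) haA
    rw [hI, Real.le_log_iff_exp_le (by positivity), le_div_iff₀ h0] at ha
    rw [Real.exp_neg, ← div_eq_mul_inv, le_div_iff₀ (Real.exp_pos _)]
    linarith

namespace Sys

variable (s : Sys)

theorem le_HH : ∀ ε > 0, ∃ Ce : ℝ, 0 ≤ Ce ∧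
    ∀ (n : ℕ) (t : ℝ), |t| ≤ s.K → (s.ell - ε) * n - Ce ≤ s.HH n t := by
  obtain ⟨P, C, -, hPl, hP, hlow⟩ := s.exists_rate
  rcases hPl.lt_or_eq with h | h
  · exact (s.false_of_star h (s.star hPl hP hlow) hlow).elim
  · rwa [← h]

theorem card_image_fl_le (n : ℕ) {t : ℝ} (ht : |t| ≤ s.K) :
    (((s.W n).image (fun w => s.fl n (s.Pl w t))).card : ℝ)
      ≤ Real.exp (n * s.ell + Real.log (2 * s.KK + 3)) := by
  have h1 := s.one_le_inv_lam_pow n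
  have h0 := s.lam_pow_pos n
  obtain ⟨k, hk⟩ : ∃ k, k = ⌈s.KK * (s.lam ^ n)⁻¹⌉₊ := ⟨_, rfl⟩
  have hk1 : (k : ℝ) ≤ s.KK * (s.lam ^ n)⁻¹ + 1 := by
    rw [hk]
    exact (Nat.ceil_lt_add_one (by positivity)).le
  have hk2 : (s.KK : ℝ) ≤ k * s.lam ^ n := by
    rw [← div_le_iff₀ h0, div_eq_mul_inv, hk]
    exact Nat.le_ceil _
  have hsub : (s.W n).image (fun w => s.fl n (s.Pl w t)) ⊆ Finset.Icc (-(k : ℤ)) k := by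
    intro x hx
    obtain ⟨w, -, rfl⟩ := Finset.mem_image.1 hx
    have h2 : |s.Pl w t - 0| ≤ k * s.lam ^ n := by
      rw [sub_zero]
      exact ((s.Pl_le w ht).trans s.K2_le_KK).trans hk2
    have h3 := s.fl_sub_le h2
    have h4 : s.fl n 0 = 0 := by simp [fl]
    rw [h4, sub_zero, abs_le] at h3
    exact Finset.mem_Icc.2 h3
  have h3 := Finset.card_le_card hsub
  rw [Int.card_Icc] at h3
  have h4 : (((s.W n).image (fun w => s.fl n (s.Pl w t))).card : ℝ) ≤ 2 * k + 1 := by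
    have : ((s.W n).image (fun w => s.fl n (s.Pl w t))).card ≤ 2 * k + 1 := by omega
    exact_mod_cast this
  rw [Real.exp_add, Real.exp_log (by positivity), ← s.log_inv_lam_pow, Real.exp_log (by positivity)]
  nlinarith

theorem exists_half : ∀ ε > 0, ∃ C : ℝ, 0 ≤ C ∧ ∀ (n : ℕ) (t : ℝ), |t| ≤ s.K →
    ∃ V ⊆ s.W n, s.B ^ n ≤ 2 * V.card ∧ ∀ w ∈ V,
      ((fib (s.W n) (fun w => s.fl n (s.Pl w t)) w).card : ℝ)
        ≤ s.B ^ n * Real.exp (-((s.ell - ε) * n) + C) := by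
  intro ε hε
  obtain ⟨Ce, hCe, h⟩ := s.le_HH (ε / 2) (half_pos hε)
  have hL : 0 ≤ Real.log (2 * s.KK + 3) :=
    Real.log_nonneg (by have : (0 : ℝ) ≤ s.KK := Nat.cast_nonneg _
                        linarith)
  refine ⟨Real.log (2 * s.KK + 3) + 2 * Ce + 2, by positivity, fun n t ht => ?_⟩
  obtain ⟨V, hV, hc, hf⟩ := exists_half_of_le_ent (s.W_nonempty n)
    (fun w => s.fl n (s.Pl w t)) (r := n * s.ell + Real.log (2 * s.KK + 3))
    (c := ε / 2 * n + Ce + Real.log (2 * s.KK + 3)) (by positivity)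
    (s.card_image_fl_le n ht) (by
      have := h n t ht
      unfold HH at this
      linarith)
  rw [s.card_W] at hc hf
  refine ⟨V, hV, hc, fun w hw => (hf w hw).trans ?_⟩
  push_cast
  gcongr
  linarith

end Sys

/-- A choice, for every admissible slope `t`, of `k` words of length `T` with few of the
corresponding heights in any interval of length comparable to `λ^T`. -/
structure Blocks (s : Sys) where
  T : ℕ
  k : ℕ
  e : ℝ → Fin k → List (Fin s.B)
  Q : ℝ
  T_pos : 0 < T
  one_le_Q : 1 ≤ Q
  Q_le : Q ≤ k
  inj : ∀ t, |t| ≤ s.K → Function.Injective (e t)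
  length_eq : ∀ t, |t| ≤ s.K → ∀ i, (e t i).length = T
  count : ∀ t, |t| ≤ s.K → ∀ y : ℝ, ∀ I : Finset (Fin k),
    (∀ i ∈ I, |s.Pl (e t i) t - y| ≤ (2 * s.KK + 1 : ℕ) * s.lam ^ T) → (I.card : ℝ) ≤ Q

namespace Sys

variable (s : Sys)

theorem card_le_of_fib_le {n c : ℕ} {t M y : ℝ} {V : Finset (List (Fin s.B))} (hM : 0 ≤ M)
    (hVW : V ⊆ s.W n)
    (hV : ∀ w ∈ V, ((fib (s.W n) (fun w => s.fl n (s.Pl w t)) w).card : ℝ) ≤ M)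
    (hy : ∀ w ∈ V, |s.Pl w t - y| ≤ c * s.lam ^ n) : (V.card : ℝ) ≤ (2 * c + 1) * M := by
  classical
  have hsub : V.image (fun w => s.fl n (s.Pl w t)) ⊆ Finset.Icc (s.fl n y - c) (s.fl n y + c) := by
    intro x hx
    obtain ⟨w, hw, rfl⟩ := Finset.mem_image.1 hx
    have := abs_le.1 (s.fl_sub_le (hy w hw))
    exact Finset.mem_Icc.2 ⟨by linarith, by linarith⟩
  have hc := Finset.card_le_card hsub
  rw [Int.card_Icc] at hc
  have hc' : ((V.image (fun w => s.fl n (s.Pl w t))).card : ℝ) ≤ 2 * c + 1 := by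
    have : (V.image (fun w => s.fl n (s.Pl w t))).card ≤ 2 * c + 1 := by omega
    exact_mod_cast this
  have h1 : (V.card : ℝ) = ∑ x ∈ V.image (fun w => s.fl n (s.Pl w t)),
      ((V.filter (fun w => s.fl n (s.Pl w t) = x)).card : ℝ) := by
    exact_mod_cast Finset.card_eq_sum_card_image (fun w => s.fl n (s.Pl w t)) V
  rw [h1]
  calc _ ≤ ∑ x ∈ V.image (fun w => s.fl n (s.Pl w t)), M := by
        refine Finset.sum_le_sum fun x hx => ?_
        obtain ⟨w, hw, rfl⟩ := Finset.mem_image.1 hx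
        refine le_trans ?_ (hV w hw)
        have : V.filter (fun w' => s.fl n (s.Pl w' t) = s.fl n (s.Pl w t))
            ⊆ fib (s.W n) (fun w => s.fl n (s.Pl w t)) w := by
          intro v hv
          rw [Finset.mem_filter] at hv
          exact mem_fib.2 ⟨hVW hv.1, hv.2⟩
        exact_mod_cast Finset.card_le_card this
    _ = ((V.image (fun w => s.fl n (s.Pl w t))).card : ℝ) * M := by simp
    _ ≤ _ := by gcongr

theorem exists_blocks {σ : ℝ} (hσ : σ < 2 - s.ell / Real.log s.B) :
    ∃ b : Blocks s, σ ≤ Real.log b.Q / (b.T * Real.log s.B)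
      + (Real.log b.k - Real.log b.Q) / (b.T * s.ell) := by
  classical
  have hℓ := s.ell_pos
  have hLB := s.logB_pos
  have hlt := s.ell_lt
  obtain ⟨κ, hκ⟩ : ∃ κ, κ = 1 / s.ell - 1 / Real.log s.B := ⟨_, rfl⟩
  have hκ0 : 0 < κ := by
    rw [hκ, sub_pos]
    exact one_div_lt_one_div_of_lt hℓ hlt
  obtain ⟨g, hg⟩ : ∃ g, g = 2 - s.ell / Real.log s.B - σ := ⟨_, rfl⟩
  have hg0 : 0 < g := by rw [hg]; linarith
  obtain ⟨ε, hε⟩ : ∃ ε, ε = min (g / (2 * κ)) (s.ell / 2) := ⟨_, rfl⟩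
  have hε0 : 0 < ε := by rw [hε]; positivity
  have hε1 : ε * κ ≤ g / 2 := by
    have : ε ≤ g / (2 * κ) := by rw [hε]; exact min_le_left _ _
    rw [le_div_iff₀ (by positivity)] at this
    linarith
  have hε2 : ε ≤ s.ell / 2 := by rw [hε]; exact min_le_right _ _
  obtain ⟨C, hC, hhalf⟩ := s.exists_half ε hε0
  obtain ⟨c, hc⟩ : ∃ c : ℕ, c = 2 * s.KK + 1 := ⟨_, rfl⟩
  have hc1 : (1 : ℝ) ≤ c := by rw [hc]; push_cast; linarith [Nat.cast_nonneg (α := ℝ) s.KK]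
  obtain ⟨C', hC'⟩ : ∃ C', C' = C + Real.log (2 * (2 * c + 1)) := ⟨_, rfl⟩
  have hC'0 : 0 ≤ C' := by
    have : 0 ≤ Real.log (2 * (2 * c + 1)) := Real.log_nonneg (by linarith)
    linarith
  obtain ⟨T, hT⟩ := exists_nat_gt ((Real.log 2 / Real.log s.B + C' * κ) * 2 / g
    + C' / (s.ell / 2) + 0)
  have hl2 : 0 < Real.log 2 := Real.log_pos (by norm_num)
  have hT1 : (Real.log 2 / Real.log s.B + C' * κ) * 2 < g * T := by
    have : 0 ≤ C' / (s.ell / 2) := by positivity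
    have : (Real.log 2 / Real.log s.B + C' * κ) * 2 / g < T := by linarith
    rw [div_lt_iff₀ hg0] at this
    linarith
  have hT2 : C' ≤ (s.ell - ε) * T := by
    have : 0 ≤ (Real.log 2 / Real.log s.B + C' * κ) * 2 / g := by positivity
    have : C' / (s.ell / 2) < T := by linarith
    rw [div_lt_iff₀ (by positivity)] at this
    have h0 : (0 : ℝ) ≤ T := Nat.cast_nonneg T
    nlinarith
  have hT0 : (0 : ℝ) < T := by
    have : 0 < Real.log 2 / Real.log s.B := by positivity
    have : 0 ≤ C' * κ := by positivity
    by_contra h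
    nlinarith
  obtain ⟨k, hk⟩ : ∃ k : ℕ, k = (s.B ^ T + 1) / 2 := ⟨_, rfl⟩
  have hk2 : (s.B : ℝ) ^ T ≤ 2 * k := by
    have : s.B ^ T ≤ 2 * k := by omega
    exact_mod_cast this
  obtain ⟨M, hM⟩ : ∃ M : ℝ, M = s.B ^ T * Real.exp (-((s.ell - ε) * T) + C) := ⟨_, rfl⟩
  have hBT : (s.B : ℝ) ^ T = Real.exp (T * Real.log s.B) := by
    rw [mul_comm, Real.exp_mul, Real.exp_log s.B_pos, Real.rpow_natCast]
  have hM1 : 1 ≤ M := by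
    rw [hM, hBT, ← Real.exp_add, Real.one_le_exp_iff]
    nlinarith
  have hM0 : 0 < M := by linarith
  have hQ1 : 1 ≤ (2 * c + 1) * M := by nlinarith
  have hk0 : (0 : ℝ) < k := by
    have := pow_pos s.B_pos T
    linarith
  have hlogk : T * Real.log s.B - Real.log 2 ≤ Real.log k := by
    rw [← Real.log_pow, ← Real.log_div (pow_pos s.B_pos T).ne' (by norm_num)]
    exact Real.log_le_log (div_pos (pow_pos s.B_pos T) (by norm_num)) (by linarith)
  have hlogM : Real.log M = T * Real.log s.B - (s.ell - ε) * T + C := by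
    rw [hM, hBT, ← Real.exp_add, Real.log_exp]
    ring
  have hlogQ : Real.log ((2 * c + 1) * M) = Real.log (2 * (2 * c + 1)) - Real.log 2
      + (T * Real.log s.B - (s.ell - ε) * T + C) := by
    rw [Real.log_mul (by positivity) hM0.ne', hlogM, Real.log_mul (by norm_num) (by positivity)]
    ring
  have hb : (s.ell - ε) * T - C' ≤ Real.log k - Real.log ((2 * c + 1) * M) := by
    rw [hlogQ, hC']
    linarith
  have hQk : (2 * c + 1) * M ≤ k := by
    rw [← Real.log_le_log_iff (by positivity) hk0]
    linarith
  have hex : ∀ t, ∃ e : Fin k → List (Fin s.B), |t| ≤ s.K → Function.Injective e ∧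
      (∀ i, e i ∈ s.W T ∧ ((fib (s.W T) (fun w => s.fl T (s.Pl w t)) (e i)).card : ℝ) ≤ M) := by
    intro t
    by_cases ht : |t| ≤ s.K
    · obtain ⟨V, hVW, hVc, hV⟩ := hhalf T t ht
      have hkV : k ≤ V.card := by omega
      refine ⟨fun i => (V.equivFin.symm (Fin.castLE hkV i) : List (Fin s.B)), fun _ => ⟨?_, ?_⟩⟩
      · intro i i' h
        have := V.equivFin.symm.injective (Subtype.ext h)
        exact Fin.castLE_injective hkV this
      · intro i
        have hi := (V.equivFin.symm (Fin.castLE hkV i)).2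
        refine ⟨hVW hi, ?_⟩
        rw [hM]
        exact hV _ hi
    · exact ⟨fun _ => [], fun h => absurd h ht⟩
  choose e he using hex
  refine ⟨⟨T, k, e, (2 * c + 1) * M, by exact_mod_cast hT0, hQ1, hQk, fun t ht => (he t ht).1,
    fun t ht i => s.mem_W.1 ((he t ht).2 i).1, ?_⟩, ?_⟩
  · intro t ht y I hI
    rw [← Finset.card_image_of_injective I (he t ht).1]
    refine s.card_le_of_fib_le (y := y) (c := c) (t := t) (n := T) hM0.le ?_ ?_ ?_
    · intro w hw
      obtain ⟨i, -, rfl⟩ := Finset.mem_image.1 hw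
      exact ((he t ht).2 i).1
    · intro w hw
      obtain ⟨i, -, rfl⟩ := Finset.mem_image.1 hw
      exact ((he t ht).2 i).2
    · intro w hw
      obtain ⟨i, hi, rfl⟩ := Finset.mem_image.1 hw
      rw [hc]
      exact hI i hi
  · dsimp only
    obtain ⟨q, hq⟩ : ∃ q, q = Real.log ((2 * c + 1) * M) := ⟨_, rfl⟩
    rw [← hq] at hb ⊢
    have e1 : q / (T * Real.log s.B) + (Real.log k - q) / (T * s.ell)
        = (Real.log k / Real.log s.B + (Real.log k - q) * κ) / T := by
      rw [hκ]
      field_simp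
      ring
    rw [e1, le_div_iff₀ hT0]
    have h1 : T - Real.log 2 / Real.log s.B ≤ Real.log k / Real.log s.B := by
      rw [le_div_iff₀ hLB, sub_mul, div_mul_cancel₀ _ hLB.ne']
      exact hlogk
    have h2 := mul_le_mul_of_nonneg_right hb hκ0.le
    have h3 : s.ell * κ = 1 - s.ell / Real.log s.B := by
      rw [hκ]
      field_simp
    have h4 := mul_le_mul_of_nonneg_right hε1 hT0.le
    have h5 : ((s.ell - ε) * T - C') * κ = T * (s.ell * κ) - ε * κ * T - C' * κ := by ring
    rw [h5, h3] at h2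
    have h6 : σ = 2 - s.ell / Real.log s.B - g := by rw [hg]; ring
    rw [h6]
    generalize s.ell / Real.log s.B = α at *
    linarith

end Sys

theorem distInt_eq_norm (x : ℝ) : distInt x = ‖(x : UnitAddCircle)‖ :=
  (UnitAddCircle.norm_eq).symm

theorem continuous_distInt : Continuous distInt := by
  have : distInt = fun x : ℝ => ‖(x : UnitAddCircle)‖ := funext distInt_eq_norm
  rw [this]
  exact continuous_norm.comp (AddCircle.continuous_mk' 1)

theorem distInt_nonneg (x : ℝ) : 0 ≤ distInt x := abs_nonneg _

theorem distInt_le_half (x : ℝ) : distInt x ≤ 1 / 2 := abs_sub_round x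

theorem distInt_le_abs (x : ℝ) : distInt x ≤ |x| := by
  simpa [distInt] using round_le x 0

theorem distInt_add_int (x : ℝ) (n : ℤ) : distInt (x + n) = distInt x := by
  simp [distInt, round_add_intCast]

theorem distInt_neg (x : ℝ) : distInt (-x) = distInt x := by
  rw [distInt_eq_norm, distInt_eq_norm, AddCircle.coe_neg, norm_neg]

theorem distInt_eq_self {x : ℝ} (h0 : 0 ≤ x) (h1 : x ≤ 1 / 2) : distInt x = x := by
  rw [distInt, abs_sub_round_eq_min, Int.fract_eq_self.2 ⟨h0, by linarith⟩]
  exact min_eq_left (by linarith)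

namespace Sys

variable (s : Sys)

theorem H_term_le (n : ℕ) (x : ℝ) : ‖s.lam ^ n * distInt ((s.B : ℝ) ^ n * x)‖ ≤ s.lam ^ n := by
  have h0 := (s.lam_pow_pos n).le
  rw [Real.norm_of_nonneg (mul_nonneg h0 (distInt_nonneg _))]
  exact mul_le_of_le_one_right h0 ((distInt_le_half _).trans (by norm_num))

theorem summable_H (x : ℝ) : Summable fun n => s.lam ^ n * distInt ((s.B : ℝ) ^ n * x) :=
  Summable.of_norm_bounded (summable_geometric_of_lt_one s.lam_pos.le s.lam_lt)
    fun n => s.H_term_le n x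

theorem continuous_H : Continuous s.H := by
  refine continuous_tsum (fun n => ?_)
    (summable_geometric_of_lt_one s.lam_pos.le s.lam_lt) s.H_term_le
  exact continuous_const.mul (continuous_distInt.comp (continuous_const.mul continuous_id))

theorem H_eq (x : ℝ) : s.H x = distInt x + s.lam * s.H (s.B * x) := by
  unfold H
  rw [(s.summable_H x).tsum_eq_zero_add, ← tsum_mul_left]
  congr 1
  · simp
  · congr 1
    ext n
    rw [pow_succ, pow_succ, mul_assoc ((s.B : ℝ) ^ n)]
    ring

theorem H_add_int (x : ℝ) (k : ℤ) : s.H (x + k) = s.H x := by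
  unfold H
  congr 1
  ext n
  have : (s.B : ℝ) ^ n * (x + k) = s.B ^ n * x + ((s.B ^ n * k : ℤ) : ℝ) := by push_cast; ring
  rw [this, distInt_add_int]

theorem H_neg (x : ℝ) : s.H (-x) = s.H x := by
  unfold H
  congr 1
  ext n
  rw [mul_neg, distInt_neg]

theorem H_zero : s.H 0 = 0 := by
  simp [H, distInt]

theorem Pl_eq (w : List (Fin s.B)) (t : ℝ) : s.Pl w t = s.H (s.xl w) + (t - 1) * s.xl w := by
  induction w generalizing t with
  | nil => simp [Pl, xl, H_zero]
  | cons d w ih =>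
    have hB := s.B_pos
    have hmem := s.xl_mem (d :: w)
    rw [s.H_eq, distInt_eq_self hmem.1 hmem.2]
    have hBx : s.H (s.B * s.xl (d :: w)) = s.H (s.xl w) := by
      obtain ⟨q, hq⟩ : ∃ q : ℕ, (d : ℕ) + (d : ℕ) % 2 = q * 2 :=
        ⟨((d : ℕ) + (d : ℕ) % 2) / 2, by omega⟩
      have e1 : s.B * s.xl (d :: w) = s.sg d * s.xl w + ((q : ℤ) : ℝ) := by
        simp only [xl, vv]
        rw [hq]
        push_cast
        field_simp
        ring
      rw [e1, H_add_int]
      rcases s.sg_cases d with h | h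
      · rw [h.1, one_mul]
      · rw [h.1, neg_one_mul, H_neg]
    rw [hBx]
    simp only [Pl, xl]
    rw [ih]
    linear_combination (s.sg d * t * s.xl w) * s.lam_gam

theorem Pl_one (w : List (Fin s.B)) : s.Pl w 1 = s.H (s.xl w) := by
  rw [Pl_eq]
  ring

theorem one_mem : |(1 : ℝ)| ≤ s.K := by
  rw [abs_one]
  exact s.one_le_K

end Sys

namespace Blocks

variable {s : Sys} (b : Blocks s)

/-- The word obtained by concatenating the blocks chosen by `ω`. -/
def word (ω : ℕ → Fin b.k) : ℕ → List (Fin s.B)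
  | 0 => []
  | n + 1 => word ω n ++ b.e (s.Tl (word ω n) 1) (ω n)

theorem Tl_word_le (ω : ℕ → Fin b.k) (n : ℕ) : |s.Tl (b.word ω n) 1| ≤ s.K :=
  s.Tl_le _ s.one_mem

theorem length_word (ω : ℕ → Fin b.k) (n : ℕ) : (b.word ω n).length = n * b.T := by
  induction n with
  | zero => simp [word]
  | succ n ih =>
    rw [word, List.length_append, ih, b.length_eq _ (b.Tl_word_le ω n)]
    ring

theorem eq_of_word_eq {ω ω' : ℕ → Fin b.k} {n : ℕ} (h : b.word ω n = b.word ω' n) :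
    ∀ i < n, ω i = ω' i := by
  induction n with
  | zero => simp
  | succ n ih =>
    rw [word, word] at h
    obtain ⟨h1, h2⟩ := List.append_inj h (by rw [length_word, length_word])
    rw [← h1] at h2
    have h3 := b.inj _ (b.Tl_word_le ω n) h2
    intro i hi
    rcases Nat.lt_succ_iff_lt_or_eq.1 hi with hi | rfl
    · exact ih h1 i hi
    · exact h3

/-- The concatenations of `n` admissible blocks starting from slope `t`. -/
def reach : ℕ → ℝ → Finset (List (Fin s.B))
  | 0, _ => {[]}
  | n + 1, t => Finset.univ.biUnion fun i =>
      (reach n (s.Tl (b.e t i) t)).image fun v => b.e t i ++ v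

theorem append_mem_reach {n : ℕ} {t : ℝ} {v : List (Fin s.B)} (hv : v ∈ b.reach n t)
    (i : Fin b.k) : v ++ b.e (s.Tl v t) i ∈ b.reach (n + 1) t := by
  induction n generalizing t v with
  | zero =>
    rw [reach, Finset.mem_singleton] at hv
    subst hv
    simp only [reach, Finset.mem_biUnion, Finset.mem_univ, true_and]
    exact ⟨i, by simp [Sys.Tl]⟩
  | succ n ih =>
    rw [reach] at hv
    simp only [Finset.mem_biUnion, Finset.mem_univ, true_and, Finset.mem_image] at hv
    obtain ⟨j, v', hv', rfl⟩ := hv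
    rw [reach]
    simp only [Finset.mem_biUnion, Finset.mem_univ, true_and, Finset.mem_image]
    refine ⟨j, _, ih hv', ?_⟩
    rw [s.Tl_append, List.append_assoc]

theorem word_add (ω : ℕ → Fin b.k) (n m : ℕ) :
    ∃ v ∈ b.reach m (s.Tl (b.word ω n) 1), b.word ω (n + m) = b.word ω n ++ v := by
  induction m with
  | zero => exact ⟨[], by simp [reach], by simp⟩
  | succ m ih =>
    obtain ⟨v, hv, h⟩ := ih
    refine ⟨_, b.append_mem_reach hv (ω (n + m)), ?_⟩
    rw [← add_assoc, word, h, s.Tl_append, List.append_assoc]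

theorem card_reach_le (m : ℕ) {t : ℝ} (ht : |t| ≤ s.K) (y : ℝ) :
    (((b.reach m t).filter fun v => |s.Pl v t - y| ≤ (s.KK + 1) * s.lam ^ (m * b.T)).card : ℝ)
      ≤ b.Q ^ m := by
  classical
  induction m generalizing t y with
  | zero =>
    rw [pow_zero]
    have : ((b.reach 0 t).filter fun v =>
        |s.Pl v t - y| ≤ (s.KK + 1) * s.lam ^ (0 * b.T)).card ≤ 1 :=
      (Finset.card_filter_le _ _).trans (by simp [reach])
    exact_mod_cast this
  | succ m ih =>
    have hl := s.lam_pow_pos b.T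
    have hKK : (0 : ℝ) ≤ s.KK := Nat.cast_nonneg _
    have hQ : 0 ≤ b.Q ^ m := pow_nonneg (by linarith [b.one_le_Q]) m
    set I : Finset (Fin b.k) := Finset.univ.filter fun i =>
      |s.Pl (b.e t i) t - y| ≤ (2 * s.KK + 1 : ℕ) * s.lam ^ b.T with hI
    have hIc : (I.card : ℝ) ≤ b.Q := b.count t ht y I fun i hi => (Finset.mem_filter.1 hi).2
    set F : Fin b.k → Finset (List (Fin s.B)) := fun i =>
      (b.reach m (s.Tl (b.e t i) t)).filter fun v =>
        |s.Pl v (s.Tl (b.e t i) t) - (y - s.Pl (b.e t i) t) / s.lam ^ b.T|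
          ≤ (s.KK + 1) * s.lam ^ (m * b.T) with hF
    have hsub : ((b.reach (m + 1) t).filter fun v =>
        |s.Pl v t - y| ≤ (s.KK + 1) * s.lam ^ ((m + 1) * b.T))
        ⊆ I.biUnion fun i => (F i).image fun v => b.e t i ++ v := by
      intro v hv
      rw [Finset.mem_filter, reach] at hv
      obtain ⟨hv, hvy⟩ := hv
      simp only [Finset.mem_biUnion, Finset.mem_univ, true_and, Finset.mem_image] at hv
      obtain ⟨i, v, hv, rfl⟩ := hv
      rw [s.Pl_append, b.length_eq t ht] at hvy
      have hp : s.lam ^ ((m + 1) * b.T) = s.lam ^ b.T * s.lam ^ (m * b.T) := by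
        rw [← pow_add]
        congr 1
        ring
      simp only [Finset.mem_biUnion, Finset.mem_image]
      refine ⟨i, ?_, v, ?_, rfl⟩
      · rw [hI, Finset.mem_filter]
        refine ⟨Finset.mem_univ _, ?_⟩
        have h1 := (s.Pl_le v (s.Tl_le (b.e t i) ht)).trans s.K2_le_KK
        have h2 : |s.lam ^ b.T * s.Pl v (s.Tl (b.e t i) t)| ≤ s.lam ^ b.T * s.KK := by
          rw [abs_mul, abs_of_pos hl]
          gcongr
        have h3 : s.lam ^ (m * b.T) ≤ 1 := pow_le_one₀ s.lam_pos.le s.lam_lt.le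
        have h4 : (s.KK + 1) * s.lam ^ ((m + 1) * b.T) ≤ (s.KK + 1) * s.lam ^ b.T := by
          rw [hp]
          have : s.lam ^ b.T * s.lam ^ (m * b.T) ≤ s.lam ^ b.T := mul_le_of_le_one_right hl.le h3
          gcongr
        have e1 : s.Pl (b.e t i) t - y = (s.Pl (b.e t i) t
            + s.lam ^ b.T * s.Pl v (s.Tl (b.e t i) t) - y)
            - s.lam ^ b.T * s.Pl v (s.Tl (b.e t i) t) := by ring
        rw [e1]
        refine (abs_sub _ _).trans ?_
        push_cast
        linarith
      · rw [hF, Finset.mem_filter]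
        refine ⟨hv, ?_⟩
        have e1 : s.Pl v (s.Tl (b.e t i) t) - (y - s.Pl (b.e t i) t) / s.lam ^ b.T
            = (s.Pl (b.e t i) t + s.lam ^ b.T * s.Pl v (s.Tl (b.e t i) t) - y) / s.lam ^ b.T := by
          field_simp
          ring
        rw [e1, abs_div, abs_of_pos hl, div_le_iff₀ hl]
        rw [hp] at hvy
        linarith
    calc _ ≤ ((I.biUnion fun i => (F i).image fun v => b.e t i ++ v).card : ℝ) := by
          exact_mod_cast Finset.card_le_card hsub
      _ ≤ ∑ i ∈ I, ((F i).card : ℝ) := by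
          exact_mod_cast Finset.card_biUnion_le.trans
            (Finset.sum_le_sum fun i _ => Finset.card_image_le)
      _ ≤ ∑ i ∈ I, b.Q ^ m := Finset.sum_le_sum fun i _ => ih (s.Tl_le _ ht) _
      _ = I.card * b.Q ^ m := by simp
      _ ≤ b.Q * b.Q ^ m := by gcongr
      _ = b.Q ^ (m + 1) := by ring

theorem abs_xl_word_succ (ω : ℕ → Fin b.k) (n : ℕ) :
    dist (s.xl (b.word ω n)) (s.xl (b.word ω (n + 1))) ≤ 1 / 2 * (((s.B : ℝ) ^ b.T)⁻¹) ^ n := by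
  have h1 := s.xl_append_mem' (b.word ω n) []
  have h2 := s.xl_append_mem' (b.word ω n) (b.e (s.Tl (b.word ω n) 1) (ω n))
  rw [List.append_nil] at h1
  rw [b.length_word] at h1 h2
  rw [Real.dist_eq, word]
  have hB : (0 : ℝ) < 2 * s.B ^ (n * b.T) := by have := s.B_pos; positivity
  have e1 : 1 / 2 * (((s.B : ℝ) ^ b.T)⁻¹) ^ n = 1 / (2 * s.B ^ (n * b.T)) := by
    rw [mul_comm n, pow_mul, inv_pow]
    field_simp
  rw [e1, le_div_iff₀ hB, ← abs_of_pos hB, ← abs_mul, sub_mul, abs_le]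
  constructor <;> linarith

theorem cauchySeq_xl (ω : ℕ → Fin b.k) : CauchySeq fun n => s.xl (b.word ω n) := by
  refine cauchySeq_of_le_geometric _ (1 / 2) ?_ (b.abs_xl_word_succ ω)
  have h2 : (1 : ℝ) < s.B := by linarith [s.two_le_B]
  exact inv_lt_one_of_one_lt₀ (one_lt_pow₀ h2 (Nat.ne_of_gt b.T_pos))

/-- The point coded by `ω`. -/
def pos (ω : ℕ → Fin b.k) : ℝ := (cauchySeq_tendsto_of_complete (b.cauchySeq_xl ω)).choose

theorem tendsto_pos (ω : ℕ → Fin b.k) :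
    Tendsto (fun n => s.xl (b.word ω n)) atTop (nhds (b.pos ω)) :=
  (cauchySeq_tendsto_of_complete (b.cauchySeq_xl ω)).choose_spec

theorem pos_mem (ω : ℕ → Fin b.k) : 0 ≤ b.pos ω ∧ b.pos ω ≤ 1 / 2 :=
  ⟨ge_of_tendsto' (b.tendsto_pos ω) fun _ => (s.xl_mem _).1,
    le_of_tendsto' (b.tendsto_pos ω) fun _ => (s.xl_mem _).2⟩

theorem pos_mul_mem (ω : ℕ → Fin b.k) (n : ℕ) :
    (s.ix (b.word ω n) : ℝ) ≤ b.pos ω * (2 * s.B ^ (n * b.T)) ∧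
      b.pos ω * (2 * s.B ^ (n * b.T)) ≤ s.ix (b.word ω n) + 1 := by
  have h := (b.tendsto_pos ω).mul_const (2 * (s.B : ℝ) ^ (n * b.T))
  have hm : ∀ m ≥ n, ∃ v, b.word ω m = b.word ω n ++ v := by
    intro m hm
    obtain ⟨r, rfl⟩ := Nat.exists_eq_add_of_le hm
    obtain ⟨v, -, h⟩ := b.word_add ω n r
    exact ⟨v, h⟩
  constructor
  · refine ge_of_tendsto h (eventually_atTop.2 ⟨n, fun m hmn => ?_⟩)
    obtain ⟨v, hv⟩ := hm m hmn
    rw [hv, ← b.length_word ω n]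
    exact (s.xl_append_mem' _ v).1
  · refine le_of_tendsto h (eventually_atTop.2 ⟨n, fun m hmn => ?_⟩)
    obtain ⟨v, hv⟩ := hm m hmn
    rw [hv, ← b.length_word ω n]
    exact (s.xl_append_mem' _ v).2

theorem abs_H_pos_sub_le (ω : ℕ → Fin b.k) (n : ℕ) :
    |s.H (b.pos ω) - s.Pl (b.word ω n) 1| ≤ s.KK * s.lam ^ (n * b.T) := by
  have h := ((s.continuous_H.tendsto _).comp (b.tendsto_pos ω)).sub_const (s.Pl (b.word ω n) 1)
  refine le_of_tendsto h.abs (eventually_atTop.2 ⟨n, fun m hm => ?_⟩)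
  obtain ⟨r, rfl⟩ := Nat.exists_eq_add_of_le hm
  obtain ⟨v, -, hv⟩ := b.word_add ω n r
  simp only [Function.comp_apply]
  rw [← s.Pl_one, hv, s.Pl_append, add_sub_cancel_left, b.length_word, abs_mul,
    abs_of_pos (s.lam_pow_pos _), mul_comm]
  have := (s.Pl_le v (b.Tl_word_le ω n)).trans s.K2_le_KK
  have := s.lam_pow_pos (n * b.T)
  gcongr

theorem k_pos : 0 < b.k := by
  have h := b.one_le_Q.trans b.Q_le
  have : (0 : ℝ) < b.k := by linarith
  exact_mod_cast this

instance : Nonempty (Fin b.k) := ⟨⟨0, b.k_pos⟩⟩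

/-- The uniform measure on the set of admissible choices. -/
def prob : Measure (ℕ → Fin b.k) :=
  Measure.infinitePi fun _ => ProbabilityTheory.uniformOn (univ : Set (Fin b.k))

instance (i : ℕ) : IsProbabilityMeasure
    ((fun _ : ℕ => ProbabilityTheory.uniformOn (univ : Set (Fin b.k))) i) :=
  ProbabilityTheory.isProbabilityMeasure_uniformOn finite_univ univ_nonempty

instance : IsProbabilityMeasure b.prob := by
  unfold prob
  infer_instance

theorem prob_word_eq_le (n : ℕ) (u : List (Fin s.B)) :
    b.prob {ω | b.word ω n = u} ≤ ((b.k : ENNReal)⁻¹) ^ n := by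
  rcases ({ω | b.word ω n = u} : Set _).eq_empty_or_nonempty with h | ⟨ω₀, h₀⟩
  · rw [h]
    simp
  · have hsub : {ω | b.word ω n = u}
        ⊆ Set.pi (Finset.range n : Finset ℕ) fun i => ({ω₀ i} : Set (Fin b.k)) := by
      intro ω hω i hi
      exact b.eq_of_word_eq (hω.trans h₀.symm) i (Finset.mem_range.1 hi)
    refine (measure_mono hsub).trans ?_
    unfold prob
    rw [Measure.infinitePi_pi _ fun i _ => MeasurableSet.singleton _]
    simp [ProbabilityTheory.uniformOn_univ]

theorem measurable_pos : Measurable b.pos := by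
  let _ : MeasurableSpace (List (Fin s.B)) := ⊤
  have hd : DiscreteMeasurableSpace (List (Fin s.B)) := ⟨fun _ => trivial⟩
  have hw : ∀ n, Measurable fun ω : ℕ → Fin b.k => b.word ω n := by
    intro n
    induction n with
    | zero => exact measurable_const
    | succ n ih =>
      have hg : Measurable fun p : List (Fin s.B) × Fin b.k =>
          p.1 ++ b.e (s.Tl p.1 1) p.2 := Measurable.of_discrete
      exact hg.comp (ih.prodMk (measurable_pi_apply n))
  refine measurable_of_tendsto_metrizable (f := fun n ω => s.xl (b.word ω n)) (fun n => ?_)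
    (tendsto_pi_nhds.2 b.tendsto_pos)
  exact Measurable.of_discrete.comp (hw n)

theorem card_ix_near_le (N : ℕ) (a : ℝ) :
    ((s.W N).filter fun u => a - 2 ≤ s.ix u ∧ (s.ix u : ℝ) ≤ a + 1).card ≤ 4 := by
  rw [← Finset.card_image_of_injOn (f := fun u => (s.ix u : ℤ))]
  · have hsub : (((s.W N).filter fun u => a - 2 ≤ s.ix u ∧ (s.ix u : ℝ) ≤ a + 1).image
        fun u => (s.ix u : ℤ)) ⊆ Finset.Icc ⌈a - 2⌉ ⌊a + 1⌋ := by
      intro x hx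
      obtain ⟨u, hu, rfl⟩ := Finset.mem_image.1 hx
      obtain ⟨-, h1, h2⟩ := Finset.mem_filter.1 hu
      exact Finset.mem_Icc.2 ⟨Int.ceil_le.2 (by exact_mod_cast h1),
        Int.le_floor.2 (by exact_mod_cast h2)⟩
    refine (Finset.card_le_card hsub).trans ?_
    rw [Int.card_Icc]
    have h1 := Int.le_ceil (a - 2)
    have h2 := Int.floor_le (a + 1)
    have h3 : ⌊a + 1⌋ - ⌈a - 2⌉ ≤ 3 := by
      have : ((⌊a + 1⌋ - ⌈a - 2⌉ : ℤ) : ℝ) ≤ 3 := by push_cast; linarith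
      exact_mod_cast this
    omega
  · intro u hu v hv h
    have hu' := s.mem_W.1 (Finset.mem_filter.1 hu).1
    have hv' := s.mem_W.1 (Finset.mem_filter.1 hv).1
    have h' : (s.ix u : ℤ) = s.ix v := h
    exact s.ix_inj (hu'.trans hv'.symm) (by exact_mod_cast h')

theorem prob_near_le (n m : ℕ) (x y : ℝ) :
    b.prob {ω | |b.pos ω - x| * (2 * s.B ^ (n * b.T)) ≤ 1 ∧
        |s.H (b.pos ω) - y| ≤ s.lam ^ ((n + m) * b.T)}
      ≤ ENNReal.ofReal (4 * b.Q ^ m * ((b.k : ℝ)⁻¹) ^ (n + m)) := by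
  classical
  have hB : (0 : ℝ) < 2 * s.B ^ (n * b.T) := by have := s.B_pos; positivity
  have hQ : 0 ≤ b.Q ^ m := pow_nonneg (by linarith [b.one_le_Q]) m
  have hl := s.lam_pow_pos (n * b.T)
  set a : ℝ := x * (2 * s.B ^ (n * b.T)) with ha
  set U := (s.W (n * b.T)).filter fun u => a - 2 ≤ s.ix u ∧ (s.ix u : ℝ) ≤ a + 1 with hU
  set G : List (Fin s.B) → Finset (List (Fin s.B)) := fun u =>
    (b.reach m (s.Tl u 1)).filter fun v =>
      |s.Pl v (s.Tl u 1) - (y - s.Pl u 1) / s.lam ^ (n * b.T)|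
        ≤ (s.KK + 1) * s.lam ^ (m * b.T) with hG
  set F := U.biUnion fun u => (G u).image fun v => u ++ v with hF
  have hFc : (F.card : ℝ) ≤ 4 * b.Q ^ m := by
    calc (F.card : ℝ) ≤ ∑ u ∈ U, ((G u).card : ℝ) := by
          exact_mod_cast Finset.card_biUnion_le.trans
            (Finset.sum_le_sum fun i _ => Finset.card_image_le)
      _ ≤ ∑ u ∈ U, b.Q ^ m :=
          Finset.sum_le_sum fun u _ => b.card_reach_le m (s.Tl_le _ s.one_mem) _
      _ = U.card * b.Q ^ m := by simp
      _ ≤ 4 * b.Q ^ m := by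
          have : (U.card : ℝ) ≤ 4 := by exact_mod_cast card_ix_near_le (n * b.T) a
          gcongr
  have hsub : {ω | |b.pos ω - x| * (2 * s.B ^ (n * b.T)) ≤ 1 ∧
        |s.H (b.pos ω) - y| ≤ s.lam ^ ((n + m) * b.T)}
      ⊆ ⋃ w ∈ F, {ω | b.word ω (n + m) = w} := by
    rintro ω ⟨h1, h2⟩
    simp only [mem_iUnion, exists_prop]
    refine ⟨_, ?_, rfl⟩
    obtain ⟨v, hv, hw⟩ := b.word_add ω n m
    rw [hw, hF]
    simp only [Finset.mem_biUnion, Finset.mem_image]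
    refine ⟨_, ?_, v, ?_, rfl⟩
    · have h3 := b.pos_mul_mem ω n
      rw [← abs_of_pos hB, ← abs_mul, sub_mul, ← ha, abs_le] at h1
      rw [hU, Finset.mem_filter, s.mem_W]
      exact ⟨b.length_word ω n, by linarith, by linarith⟩
    · rw [hG, Finset.mem_filter]
      refine ⟨hv, ?_⟩
      have h3 := b.abs_H_pos_sub_le ω (n + m)
      have e1 : s.Pl v (s.Tl (b.word ω n) 1) - (y - s.Pl (b.word ω n) 1) / s.lam ^ (n * b.T)
          = (s.Pl (b.word ω (n + m)) 1 - y) / s.lam ^ (n * b.T) := by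
        rw [hw, s.Pl_append, b.length_word]
        field_simp
        ring
      have hp : s.lam ^ ((n + m) * b.T) = s.lam ^ (m * b.T) * s.lam ^ (n * b.T) := by
        rw [← pow_add]
        congr 1
        ring
      rw [e1, abs_div, abs_of_pos hl, div_le_iff₀ hl, mul_assoc, ← hp]
      have h4 := abs_sub_le (s.Pl (b.word ω (n + m)) 1) (s.H (b.pos ω)) y
      rw [abs_sub_comm (s.Pl (b.word ω (n + m)) 1) (s.H _)] at h4
      linarith
  have hk : (b.k : ENNReal)⁻¹ = ENNReal.ofReal ((b.k : ℝ)⁻¹) := by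
    rw [ENNReal.ofReal_inv_of_pos (by exact_mod_cast b.k_pos), ENNReal.ofReal_natCast]
  calc _ ≤ b.prob (⋃ w ∈ F, {ω | b.word ω (n + m) = w}) := measure_mono hsub
    _ ≤ ∑ w ∈ F, b.prob {ω | b.word ω (n + m) = w} := measure_biUnion_finset_le _ _
    _ ≤ ∑ w ∈ F, ((b.k : ENNReal)⁻¹) ^ (n + m) :=
        Finset.sum_le_sum fun w _ => b.prob_word_eq_le _ w
    _ = ENNReal.ofReal (F.card * ((b.k : ℝ)⁻¹) ^ (n + m)) := by
        rw [hk, Finset.sum_const, nsmul_eq_mul, ← ENNReal.ofReal_pow (by positivity),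
          ENNReal.ofReal_mul (by positivity), ENNReal.ofReal_natCast]
    _ ≤ _ := by
        refine ENNReal.ofReal_le_ofReal ?_
        gcongr

end Blocks

namespace Sys

variable (s : Sys)

theorem exists_measure {σ : ℝ} (hσ : σ < 2 - s.ell / Real.log s.B) :
    ∃ ν : Measure ℝ, IsProbabilityMeasure ν ∧ ν (Icc 0 1)ᶜ = 0 ∧ ∃ C : ℝ, 0 < C ∧
      ∀ x y ρ : ℝ, 0 < ρ → ρ ≤ 1 / 2 →
        ν {z | |z - x| ≤ ρ ∧ |s.H z - y| ≤ ρ} ≤ ENNReal.ofReal (C * ρ ^ σ) := by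
  obtain ⟨b, hb⟩ := s.exists_blocks hσ
  have hlB := s.logB_pos
  have hell := s.ell_pos
  have hT : (0 : ℝ) < b.T := by exact_mod_cast b.T_pos
  have hk : (0 : ℝ) < b.k := by exact_mod_cast b.k_pos
  have hQ : 0 < b.Q := by linarith [b.one_le_Q]
  have hq : 0 ≤ Real.log b.Q := Real.log_nonneg b.one_le_Q
  have hqk : Real.log b.Q ≤ Real.log b.k := Real.log_le_log hQ b.Q_le
  obtain ⟨c, hc⟩ : ∃ c, c = Real.log 4 + Real.log b.Q * (Real.log 2 / (b.T * Real.log s.B))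
    + Real.log b.k := ⟨_, rfl⟩
  refine ⟨b.prob.map b.pos, Measure.isProbabilityMeasure_map b.measurable_pos.aemeasurable, ?_,
    Real.exp c, Real.exp_pos _, ?_⟩
  · rw [Measure.map_apply b.measurable_pos measurableSet_Icc.compl]
    have : b.pos ⁻¹' (Icc 0 1)ᶜ = ∅ := by
      ext ω
      have := b.pos_mem ω
      simp only [mem_preimage, mem_compl_iff, mem_Icc, mem_empty_iff_false, iff_false, not_not]
      exact ⟨this.1, by linarith⟩
    rw [this, measure_empty]
  · intro x y ρ hρ hρ2
    have hB1 : (1 : ℝ) < s.B ^ b.T := one_lt_pow₀ (by linarith [s.two_le_B]) b.T_pos.ne'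
    have hBT : (0 : ℝ) < s.B ^ b.T := by linarith
    have hlT : s.lam ^ b.T < 1 := pow_lt_one₀ s.lam_pos.le s.lam_lt b.T_pos.ne'
    obtain ⟨n, hn1, hn2⟩ := exists_nat_pow_near_of_lt_one (show 0 < 2 * ρ by linarith)
      (by linarith) (inv_pos.2 hBT) (inv_lt_one_of_one_lt₀ hB1)
    obtain ⟨N, hN1, hN2⟩ := exists_nat_pow_near_of_lt_one hρ (by linarith)
      (s.lam_pow_pos b.T) hlT
    have hnN : n ≤ N := by
      by_contra h
      have h1 : (s.lam ^ b.T) ^ n ≤ (s.lam ^ b.T) ^ (N + 1) :=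
        pow_le_pow_of_le_one (s.lam_pow_pos _).le hlT.le (by omega)
      have h2 : ((s.B ^ b.T : ℝ)⁻¹) ^ n ≤ (s.lam ^ b.T) ^ n := by
        have := s.lt_lam.le
        rw [← inv_pow]
        have := s.B_pos
        gcongr
      linarith
    obtain ⟨m, rfl⟩ := Nat.exists_eq_add_of_le hnN
    have hmeas : MeasurableSet {z | |z - x| ≤ ρ ∧ |s.H z - y| ≤ ρ} := by
      have h1 : IsClosed {z : ℝ | |z - x| ≤ ρ} :=
        isClosed_le (by fun_prop) continuous_const
      have h2 : IsClosed {z : ℝ | |s.H z - y| ≤ ρ} :=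
        isClosed_le ((s.continuous_H.sub continuous_const).abs) continuous_const
      exact (h1.inter h2).measurableSet
    rw [Measure.map_apply b.measurable_pos hmeas]
    refine (measure_mono ?_).trans ((b.prob_near_le n m x y).trans ?_)
    · rintro ω ⟨h1, h2⟩
      refine ⟨?_, h2.trans (hN2.trans_eq ?_)⟩
      · rw [inv_pow, ← pow_mul, mul_comm b.T, le_inv_comm₀ (by linarith)
          (pow_pos s.B_pos _)] at hn2
        have h3 : (s.B : ℝ) ^ (n * b.T) * (2 * ρ) ≤ 1 := by
          calc _ ≤ (2 * ρ)⁻¹ * (2 * ρ) := by gcongr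
            _ = 1 := inv_mul_cancel₀ (by linarith)
        have h4 : |b.pos ω - x| * (2 * s.B ^ (n * b.T)) ≤ ρ * (2 * s.B ^ (n * b.T)) := by
          have := pow_pos s.B_pos (n * b.T)
          gcongr
        linarith
      · rw [← pow_mul, mul_comm]
    · refine ENNReal.ofReal_le_ofReal ?_
      have hL1 : -Real.log ρ - Real.log 2 ≤ (n + 1) * (b.T * Real.log s.B) := by
        have := Real.log_lt_log (by positivity) hn1
        rw [Real.log_pow, Real.log_inv, Real.log_pow, Real.log_mul (by norm_num) hρ.ne'] at this
        push_cast at this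
        linarith
      have hL2 : -Real.log ρ ≤ (n + m + 1) * (b.T * s.ell) := by
        have := Real.log_lt_log (pow_pos (s.lam_pow_pos _) _) hN1
        have he : s.ell = -Real.log s.lam := by rw [Sys.ell, one_div, Real.log_inv]
        rw [Real.log_pow, Real.log_pow] at this
        push_cast at this
        rw [he]
        linarith
      have hL0 : 0 ≤ -Real.log ρ := by
        have := Real.log_nonpos hρ.le (by linarith)
        linarith
      have e1 : (4 : ℝ) * b.Q ^ m * ((b.k : ℝ)⁻¹) ^ (n + m)
          = Real.exp (Real.log 4 + m * Real.log b.Q - (n + m) * Real.log b.k) := by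
        rw [Real.exp_sub, Real.exp_add, Real.exp_log (by norm_num), mul_comm (m : ℝ),
          Real.exp_mul, Real.exp_log hQ, mul_comm ((n : ℝ) + m), Real.exp_mul, Real.exp_log hk,
          inv_pow, div_eq_mul_inv]
        norm_cast
      have e2 : Real.exp c * ρ ^ σ = Real.exp (c + Real.log ρ * σ) := by
        rw [Real.exp_add c, Real.rpow_def_of_pos hρ]
      rw [e1, e2, Real.exp_le_exp]
      have h1 := mul_le_mul_of_nonneg_left hb hL0
      have h2 : Real.log b.Q * ((-Real.log ρ - Real.log 2) / (b.T * Real.log s.B))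
          ≤ Real.log b.Q * (n + 1) := by
        refine mul_le_mul_of_nonneg_left ?_ hq
        rw [div_le_iff₀ (by positivity)]
        exact hL1
      have h3 : (Real.log b.k - Real.log b.Q) * (-Real.log ρ / (b.T * s.ell))
          ≤ (Real.log b.k - Real.log b.Q) * (n + m + 1) := by
        refine mul_le_mul_of_nonneg_left ?_ (by linarith)
        rw [div_le_iff₀ (by positivity)]
        exact hL2
      have e3 : -Real.log ρ * (Real.log b.Q / (b.T * Real.log s.B)
            + (Real.log b.k - Real.log b.Q) / (b.T * s.ell))
          = Real.log b.Q * ((-Real.log ρ - Real.log 2) / (b.T * Real.log s.B))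
            + (Real.log b.k - Real.log b.Q) * (-Real.log ρ / (b.T * s.ell))
            + Real.log b.Q * (Real.log 2 / (b.T * Real.log s.B)) := by ring
      rw [e3] at h1
      rw [hc]
      linarith

end Sys

open scoped Topology

/-- The mass distribution principle, for measures with a power bound on balls. -/
theorem ofReal_le_dimH_of_closedBall_le {X : Type*} [MetricSpace X] [MeasurableSpace X]
    [BorelSpace X] (μ : Measure X) {C s : ℝ} (hC : 0 < C) (hs : 0 ≤ s)
    (h : ∀ p ρ, 0 < ρ → ρ ≤ 1 / 2 → μ (Metric.closedBall p ρ) ≤ ENNReal.ofReal (C * ρ ^ s))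
    {S : Set X} (hS : μ S ≠ 0) : ENNReal.ofReal s ≤ dimH S := by
  have hCe : ENNReal.ofReal C ≠ 0 := (ENNReal.ofReal_pos.2 hC).ne'
  have key : (ENNReal.ofReal C)⁻¹ • μ ≤ μH[s] := by
    refine Measure.le_hausdorffMeasure s _ (ENNReal.ofReal (1 / 4)) (by simp) fun A hA => ?_
    rcases A.eq_empty_or_nonempty with rfl | ⟨p, hp⟩
    · simp
    have hfin : Metric.ediam A ≠ ⊤ := (hA.trans_lt ENNReal.ofReal_lt_top).ne
    obtain ⟨r, hr0, hr⟩ : ∃ r : ℝ, 0 ≤ r ∧ Metric.ediam A = ENNReal.ofReal r :=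
      ⟨_, ENNReal.toReal_nonneg, (ENNReal.ofReal_toReal hfin).symm⟩
    have hr4 : r ≤ 1 / 4 := by
      rw [hr] at hA
      exact (ENNReal.ofReal_le_ofReal_iff (by norm_num)).1 hA
    have hμ : μ A ≤ ENNReal.ofReal (C * r ^ s) := by
      have hlim : Tendsto (fun ρ : ℝ => ENNReal.ofReal (C * ρ ^ s)) (𝓝[>] r)
          (𝓝 (ENNReal.ofReal (C * r ^ s))) := by
        refine (ENNReal.continuous_ofReal.tendsto _).comp (Tendsto.const_mul _ ?_)
        exact ((Real.continuousAt_rpow_const r s (Or.inr hs)).tendsto).mono_left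
          nhdsWithin_le_nhds
      refine ge_of_tendsto hlim ?_
      filter_upwards [Ioo_mem_nhdsGT (show r < 1 / 2 by linarith)] with ρ hρ
      refine (measure_mono fun q hq => ?_).trans (h p ρ (hr0.trans_lt hρ.1) hρ.2.le)
      have h1 := Metric.edist_le_ediam_of_mem hq hp
      rw [hr, edist_dist, ENNReal.ofReal_le_ofReal_iff hr0] at h1
      exact h1.trans hρ.1.le
    rw [Measure.smul_apply, smul_eq_mul, hr, ENNReal.ofReal_rpow_of_nonneg hr0 hs,
      ENNReal.inv_mul_le_iff hCe ENNReal.ofReal_ne_top, ← ENNReal.ofReal_mul hC.le]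
    exact hμ
  have hne : μH[((⟨s, hs⟩ : NNReal) : ℝ)] S ≠ 0 := by
    intro h0
    have h1 := key S
    change μH[s] S = 0 at h0
    rw [h0, Measure.smul_apply, smul_eq_mul, nonpos_iff_eq_zero, mul_eq_zero] at h1
    exact h1.elim (fun h => by simp at h) hS
  have := le_dimH_of_hausdorffMeasure_ne_zero hne
  rwa [ENNReal.ofReal, Real.toNNReal_of_nonneg hs]

/-- If `ν` has a power bound of exponent `σ` on the graph of `f`, then the graph of
`f t + c z`, with `n` further variables `z`, has dimension at least `σ + n`. -/
theorem le_dimH_graph_add {n : ℕ} (i : Fin (n + 1)) {f : ℝ → ℝ} {c : (Fin n → ℝ) → ℝ}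
    (hf : Continuous f) (hc : Continuous c) (ν : Measure ℝ) [IsProbabilityMeasure ν]
    (hν : ν (Icc 0 1)ᶜ = 0) {C σ : ℝ} (hC : 0 < C) (hσ : 0 ≤ σ)
    (h : ∀ x y ρ : ℝ, 0 < ρ → ρ ≤ 1 / 2 →
      ν {z | |z - x| ≤ ρ ∧ |f z - y| ≤ ρ} ≤ ENNReal.ofReal (C * ρ ^ σ))
    {S : Set ((Fin (n + 1) → ℝ) × ℝ)}
    (hS : ∀ t ∈ Icc (0 : ℝ) 1, ∀ z ∈ Icc (0 : Fin n → ℝ) 1,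
      ((i.insertNth t z : Fin (n + 1) → ℝ), f t + c z) ∈ S) :
    ENNReal.ofReal (σ + n) ≤ dimH S := by
  set κ : Measure (Fin n → ℝ) := volume.restrict (Icc 0 1) with hκ
  let Φ : ℝ × (Fin n → ℝ) → (Fin (n + 1) → ℝ) × ℝ := fun q =>
    (i.insertNth q.1 q.2, f q.1 + c q.2)
  have hΦ : Continuous Φ := (Continuous.finInsertNth (A := fun _ => ℝ) i continuous_fst
    continuous_snd).prodMk ((hf.comp continuous_fst).add (hc.comp continuous_snd))
  refine ofReal_le_dimH_of_closedBall_le ((ν.prod κ).map Φ) (C := C * 2 ^ n)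
    (by positivity) (by positivity) ?_ ?_
  · intro p ρ hρ hρ2
    rw [Measure.map_apply hΦ.measurable Metric.isClosed_closedBall.measurableSet,
      Measure.prod_apply_symm (hΦ.measurable Metric.isClosed_closedBall.measurableSet)]
    set q : Fin n → ℝ := fun j => p.1 (i.succAbove j) with hq
    calc ∫⁻ z, ν ((fun t => (t, z)) ⁻¹' (Φ ⁻¹' Metric.closedBall p ρ)) ∂κ
        ≤ ∫⁻ z, (Metric.closedBall q ρ).indicator
            (fun _ => ENNReal.ofReal (C * ρ ^ σ)) z ∂κ := by
          refine lintegral_mono fun z => ?_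
          by_cases hz : z ∈ Metric.closedBall q ρ
          · rw [indicator_of_mem hz]
            refine (measure_mono fun t ht => ?_).trans (h (p.1 i) (p.2 - c z) ρ hρ hρ2)
            have ht' : Φ (t, z) ∈ Metric.closedBall p ρ := ht
            rw [Metric.mem_closedBall, Prod.dist_eq, max_le_iff] at ht'
            refine ⟨?_, ?_⟩
            · have := (dist_le_pi_dist _ _ i).trans ht'.1
              simpa [Φ, Real.dist_eq] using this
            · have := ht'.2
              rw [Real.dist_eq] at this
              refine le_of_eq_of_le ?_ this
              congr 1
              simp only [Φ]
              ring
          · rw [indicator_of_notMem hz, nonpos_iff_eq_zero]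
            refine measure_mono_null (t := ∅) (fun t ht => hz ?_) measure_empty
            have ht' : Φ (t, z) ∈ Metric.closedBall p ρ := ht
            rw [Metric.mem_closedBall, Prod.dist_eq, max_le_iff] at ht'
            rw [Metric.mem_closedBall, dist_pi_le_iff hρ.le]
            intro j
            have := (dist_le_pi_dist _ _ (i.succAbove j)).trans ht'.1
            simpa [Φ, hq] using this
      _ = ENNReal.ofReal (C * ρ ^ σ) * κ (Metric.closedBall q ρ) :=
          lintegral_indicator_const Metric.isClosed_closedBall.measurableSet _
      _ ≤ ENNReal.ofReal (C * ρ ^ σ) * volume (Metric.closedBall q ρ) := by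
          gcongr
          exact Measure.restrict_le_self
      _ = ENNReal.ofReal (C * 2 ^ n * ρ ^ (σ + n)) := by
          rw [Real.volume_pi_closedBall _ hρ.le, ← ENNReal.ofReal_mul (by positivity),
            Real.rpow_add hρ, Real.rpow_natCast, Fintype.card_fin, mul_pow]
          congr 1
          ring
  · have h1 : (ν.prod κ) (Icc 0 1 ×ˢ Icc 0 1) = 1 := by
      rw [Measure.prod_prod, hκ, Measure.restrict_apply_self, Real.volume_Icc_pi,
        (prob_compl_eq_zero_iff measurableSet_Icc).1 hν]
      simp
    have h2 : (ν.prod κ) (Icc 0 1 ×ˢ Icc 0 1) ≤ (ν.prod κ).map Φ S :=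
      (measure_mono fun q hq => hS q.1 hq.1 q.2 hq.2).trans
        (Measure.le_map_apply hΦ.measurable.aemeasurable S)
    intro h0
    rw [h0, h1] at h2
    simp at h2

theorem abs_distInt_sub_le (a b : ℝ) : |distInt a - distInt b| ≤ |a - b| := by
  rw [distInt_eq_norm, distInt_eq_norm]
  refine (abs_norm_sub_norm_le _ _).trans ?_
  rw [← AddCircle.coe_sub, ← distInt_eq_norm]
  exact distInt_le_abs _

section

variable {d : ℕ} (β : Fin d → ℕ) {lam : ℝ}

theorem multiTakagi_term_nonneg (h0 : 0 < lam) (x : Fin d → ℝ) (n : ℕ) :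
    0 ≤ lam ^ n * ∑ i, distInt ((β i : ℝ) ^ n * x i) :=
  mul_nonneg (pow_nonneg h0.le n) (Finset.sum_nonneg fun _ _ => distInt_nonneg _)

theorem multiTakagi_term_le (h0 : 0 < lam) (x : Fin d → ℝ) (n : ℕ) :
    lam ^ n * ∑ i, distInt ((β i : ℝ) ^ n * x i) ≤ d * lam ^ n := by
  rw [mul_comm]
  refine mul_le_mul_of_nonneg_right ?_ (pow_nonneg h0.le n)
  refine (Finset.sum_le_sum (g := fun _ => 1) fun i _ => ?_).trans_eq (by simp)
  linarith [distInt_le_half ((β i : ℝ) ^ n * x i)]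

theorem summable_multiTakagi (h0 : 0 < lam) (h1 : lam < 1) (x : Fin d → ℝ) :
    Summable fun n : ℕ => lam ^ n * ∑ i, distInt ((β i : ℝ) ^ n * x i) :=
  Summable.of_nonneg_of_le (multiTakagi_term_nonneg β h0 x) (multiTakagi_term_le β h0 x)
    ((summable_geometric_of_lt_one h0.le h1).mul_left _)

theorem continuous_multiTakagi (h0 : 0 < lam) (h1 : lam < 1) :
    Continuous (multiTakagi d β lam) := by
  refine continuous_tsum (fun n => ?_)
    ((summable_geometric_of_lt_one h0.le h1).mul_left (d : ℝ)) fun n x => ?_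
  · exact continuous_const.mul (continuous_finsetSum _ fun i _ =>
      continuous_distInt.comp (continuous_const.mul (continuous_apply i)))
  · rw [Real.norm_of_nonneg (multiTakagi_term_nonneg β h0 x n)]
    exact multiTakagi_term_le β h0 x n

end

namespace Sys

variable (s : Sys)

theorem multiTakagi_insertNth {n : ℕ} (β : Fin (n + 1) → ℕ) (i : Fin (n + 1)) (hi : β i = s.B)
    (t : ℝ) (z : Fin n → ℝ) :
    multiTakagi (n + 1) β s.lam (i.insertNth t z)
      = s.H t + multiTakagi n (fun j => β (i.succAbove j)) s.lam z := by
  rw [H, multiTakagi, multiTakagi, ← (s.summable_H t).tsum_add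
    (summable_multiTakagi _ s.lam_pos s.lam_lt z)]
  refine tsum_congr fun k => ?_
  rw [Fin.sum_univ_succAbove _ i, mul_add]
  simp [hi]

theorem le_dimH_graph {n : ℕ} (β : Fin (n + 1) → ℕ) (i : Fin (n + 1)) (hi : β i = s.B) :
    ENNReal.ofReal (2 - s.ell / Real.log s.B + n) ≤
      dimH {p : (Fin (n + 1) → ℝ) × ℝ | (∀ i, p.1 i ∈ Icc (0 : ℝ) 1) ∧
        p.2 = multiTakagi (n + 1) β s.lam p.1} := by
  have h1 : s.ell / Real.log s.B < 1 := (div_lt_one s.logB_pos).2 s.ell_lt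
  have hlim : Tendsto (fun σ : ℝ => ENNReal.ofReal (σ + n))
      (𝓝[<] (2 - s.ell / Real.log s.B)) (𝓝 (ENNReal.ofReal (2 - s.ell / Real.log s.B + n))) :=
    ((ENNReal.continuous_ofReal.comp (continuous_add_const (n : ℝ))).tendsto _).mono_left
      nhdsWithin_le_nhds
  refine le_of_tendsto hlim ?_
  filter_upwards [Ioo_mem_nhdsLT (show (0 : ℝ) < 2 - s.ell / Real.log s.B by linarith)] with σ hσ
  obtain ⟨ν, hν, hν0, C, hC, h⟩ := s.exists_measure hσ.2
  refine le_dimH_graph_add i s.continuous_H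
    (continuous_multiTakagi (fun j => β (i.succAbove j)) s.lam_pos s.lam_lt) ν hν0 hC hσ.1.le h ?_
  intro t ht z hz
  refine ⟨fun j => ?_, (s.multiTakagi_insertNth β i hi t z).symm⟩
  refine Fin.succAboveCases i ?_ (fun k => ?_) j
  · simpa using ht
  · simpa using ⟨hz.1 k, hz.2 k⟩

theorem one_lt_lam_mul_B : 1 < s.lam * s.B := by
  have h := s.lt_lam
  rwa [inv_lt_iff_one_lt_mul₀ s.B_pos] at h

theorem abs_multiTakagi_sub_le {d : ℕ} {β : Fin d → ℕ} (hβ : ∀ i, β i ≤ s.B) (n : ℕ)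
    {x y : Fin d → ℝ} (hxy : ∀ i, |x i - y i| ≤ ((s.B : ℝ) ^ n)⁻¹) :
    |multiTakagi d β s.lam x - multiTakagi d β s.lam y|
      ≤ d * (1 / (s.lam * s.B - 1) + 1 / (1 - s.lam)) * s.lam ^ n := by
  have hl := s.lam_pos
  have hB := s.B_pos
  have hl1 := s.lam_lt
  have hlB := s.one_lt_lam_mul_B
  have hsx := summable_multiTakagi β s.lam_pos s.lam_lt x
  have hsy := summable_multiTakagi β s.lam_pos s.lam_lt y
  have hgeo := summable_geometric_of_lt_one hl.le hl1
  rw [multiTakagi, multiTakagi, ← hsx.tsum_sub hsy, ← (hsx.sub hsy).sum_add_tsum_nat_add n]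
  refine (abs_add_le _ _).trans ?_
  have h1 : |∑ k ∈ Finset.range n, (s.lam ^ k * ∑ i, distInt ((β i : ℝ) ^ k * x i)
      - s.lam ^ k * ∑ i, distInt ((β i : ℝ) ^ k * y i))|
      ≤ d * (1 / (s.lam * s.B - 1)) * s.lam ^ n := by
    calc _ ≤ ∑ k ∈ Finset.range n, d * ((s.B : ℝ) ^ n)⁻¹ * (s.lam * s.B) ^ k := by
          refine (Finset.abs_sum_le_sum_abs _ _).trans (Finset.sum_le_sum fun k _ => ?_)
          rw [← mul_sub, ← Finset.sum_sub_distrib, abs_mul, abs_of_pos (s.lam_pow_pos k), mul_pow]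
          have : |∑ i, (distInt ((β i : ℝ) ^ k * x i) - distInt ((β i : ℝ) ^ k * y i))|
              ≤ d * ((s.B : ℝ) ^ k * ((s.B : ℝ) ^ n)⁻¹) := by
            refine (Finset.abs_sum_le_sum_abs _ _).trans ((Finset.sum_le_sum
              (g := fun _ => (s.B : ℝ) ^ k * ((s.B : ℝ) ^ n)⁻¹) fun i _ => ?_).trans_eq (by simp))
            refine (abs_distInt_sub_le _ _).trans ?_
            rw [← mul_sub, abs_mul, abs_of_nonneg (by positivity : (0 : ℝ) ≤ (β i : ℝ) ^ k)]
            have hb : (β i : ℝ) ≤ s.B := by exact_mod_cast hβ i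
            gcongr
            exact hxy i
          have := mul_le_mul_of_nonneg_left this (s.lam_pow_pos k).le
          linarith
      _ = d * ((s.B : ℝ) ^ n)⁻¹ * (((s.lam * s.B) ^ n - 1) / (s.lam * s.B - 1)) := by
          rw [← Finset.mul_sum, geom_sum_eq hlB.ne']
      _ ≤ d * ((s.B : ℝ) ^ n)⁻¹ * ((s.lam * s.B) ^ n / (s.lam * s.B - 1)) := by
          have : 0 < s.lam * s.B - 1 := by linarith
          gcongr
          linarith
      _ = _ := by
          rw [mul_pow]
          field_simp
  have h2 : |∑' k, (s.lam ^ (k + n) * ∑ i, distInt ((β i : ℝ) ^ (k + n) * x i)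
      - s.lam ^ (k + n) * ∑ i, distInt ((β i : ℝ) ^ (k + n) * y i))|
      ≤ d * (1 / (1 - s.lam)) * s.lam ^ n := by
    have e : d * (1 / (1 - s.lam)) * s.lam ^ n = ∑' k, d * s.lam ^ n * s.lam ^ k := by
      rw [tsum_mul_left, tsum_geometric_of_lt_one hl.le hl1]
      ring
    rw [e, ← Real.norm_eq_abs]
    refine tsum_of_norm_bounded (hgeo.mul_left _).hasSum fun k => ?_
    rw [Real.norm_eq_abs, mul_assoc, ← pow_add, add_comm n k]
    have a1 := multiTakagi_term_nonneg β hl x (k + n)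
    have a2 := multiTakagi_term_nonneg β hl y (k + n)
    have a3 := multiTakagi_term_le β hl x (k + n)
    have a4 := multiTakagi_term_le β hl y (k + n)
    exact abs_sub_le_of_nonneg_of_le a1 a3 a2 a4
  linarith

theorem inv_pow_rpow (d n : ℕ) :
    (((s.B : ℝ) ^ n)⁻¹) ^ ((d : ℝ) + 1 - s.ell / Real.log s.B)
      = ((s.B : ℝ) ^ n)⁻¹ ^ (d + 1) * (s.lam ^ n)⁻¹ := by
  have hB := s.B_pos
  have hp : (0 : ℝ) < ((s.B : ℝ) ^ n)⁻¹ := by positivity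
  have hl := s.logB_pos
  rw [sub_eq_add_neg, Real.rpow_add hp, ← Nat.cast_add_one, Real.rpow_natCast]
  congr 1
  rw [Real.rpow_def_of_pos hp, Real.log_inv, Real.log_pow, ell, one_div, Real.log_inv]
  rw [← Real.exp_log (inv_pos.2 (s.lam_pow_pos n)), Real.log_inv, Real.log_pow]
  congr 1
  field_simp

theorem dimH_graph_le {d : ℕ} {β : Fin d → ℕ} (hβ : ∀ i, β i ≤ s.B) :
    dimH {p : (Fin d → ℝ) × ℝ | (∀ i, p.1 i ∈ Icc (0 : ℝ) 1) ∧
        p.2 = multiTakagi d β s.lam p.1}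
      ≤ ENNReal.ofReal ((d : ℝ) + 1 - s.ell / Real.log s.B) := by
  have hB := s.B_pos
  have hα : s.ell / Real.log s.B < 1 := (div_lt_one s.logB_pos).2 s.ell_lt
  have hD : 0 ≤ (d : ℝ) + 1 - s.ell / Real.log s.B := by
    have : (0 : ℝ) ≤ d := Nat.cast_nonneg d
    linarith
  set D : ℝ := (d : ℝ) + 1 - s.ell / Real.log s.B with hDdef
  set G := multiTakagi d β s.lam with hG
  obtain ⟨C, hC⟩ : ∃ C : ℝ, C = d * (1 / (s.lam * s.B - 1) + 1 / (1 - s.lam)) := ⟨_, rfl⟩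
  have hC0 : 0 ≤ C := by
    have h1 : 0 < s.lam * s.B - 1 := by linarith [s.one_lt_lam_mul_B]
    have h2 : 0 < 1 - s.lam := by linarith [s.lam_lt]
    rw [hC]
    positivity
  let M : ℕ → ℕ := fun n => ⌊2 * C * (s.lam * s.B) ^ n⌋₊ + 1
  let cell : ∀ n, (Fin d → Fin (s.B ^ n + 1)) × Fin (M n) → Set ((Fin d → ℝ) × ℝ) := fun n k =>
    {p | (∀ i, p.1 i ∈ Icc ((k.1 i : ℝ) * ((s.B : ℝ) ^ n)⁻¹)
        ((k.1 i : ℝ) * ((s.B : ℝ) ^ n)⁻¹ + ((s.B : ℝ) ^ n)⁻¹)) ∧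
      p.2 - G (fun i => (k.1 i : ℝ) * ((s.B : ℝ) ^ n)⁻¹) + C * s.lam ^ n ∈
        Icc ((k.2 : ℝ) * ((s.B : ℝ) ^ n)⁻¹)
          ((k.2 : ℝ) * ((s.B : ℝ) ^ n)⁻¹ + ((s.B : ℝ) ^ n)⁻¹)}
  have hdiam : ∀ n k, Metric.ediam (cell n k) ≤ ENNReal.ofReal ((s.B : ℝ) ^ n)⁻¹ := by
    intro n k
    refine Metric.ediam_le fun p hp q hq => ?_
    have hpos : (0 : ℝ) ≤ ((s.B : ℝ) ^ n)⁻¹ := by positivity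
    rw [edist_dist]
    refine ENNReal.ofReal_le_ofReal ?_
    rw [Prod.dist_eq, max_le_iff, dist_pi_le_iff hpos, Real.dist_eq]
    refine ⟨fun i => ?_, ?_⟩
    · have h1 := hp.1 i
      have h2 := hq.1 i
      rw [Real.dist_eq, abs_le]
      exact ⟨by linarith [h1.1, h2.2], by linarith [h1.2, h2.1]⟩
    · have h1 := hp.2
      have h2 := hq.2
      rw [abs_le]
      exact ⟨by linarith [h1.1, h2.2], by linarith [h1.2, h2.1]⟩
  have floor_mem : ∀ (n : ℕ) {t : ℝ}, 0 ≤ t → t ∈ Icc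
      ((⌊t * (s.B : ℝ) ^ n⌋₊ : ℝ) * ((s.B : ℝ) ^ n)⁻¹)
      ((⌊t * (s.B : ℝ) ^ n⌋₊ : ℝ) * ((s.B : ℝ) ^ n)⁻¹ + ((s.B : ℝ) ^ n)⁻¹) := by
    intro n t ht
    have hp : (0 : ℝ) < (s.B : ℝ) ^ n := by positivity
    have h1 := Nat.floor_le (show 0 ≤ t * (s.B : ℝ) ^ n by positivity)
    have h2 := (Nat.lt_floor_add_one (t * (s.B : ℝ) ^ n)).le
    rw [← div_eq_mul_inv, inv_eq_one_div, ← add_div]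
    exact ⟨(div_le_iff₀ hp).2 h1, (le_div_iff₀ hp).2 h2⟩
  have hcover : ∀ n, {p : (Fin d → ℝ) × ℝ | (∀ i, p.1 i ∈ Icc (0 : ℝ) 1) ∧ p.2 = G p.1}
      ⊆ ⋃ k, cell n k := by
    rintro n ⟨x, y⟩ ⟨hx, rfl : y = G x⟩
    simp only at hx
    have hp : (0 : ℝ) < (s.B : ℝ) ^ n := by positivity
    have hk : ∀ i, ⌊x i * (s.B : ℝ) ^ n⌋₊ < s.B ^ n + 1 := fun i => by
      rw [Nat.lt_succ_iff]
      refine Nat.floor_le_of_le ?_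
      push_cast
      exact mul_le_of_le_one_left hp.le (hx i).2
    let z : Fin d → ℝ := fun i => (⌊x i * (s.B : ℝ) ^ n⌋₊ : ℝ) * ((s.B : ℝ) ^ n)⁻¹
    have hxz : |G x - G z| ≤ C * s.lam ^ n := by
      rw [hC]
      refine s.abs_multiTakagi_sub_le hβ n fun i => ?_
      have := floor_mem n (hx i).1
      rw [abs_le]
      exact ⟨by linarith [this.1, inv_pos.2 hp], by linarith [this.2]⟩
    rw [abs_le] at hxz
    have h0 : 0 ≤ G x - G z + C * s.lam ^ n := by linarith [hxz.1]
    have hj : ⌊(G x - G z + C * s.lam ^ n) * (s.B : ℝ) ^ n⌋₊ < M n := by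
      refine Nat.lt_succ_of_le (Nat.floor_le_floor ?_)
      rw [mul_pow, ← mul_assoc]
      gcongr
      linarith [hxz.2]
    exact mem_iUnion.2 ⟨(fun i => ⟨_, hk i⟩, ⟨_, hj⟩), fun i => floor_mem n (hx i).1,
      floor_mem n h0⟩
  have hr : Tendsto (fun n : ℕ => ENNReal.ofReal ((s.B : ℝ) ^ n)⁻¹) atTop (𝓝 0) := by
    rw [← ENNReal.ofReal_zero]
    refine (ENNReal.continuous_ofReal.tendsto _).comp ?_
    simp_rw [← inv_pow]
    exact tendsto_pow_atTop_nhds_zero_of_lt_one (by positivity)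
      (inv_lt_one_of_one_lt₀ (by linarith [s.two_le_B]))
  have hsum : ∀ n, ∑ k, Metric.ediam (cell n k) ^ D ≤ ENNReal.ofReal (2 ^ d * (2 * C + 1)) := by
    intro n
    have hp : (0 : ℝ) < (s.B : ℝ) ^ n := by positivity
    have h1 : (1 : ℝ) ≤ (s.B : ℝ) ^ n := one_le_pow₀ (by linarith [s.two_le_B])
    have h2 : (1 : ℝ) ≤ (s.lam * s.B) ^ n := one_le_pow₀ s.one_lt_lam_mul_B.le
    have h3 := s.lam_pow_pos n
    calc ∑ k, Metric.ediam (cell n k) ^ D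
        ≤ ∑ k : (Fin d → Fin (s.B ^ n + 1)) × Fin (M n),
            ENNReal.ofReal ((((s.B : ℝ) ^ n)⁻¹) ^ D) := by
          refine Finset.sum_le_sum fun k _ => ?_
          rw [← ENNReal.ofReal_rpow_of_nonneg (by positivity) hD]
          exact ENNReal.rpow_le_rpow (hdiam n k) hD
      _ = ENNReal.ofReal (((s.B : ℝ) ^ n + 1) ^ d * M n * (((s.B : ℝ) ^ n)⁻¹) ^ D) := by
          rw [Finset.sum_const, nsmul_eq_mul, ENNReal.ofReal_mul (by positivity)]
          congr 1
          rw [← ENNReal.ofReal_natCast]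
          simp
      _ ≤ _ := by
          refine ENNReal.ofReal_le_ofReal ?_
          rw [hDdef, s.inv_pow_rpow]
          have hM : (M n : ℝ) ≤ (2 * C + 1) * (s.lam ^ n * (s.B : ℝ) ^ n) := by
            have := Nat.floor_le (show 0 ≤ 2 * C * (s.lam * s.B) ^ n by positivity)
            simp only [M]
            push_cast
            rw [← mul_pow]
            linarith
          calc ((s.B : ℝ) ^ n + 1) ^ d * M n * (((s.B : ℝ) ^ n)⁻¹ ^ (d + 1) * (s.lam ^ n)⁻¹)
              ≤ (2 * (s.B : ℝ) ^ n) ^ d * ((2 * C + 1) * (s.lam ^ n * (s.B : ℝ) ^ n)) *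
                (((s.B : ℝ) ^ n)⁻¹ ^ (d + 1) * (s.lam ^ n)⁻¹) := by
                gcongr
                linarith
            _ = 2 ^ d * (2 * C + 1) := by
                rw [inv_pow, pow_succ, mul_pow]
                field_simp
  have hfin := (Measure.hausdorffMeasure_le_liminf_sum D _ _ hr cell
    (Eventually.of_forall hdiam) (Eventually.of_forall hcover)).trans
    (liminf_le_liminf (Eventually.of_forall hsum))
  rw [liminf_const] at hfin
  have hne : μH[((⟨D, hD⟩ : NNReal) : ℝ)]
      {p : (Fin d → ℝ) × ℝ | (∀ i, p.1 i ∈ Icc (0 : ℝ) 1) ∧ p.2 = G p.1} ≠ ⊤ :=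
    (hfin.trans_lt ENNReal.ofReal_lt_top).ne
  have := dimH_le_of_hausdorffMeasure_ne_top hne
  rwa [ENNReal.ofReal, Real.toNNReal_of_nonneg hD]

end Sys

end Takagi

/-- **Theorem (multivariable Takagi function).** Let `d ≥ 1`, `D = diag(β₁,…,β_d)` with
`β_i ≥ 2` integers, and `(max_i β_i)⁻¹ < λ < 1`.  Then the Hausdorff dimension of the graph
of `G_{λ,D}` equals `d + 1 + log λ / log (max_i β_i)`. -/
theorem stmt17 (d : ℕ) (hd : 1 ≤ d) (β : Fin d → ℕ) (hβ : ∀ i, 2 ≤ β i)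
    (lam : ℝ) (hlam1 : lam < 1)
    (hlam0 : ((Finset.univ.sup β : ℕ) : ℝ)⁻¹ < lam) :
    dimH {p : (Fin d → ℝ) × ℝ | (∀ i, p.1 i ∈ Icc (0 : ℝ) 1) ∧
        p.2 = multiTakagi d β lam p.1}
      = ENNReal.ofReal (d + 1 + Real.log lam / Real.log ((Finset.univ.sup β : ℕ) : ℝ)) := by
  obtain ⟨n, rfl⟩ : ∃ n, d = n + 1 := ⟨d - 1, by omega⟩
  obtain ⟨i, -, hi⟩ := Finset.exists_mem_eq_sup Finset.univ Finset.univ_nonempty β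
  let s : Takagi.Sys := ⟨Finset.univ.sup β, lam, hi ▸ hβ i, hlam1, hlam0⟩
  have hupper := s.dimH_graph_le (β := β) fun j => Finset.le_sup (Finset.mem_univ j)
  have hlower := s.le_dimH_graph β i hi.symm
  have e : s.ell / Real.log s.B
      = -(Real.log lam / Real.log ((Finset.univ.sup β : ℕ) : ℝ)) := by
    rw [Takagi.Sys.ell, one_div, Real.log_inv, neg_div]
  rw [e] at hupper hlower
  refine le_antisymm (hupper.trans_eq ?_) (le_of_eq_of_le ?_ hlower) <;> congr 1
  · ring
  · push_cast
    ring
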